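/- Let (X,T) and (Y,S) be uniquely ergodic minimal Cantor dynamical systems with unique invariant Borel probability measures μ and ν respectively. Then (X,T) and (Y,S) are orbit equivalent if and only if S(μ) = S(ν), where S(μ) = {μ(A) : A a clopen subset of X} is the clopen values set of μ. -/

import Mathlib

open MeasureTheory

/-- The `T`-orbit of a point under a homeomorphism `T`. -/
def Homeomorph.orbit {X : Type} [TopologicalSpace X] (T : X ≃ₜ X) (x : X) : Set X :=
  Set.range fun n : ℤ => (T.toEquiv ^ n) x

/-- Two Cantor systems are orbit equivalent if a homeomorphism maps orbits onto orbits. -/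
def OrbitEquivalent {X Y : Type} [TopologicalSpace X] [TopologicalSpace Y]
    (T : X ≃ₜ X) (S : Y ≃ₜ Y) : Prop :=
  ∃ h : X ≃ₜ Y, ∀ x : X, (h : X → Y) '' T.orbit x = S.orbit (h x)

/-- The clopen values set of a measure. -/
def clopenValues {X : Type} [TopologicalSpace X] [MeasurableSpace X]
    (μ : Measure X) : Set ENNReal :=
  { r | ∃ A : Set X, IsClopen A ∧ μ A = r }

/-! ### Tower systems -/

/-- An increasing sequence of finite equivalence relations on a Cantor space together with locally
constant retractions `θ n` onto finitely many template classes, a functional `I` on integer valued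
continuous functions and a convergent family of marked points. -/
structure TowerSys (X : Type) [TopologicalSpace X] where
  I : LocallyConstant X ℤ →+ ℝ
  E : ℕ → Setoid X
  cls : ℕ → X → Finset X
  mem_cls : ∀ {n x y}, y ∈ cls n x ↔ E n x y
  mono : ∀ {m n x y}, m ≤ n → E m x y → E n x y
  θ : ℕ → LocallyConstant X X
  θ_inj : ∀ {n x y}, E n x y → θ n x = θ n y → x = y
  θ_rel : ∀ {m n x y}, m ≤ n → E n x y → (E m x y ↔ E m (θ n x) (θ n y))
  θ_lift : ∀ {n x z}, E n (θ n x) z → ∃ y, E n x y ∧ θ n y = z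
  θ_comp : ∀ {m n}, m ≤ n → ∀ x, θ m (θ n x) = θ m x
  θ_mem : ∀ A : Set X, IsClopen A → ∃ N, ∀ n ≥ N, ∀ x, θ n x ∈ A ↔ x ∈ A
  pos : ∀ f : LocallyConstant X ℤ, 0 < I f → ∃ N, ∀ n ≥ N, ∀ x, 0 < ∑ y ∈ cls n x, f y
  I_pos : ∀ (f : LocallyConstant X ℤ) (x : X), (∀ y, 0 ≤ f y) → 0 < f x → 0 < I f
  E_zero : ∀ {x y}, E 0 x y → x = y
  stab : ∀ n M, n ≤ M → ∀ z, ∃ α ∈ AddSubgroup.closure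
      (Set.range fun x => ∑ y ∈ cls M x, Pi.evalAddMonoidHom (fun _ : X => ℤ) y),
    ∀ φ : X → ℤ, α (fun x => φ (θ n x)) = ∑ y ∈ cls n z, φ (θ n y)
  free : ∀ n, ∃ δ : LocallyConstant X ℤ, I δ = 0 ∧ ∃ N, ∀ M ≥ N, ∃ α ∈ AddSubgroup.closure
      (Set.range fun x => ∑ y ∈ cls M x, Pi.evalAddMonoidHom (fun _ : X => ℤ) y),
    (∀ φ : X → ℤ, α (fun x => φ (θ n x)) = 0) ∧ α δ = 1
  ξ : ℕ × Bool → X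
  ξ_inj : Function.Injective ξ
  ξ_tendsto : ∀ b, ∀ A : Set X, IsClopen A → ξ (0, b) ∈ A → ∃ N, ∀ j ≥ N, ξ (j, b) ∈ A
  ξ_sparse : ∀ n, ∃ Q : Set X, IsClopen Q ∧ (∀ i, ξ i ∈ Q) ∧
    ∀ x y, x ∈ Q → y ∈ Q → E n x y → x = y

/-- Finite intersections of conditions that hold eventually. -/
theorem exists_forall_ge_of_finite {ι : Type*} (s : Set ι) (hs : s.Finite) (P : ι → ℕ → Prop)
    (h : ∀ i ∈ s, ∃ N, ∀ n ≥ N, P i n) : ∃ N, ∀ n ≥ N, ∀ i ∈ s, P i n := by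
  have := (Set.Finite.eventually_all (l := Filter.atTop) (p := fun i n => P i n) hs).2
    (fun i hi => Filter.eventually_atTop.2 (h i hi))
  exact Filter.eventually_atTop.1 this

open Classical in
/-- The integer valued indicator of a level set of a locally constant function. -/
noncomputable def LocallyConstant.level {X α : Type*} [TopologicalSpace X]
    (c : LocallyConstant X α) (a : α) : LocallyConstant X ℤ :=
  c.map fun b => if b = a then 1 else 0

theorem LocallyConstant.level_apply {X α : Type*} [TopologicalSpace X] [DecidableEq α]
    (c : LocallyConstant X α) (a : α) (x : X) : c.level a x = if c x = a then 1 else 0 := by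
  simp only [level, map_apply, Function.comp_apply]
  congr

theorem LocallyConstant.coe_finsetSum {X ι : Type*} [TopologicalSpace X] (s : Finset ι)
    (f : ι → LocallyConstant X ℤ) : (⇑(∑ i ∈ s, f i) : X → ℤ) = ∑ i ∈ s, ⇑(f i) :=
  map_sum (LocallyConstant.coeFnAddMonoidHom (X := X) (Y := ℤ)) f s

namespace TowerSys

variable {X : Type} [TopologicalSpace X] (S : TowerSys X)

/-- Summation over an equivalence class. -/
noncomputable def ev (M : ℕ) (x : X) : (X → ℤ) →+ ℤ :=
  ∑ y ∈ S.cls M x, Pi.evalAddMonoidHom (fun _ : X => ℤ) y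

theorem ev_apply (M : ℕ) (x : X) (f : X → ℤ) : S.ev M x f = ∑ y ∈ S.cls M x, f y := by
  simp [ev]

/-- The group generated by the class summations at level `M`. -/
noncomputable def evGroup (M : ℕ) : AddSubgroup ((X → ℤ) →+ ℤ) :=
  AddSubgroup.closure (Set.range (S.ev M))

theorem exists_stab {n M : ℕ} (h : n ≤ M) (z : X) : ∃ α ∈ S.evGroup M,
    ∀ φ : X → ℤ, α (fun x => φ (S.θ n x)) = S.ev n z (fun x => φ (S.θ n x)) := by
  obtain ⟨α, hα, h⟩ := S.stab n M h z
  exact ⟨α, hα, fun φ => by rw [h, ev_apply]⟩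

theorem exists_free (n : ℕ) : ∃ δ : LocallyConstant X ℤ, S.I δ = 0 ∧ ∃ N, ∀ M ≥ N,
    ∃ α ∈ S.evGroup M, (∀ φ : X → ℤ, α (fun x => φ (S.θ n x)) = 0) ∧ α δ = 1 :=
  S.free n

theorem cls_eq {n : ℕ} {x y : X} (h : S.E n x y) : S.cls n x = S.cls n y := by
  ext z
  rw [S.mem_cls, S.mem_cls]
  exact ⟨fun hz => (S.E n).trans ((S.E n).symm h) hz, fun hz => (S.E n).trans h hz⟩

theorem ev_eq {n : ℕ} {x y : X} (h : S.E n x y) : S.ev n x = S.ev n y := by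
  rw [ev, ev, S.cls_eq h]

theorem ev_congr {m n : ℕ} (hmn : m ≤ n) {f g : X → ℤ} (h : ∀ x, S.ev m x f = S.ev m x g)
    (x : X) : S.ev n x f = S.ev n x g := by
  classical
  rw [ev_apply, ev_apply, Finset.sum_partition (S.E m), Finset.sum_partition (S.E m)]
  refine Finset.sum_congr rfl fun q hq => ?_
  obtain ⟨y, hy, rfl⟩ := Finset.mem_image.1 hq
  have : {z ∈ S.cls n x | (Quotient.mk (S.E m) z) = Quotient.mk (S.E m) y} = S.cls m y := by
    ext z
    rw [Finset.mem_filter, S.mem_cls, S.mem_cls, Quotient.eq (r := S.E m)]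
    refine ⟨fun hz => (S.E m).symm hz.2, fun hz => ⟨?_, (S.E m).symm hz⟩⟩
    exact (S.E n).trans (S.mem_cls.1 hy) (S.mono hmn hz)
  rw [this, ← ev_apply, ← ev_apply, h]

theorem evGroup_congr {m n : ℕ} (hmn : m ≤ n) {f g : X → ℤ} (h : ∀ x, S.ev m x f = S.ev m x g)
    {α : (X → ℤ) →+ ℤ} (hα : α ∈ S.evGroup n) : α f = α g := by
  induction hα using AddSubgroup.closure_induction with
  | mem x hx => obtain ⟨y, rfl⟩ := hx; exact S.ev_congr hmn h y
  | zero => rfl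
  | add a b _ _ ha hb => rw [AddMonoidHom.add_apply, AddMonoidHom.add_apply, ha, hb]
  | neg a _ ha => rw [AddMonoidHom.neg_apply, AddMonoidHom.neg_apply, ha]

theorem I_le_zero_of_ev {n : ℕ} {f : LocallyConstant X ℤ} (x : X)
    (h : ∀ x, S.ev n x f = 0) : S.I f ≤ 0 := by
  by_contra! hf
  obtain ⟨N, hN⟩ := S.pos f hf
  have h1 := hN (max n N) (le_max_right _ _) x
  have h2 := S.ev_congr (m := n) (n := max n N) (le_max_left _ _) (f := f) (g := 0)
    (by simpa using h) x
  rw [ev_apply] at h2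
  simp only [map_zero] at h2
  omega

theorem I_congr {n : ℕ} {f g : LocallyConstant X ℤ} (x : X)
    (h : ∀ x, S.ev n x f = S.ev n x g) : S.I f = S.I g := by
  have key : ∀ f g : LocallyConstant X ℤ, (∀ x, S.ev n x f = S.ev n x g) → S.I f ≤ S.I g := by
    intro f g h
    have := S.I_le_zero_of_ev (f := f - g) (n := n) x (fun x => by
      rw [LocallyConstant.coe_sub, map_sub, h, sub_self])
    rw [map_sub] at this
    linarith
  exact le_antisymm (key f g h) (key g f fun x => (h x).symm)

theorem θ_rel_self {n : ℕ} {x y : X} (h : S.E n x y) : S.E n (S.θ n x) (S.θ n y) :=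
  (S.θ_rel le_rfl h).1 h

theorem ev_θ {m n : ℕ} (hmn : m ≤ n) {f : X → ℤ} (hf : ∀ x, f (S.θ n x) = f x) (x : X) :
    S.ev m (S.θ n x) f = S.ev m x f := by
  rw [ev_apply, ev_apply]
  symm
  refine Finset.sum_bij (fun y _ => S.θ n y) ?_ ?_ ?_ ?_
  · intro y hy
    rw [S.mem_cls] at hy ⊢
    exact (S.θ_rel hmn (S.mono hmn hy)).1 hy
  · intro y hy z hz h
    rw [S.mem_cls] at hy hz
    exact S.θ_inj ((S.E n).trans ((S.E n).symm (S.mono hmn hy)) (S.mono hmn hz)) h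
  · intro z hz
    rw [S.mem_cls] at hz
    obtain ⟨y, hy, rfl⟩ := S.θ_lift (S.mono hmn hz)
    exact ⟨y, S.mem_cls.2 ((S.θ_rel hmn hy).2 hz), rfl⟩
  · intro y _
    exact (hf y).symm

variable [CompactSpace X]

theorem exists_forall_θ_eq {α : Type*} (f : LocallyConstant X α) :
    ∃ N, ∀ n ≥ N, ∀ x, f (S.θ n x) = f x := by
  obtain ⟨N, hN⟩ := exists_forall_ge_of_finite (Set.range f) f.isLocallyConstant.range_finite
    (fun a n => ∀ x, S.θ n x ∈ f ⁻¹' {a} ↔ x ∈ f ⁻¹' {a})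
    (fun a _ => S.θ_mem _ (f.isLocallyConstant.isClopen_fiber a))
  exact ⟨N, fun n hn x => (hN n hn (f x) ⟨x, rfl⟩ x).2 rfl⟩

theorem exists_free_family (n k : ℕ) : ∃ δ : ℕ → LocallyConstant X ℤ, (∀ i, S.I (δ i) = 0) ∧
    ∃ N, ∀ M ≥ N, ∀ t : ℕ → ℤ, ∃ α ∈ S.evGroup M,
      (∀ φ : X → ℤ, α (fun x => φ (S.θ n x)) = 0) ∧ ∀ i < k, α (δ i) = t i := by
  induction k with
  | zero => exact ⟨0, fun i => map_zero _, 0, fun M _ t => ⟨0, zero_mem _, by simp⟩⟩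
  | succ k ih =>
    obtain ⟨δ, hδ, N, hN⟩ := ih
    obtain ⟨n₁, hn₁⟩ := exists_forall_ge_of_finite (Set.Iio k) (Set.finite_Iio k)
      (fun i n => ∀ x, δ i (S.θ n x) = δ i x) (fun i _ => S.exists_forall_θ_eq (δ i))
    obtain ⟨ε, hε, N', hN'⟩ := S.exists_free (max n n₁)
    refine ⟨Function.update δ k ε, fun i => ?_, max N N', fun M hM t => ?_⟩
    · by_cases h : i = k
      · subst h; simpa using hε
      · simpa [h] using hδ i
    · obtain ⟨α, hα, hα0, hαt⟩ := hN M (le_trans (le_max_left _ _) hM) t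
      obtain ⟨β, hβ, hβ0, hβ1⟩ := hN' M (le_trans (le_max_right _ _) hM)
      refine ⟨α + (t k - α ε) • β, add_mem hα (zsmul_mem hβ _), fun φ => ?_, fun i hi => ?_⟩
      · have := hβ0 (fun x => φ (S.θ n x))
        simp only [S.θ_comp (le_max_left n n₁)] at this
        rw [AddMonoidHom.add_apply, hα0, AddMonoidHom.zsmul_apply, this]
        simp
      · rw [AddMonoidHom.add_apply, AddMonoidHom.zsmul_apply]
        by_cases h : i = k
        · subst h; simp [hβ1]
        · have hik : i < k := by omega
          have h0 := hβ0 (δ i)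
          have : (fun x => δ i (S.θ (max n n₁) x)) = δ i :=
            funext fun x => hn₁ _ (le_max_right _ _) i hik x
          rw [this] at h0
          simp [h, h0, hαt i hik]

end TowerSys

/-! ### Lifting decompositions and matching towers -/

theorem TowerSys.exists_lift {X : Type} [TopologicalSpace X] [CompactSpace X] (S : TowerSys X)
    {V J : Type} [Fintype V] [DecidableEq V] [Fintype J] (u : V → LocallyConstant X ℤ)
    (hu : ∃ N, ∀ M ≥ N, ∀ v, ∃ α ∈ S.evGroup M, ∀ w, α (u w) = if w = v then 1 else 0)
    (K L : J → V → ℤ) (hL : ∀ v w, ∑ j, K j w * L j v = if v = w then 1 else 0)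
    (m : J → ℝ) (hm : ∀ v, ∑ j, K j v • m j = S.I (u v)) (hr : ∀ j, ∃ g, S.I g = m j) :
    ∃ f : J → LocallyConstant X ℤ, (∀ v, ∑ j, K j v • f j = u v) ∧ (∀ j, S.I (f j) = m j) ∧
      ∃ N, ∀ M ≥ N, ∀ t : J → ℤ, ∃ α ∈ S.evGroup M, ∀ j, α (f j) = t j := by
  classical
  choose g hg using hr
  obtain ⟨N₀, hN₀⟩ := hu
  obtain ⟨n₁, hn₁⟩ := exists_forall_ge_of_finite (Set.univ : Set V) Set.finite_univ
      (fun i n => ∀ x, u i (S.θ n x) = u i x) (fun i _ => S.exists_forall_θ_eq (u i))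
  obtain ⟨n₂, hn₂⟩ := exists_forall_ge_of_finite (Set.univ : Set J) Set.finite_univ
      (fun i n => ∀ x, g i (S.θ n x) = g i x) (fun i _ => S.exists_forall_θ_eq (g i))
  obtain ⟨δ, hδ, N₁, hN₁⟩ := S.exists_free_family (max n₁ n₂) (Fintype.card J)
  let e := Fintype.equivFin J
  let h : J → LocallyConstant X ℤ := fun j => g j + δ (e j)
  refine ⟨fun j => h j + ∑ v, L j v • (u v - ∑ i, K i v • h i), fun w => ?_, fun j => ?_,
    max N₀ N₁, fun M hM t => ?_⟩
  · simp only [smul_add, Finset.sum_add_distrib, Finset.smul_sum, smul_smul]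
    rw [Finset.sum_comm]
    simp only [← Finset.sum_smul, hL]
    simp
  · have h1 : ∀ i, S.I (h i) = m i := fun i => by simp [h, hg, hδ]
    simp only [map_add, map_sum, map_zsmul, map_sub, h1, hm, sub_self]
    simp
  · have hM0 := le_trans (le_max_left _ _) hM
    choose a ha hav using hN₀ M hM0
    let A : (X → ℤ) →+ ℤ := ∑ v, (∑ j, K j v * t j) • a v
    have hA : A ∈ S.evGroup M := sum_mem fun v _ => zsmul_mem (ha v) _
    have hAu : ∀ w, A (u w) = ∑ j, K j w * t j := fun w => by
      simp [A, AddMonoidHom.finsetSum_apply, hav]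
    obtain ⟨β, hβ, hβ0, hβ1⟩ := hN₁ M (le_trans (le_max_right _ _) hM)
      (fun i => if hi : i < Fintype.card J then
        t (e.symm ⟨i, hi⟩) - A (g (e.symm ⟨i, hi⟩)) - A (δ i) else 0)
    have hβu : ∀ v, β (u v) = 0 := fun v => by
      rw [← hβ0 (u v)]; congr 1; funext x
      exact (hn₁ _ (le_max_left _ _) v trivial x).symm
    have hβg : ∀ v, β (g v) = 0 := fun v => by
      rw [← hβ0 (g v)]; congr 1; funext x
      exact (hn₂ _ (le_max_right _ _) v trivial x).symm
    refine ⟨A + β, add_mem hA hβ, fun j => ?_⟩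
    let Φ : LocallyConstant X ℤ →+ ℤ := (A + β).comp LocallyConstant.coeFnAddMonoidHom
    have hΦ : ∀ f : LocallyConstant X ℤ, Φ f = A f + β f := fun f => rfl
    have hh : ∀ i, Φ (h i) = t i := fun i => by
      simp only [h, map_add]
      rw [hΦ, hΦ, hβg, hβ1 _ (e i).2]
      simp
    have hΦu : ∀ w, Φ (u w) = ∑ j, K j w * t j := fun w => by rw [hΦ, hAu, hβu, add_zero]
    change Φ (h j + ∑ v, L j v • (u v - ∑ i, K i v • h i)) = t j
    simp only [map_add, map_sum, map_zsmul, map_sub, hh, hΦu]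
    simp

theorem Finset.exists_mapsTo_injOn {A B : Type*} {s : Finset A} {t : Finset B}
    (h : s.card = t.card) {x : A} {p : B} (hx : x ∈ s) (hp : p ∈ t) :
    ∃ g : A → B, (∀ y ∈ s, g y ∈ t) ∧ (∀ y ∈ s, ∀ z ∈ s, g y = g z → y = z) ∧ g x = p := by
  classical
  let e := (Finset.equivOfCardEq h).trans (Equiv.swap (Finset.equivOfCardEq h ⟨x, hx⟩) ⟨p, hp⟩)
  refine ⟨fun y => if hy : y ∈ s then e ⟨y, hy⟩ else p, fun y hy => ?_, fun y hy z hz hyz => ?_, ?_⟩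
  · simp only [hy, dite_true]
    exact (e ⟨y, hy⟩).2
  · simp only [hy, hz, dite_true] at hyz
    simpa using e.injective (Subtype.ext hyz)
  · simp [hx, e]

/-- Two finite sets tiled by towers of the same types, with equally many points of each code,
are matched by a bijection respecting towers and codes; the image of one point can be prescribed. -/
theorem exists_tower_matching {A B : Type*} (C : Finset A) (P : Finset B) (r : Setoid A)
    (r' : Setoid B) (c : A → ℕ) (c' : B → ℕ) (tw : ℕ → ℕ) (R : Set ℕ)
    (hR : ∀ x ∈ C, c x ∈ R)
    (htw : ∀ x ∈ C, ∀ y ∈ C, r x y → tw (c x) = tw (c y))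
    (hinj : ∀ x ∈ C, ∀ y ∈ C, r x y → c x = c y → x = y)
    (hfull : ∀ x ∈ C, ∀ l ∈ R, tw l = tw (c x) → ∃ y ∈ C, r x y ∧ c y = l)
    (hinj' : ∀ x ∈ P, ∀ y ∈ P, r' x y → c' x = c' y → x = y)
    (hfull' : ∀ x ∈ P, ∀ l ∈ R, tw l = tw (c' x) → ∃ y ∈ P, r' x y ∧ c' y = l)
    (hcard : ∀ l, {x ∈ C | c x = l}.card = {x ∈ P | c' x = l}.card)
    {x₀ : A} {p₀ : B} (hx₀ : x₀ ∈ C) (hp₀ : p₀ ∈ P) (h₀ : c x₀ = c' p₀) :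
    ∃ β : A → B, (∀ x ∈ C, β x ∈ P ∧ c' (β x) = c x) ∧
      (∀ x ∈ C, ∀ y ∈ C, β x = β y → x = y) ∧ (∀ p ∈ P, ∃ x ∈ C, β x = p) ∧
      (∀ x ∈ C, ∀ y ∈ C, r x y → r' (β x) (β y)) ∧ β x₀ = p₀ := by
  classical
  have hbase : ∃ b : ℕ → ℕ, b (tw (c x₀)) = c x₀ ∧
      ∀ x ∈ C, b (tw (c x)) ∈ R ∧ tw (b (tw (c x))) = tw (c x) := by
    have : ∀ v, ∃ l, (v = tw (c x₀) → l = c x₀) ∧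
        ((∃ x ∈ C, tw (c x) = v) → l ∈ R ∧ tw l = v) := by
      intro v
      by_cases hv : v = tw (c x₀)
      · exact ⟨c x₀, fun _ => rfl, fun _ => ⟨hR _ hx₀, hv.symm⟩⟩
      · by_cases hx : ∃ x ∈ C, tw (c x) = v
        · obtain ⟨x, hx, h⟩ := hx
          exact ⟨c x, fun h => absurd h hv, fun _ => ⟨hR x hx, h⟩⟩
        · exact ⟨0, fun h => absurd h hv, fun h => absurd h hx⟩
    choose b hb hb' using this
    exact ⟨b, hb _ rfl, fun x hx => hb' _ ⟨x, hx, rfl⟩⟩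
  obtain ⟨b, hb₀, hb⟩ := hbase
  have hk : ∀ x, ∃ y, x ∈ C → y ∈ C ∧ r x y ∧ c y = b (tw (c x)) := by
    intro x
    by_cases hx : x ∈ C
    · obtain ⟨y, hy⟩ := hfull x hx _ (hb x hx).1 (hb x hx).2
      exact ⟨y, fun _ => hy⟩
    · exact ⟨x, fun h => absurd h hx⟩
  choose k hk using hk
  have hγ : ∃ γ : A → B, (∀ x ∈ C, γ x ∈ P ∧ c' (γ x) = c x) ∧
      (∀ x ∈ C, ∀ y ∈ C, γ x = γ y → x = y) ∧ γ x₀ = p₀ := by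
    have : ∀ l, ∃ g : A → B, (∀ x ∈ C, c x = l → g x ∈ P ∧ c' (g x) = l) ∧
        (∀ x ∈ C, ∀ y ∈ C, c x = l → c y = l → g x = g y → x = y) ∧
        (l = c x₀ → g x₀ = p₀) := by
      intro l
      by_cases hl : l = c x₀
      · obtain ⟨g, h1, h2, h3⟩ := Finset.exists_mapsTo_injOn (hcard l) (x := x₀) (p := p₀)
          (by simp [hx₀, hl]) (by simp [hp₀, hl, h₀])
        simp only [Finset.mem_filter] at h1 h2
        exact ⟨g, fun x hx hxl => h1 x ⟨hx, hxl⟩,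
          fun x hx y hy hxl hyl h => h2 x ⟨hx, hxl⟩ y ⟨hy, hyl⟩ h, fun _ => h3⟩
      · by_cases hx : ∃ x ∈ C, c x = l
        · obtain ⟨x, hx, hxl⟩ := hx
          have : 0 < {x ∈ P | c' x = l}.card := by
            rw [← hcard]
            exact Finset.card_pos.2 ⟨x, by simp [hx, hxl]⟩
          obtain ⟨p, hp⟩ := Finset.card_pos.1 this
          obtain ⟨g, h1, h2, h3⟩ := Finset.exists_mapsTo_injOn (hcard l) (x := x) (p := p)
            (by simp [hx, hxl]) hp
          simp only [Finset.mem_filter] at h1 h2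
          exact ⟨g, fun x hx hxl => h1 x ⟨hx, hxl⟩,
            fun x hx y hy hxl hyl h => h2 x ⟨hx, hxl⟩ y ⟨hy, hyl⟩ h, fun h => absurd h hl⟩
        · push Not at hx
          exact ⟨fun _ => p₀, fun x h h' => absurd h' (hx x h),
            fun x h _ _ h' => absurd h' (hx x h), fun h => absurd h hl⟩
    choose g h1 h2 h3 using this
    refine ⟨fun x => g (c x) x, fun x hx => h1 _ x hx rfl, fun x hx y hy h => ?_, h3 _ rfl⟩
    replace h : g (c x) x = g (c y) y := h
    have h4 : c x = c y := by
      rw [← (h1 _ x hx rfl).2, ← (h1 _ y hy rfl).2, h]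
    rw [← h4] at h
    exact h2 (c x) x hx y hy rfl h4.symm h
  obtain ⟨γ, hγ, hγi, hγ₀⟩ := hγ
  have hm : ∀ x, ∃ p, x ∈ C → p ∈ P ∧ r' (γ (k x)) p ∧ c' p = c x := by
    intro x
    by_cases hx : x ∈ C
    · obtain ⟨hkC, hkr, hkc⟩ := hk x hx
      obtain ⟨p, hp⟩ := hfull' (γ (k x)) (hγ _ hkC).1 (c x) (hR x hx) (by
        rw [(hγ _ hkC).2, hkc, (hb x hx).2])
      exact ⟨p, fun _ => hp⟩
    · exact ⟨p₀, fun h => absurd h hx⟩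
  choose β hβ using hm
  have hinjβ : ∀ x ∈ C, ∀ y ∈ C, β x = β y → x = y := by
    intro x hx y hy h
    have hc : c x = c y := by rw [← (hβ x hx).2.2, ← (hβ y hy).2.2, h]
    obtain ⟨hkC, hkr, hkc⟩ := hk x hx
    obtain ⟨hkC', hkr', hkc'⟩ := hk y hy
    have h1 : γ (k x) = γ (k y) := by
      refine hinj' _ (hγ _ hkC).1 _ (hγ _ hkC').1 (r'.trans (hβ x hx).2.1 ?_) ?_
      · rw [h]; exact r'.symm (hβ y hy).2.1
      · rw [(hγ _ hkC).2, (hγ _ hkC').2, hkc, hkc', hc]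
    have h2 := hγi _ hkC _ hkC' h1
    refine hinj x hx y hy (r.trans hkr ?_) hc
    rw [h2]; exact r.symm hkr'
  refine ⟨β, fun x hx => ⟨(hβ x hx).1, (hβ x hx).2.2⟩, hinjβ, ?_, ?_, ?_⟩
  · have hcP : C.card = P.card := by
      rw [Finset.card_eq_sum_card_fiberwise (f := c) (t := C.image c ∪ P.image c')
          (fun x hx => by
            simp only [Finset.coe_union, Finset.coe_image]
            exact Or.inl ⟨x, hx, rfl⟩),
        Finset.card_eq_sum_card_fiberwise (f := c') (t := C.image c ∪ P.image c')
          (fun x hx => by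
            simp only [Finset.coe_union, Finset.coe_image]
            exact Or.inr ⟨x, hx, rfl⟩)]
      exact Finset.sum_congr rfl fun l _ => hcard l
    have himg : C.image β = P := by
      refine Finset.eq_of_subset_of_card_le (fun p hp => ?_) ?_
      · obtain ⟨x, hx, rfl⟩ := Finset.mem_image.1 hp
        exact (hβ x hx).1
      · rw [Finset.card_image_of_injOn (fun x hx y hy h => hinjβ x hx y hy h), hcP]
    intro p hp
    rw [← himg] at hp
    simpa using hp
  · intro x hx y hy hxy
    obtain ⟨hkC, hkr, hkc⟩ := hk x hx
    obtain ⟨hkC', hkr', hkc'⟩ := hk y hy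
    have : k x = k y := hinj _ hkC _ hkC' (r.trans (r.symm hkr) (r.trans hxy hkr'))
      (by rw [hkc, hkc', htw x hx y hy hxy])
    refine r'.trans (r'.symm (hβ x hx).2.1) ?_
    rw [this]; exact (hβ y hy).2.1
  · obtain ⟨hkC, hkr, hkc⟩ := hk x₀ hx₀
    have hk0 : k x₀ = x₀ := hinj _ hkC _ hx₀ (r.symm hkr) (by rw [hkc, hb₀])
    have h1 := hβ x₀ hx₀
    rw [hk0, hγ₀] at h1
    exact hinj' _ h1.1 _ hp₀ (r'.symm h1.2.1) (by rw [h1.2.2, h₀])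

section

/-! ### Tilings and stages of the back-and-forth construction -/

/-- A clopen partition into codes together with a finite equivalence relation `F` such that codes
are grouped into towers (labelled by `tw`) and each `F`-class crosses one tower bijectively. -/
structure TowerSys.Tiling {X : Type} [TopologicalSpace X] (S : TowerSys X) (tw : ℕ → ℕ) where
  c : LocallyConstant X ℕ
  F : Setoid X
  tw_eq : ∀ {x y}, F x y → tw (c x) = tw (c y)
  inj : ∀ {x y}, F x y → c x = c y → x = y
  full : ∀ x z, tw (c z) = tw (c x) → ∃ y, F x y ∧ c y = c z
  adapted : ∃ N, ∀ n ≥ N, (∀ x y, F x y → S.E n x y) ∧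
    ∀ x y, S.E n x y → (F x y ↔ F (S.θ n x) (S.θ n y))
  pure : ∃ N, ∀ M ≥ N, ∀ z, ∃ α ∈ S.evGroup M, ∀ w,
    (tw (c w) = tw (c z) → α (c.level (c w)) = 1) ∧ (tw (c w) ≠ tw (c z) → α (c.level (c w)) = 0)

/-- Compatible tilings of two systems. -/
structure Stage {X Y : Type} [TopologicalSpace X] [TopologicalSpace Y] (S : TowerSys X)
    (S' : TowerSys Y) where
  tw : ℕ → ℕ
  L : S.Tiling tw
  R : S'.Tiling tw
  range_eq : Set.range L.c = Set.range R.c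
  I_eq : ∀ l, S.I (L.c.level l) = S'.I (R.c.level l)
  mark_eq : ∀ i, L.c (S.ξ i) = R.c (S'.ξ i)

/-- Refinement of stages. -/
structure Stage.Refines {X Y : Type} [TopologicalSpace X] [TopologicalSpace Y] {S : TowerSys X}
    {S' : TowerSys Y} (s t : Stage S S') : Prop where
  code : ∀ x y, t.L.c x = t.R.c y → s.L.c x = s.R.c y
  left : ∀ x x', s.L.F x x' → t.L.F x x'
  right : ∀ y y', s.R.F y y' → t.R.F y y'
  cross : ∀ x x' y y', s.L.F x x' → s.R.F y y' → t.L.c x = t.R.c y → s.L.c x' = s.R.c y' →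
    t.L.c x' = t.R.c y'

namespace TowerSys

variable {X : Type} [TopologicalSpace X] (S : TowerSys X)

theorem θ_θ (n : ℕ) (x : X) : S.θ n (S.θ n x) = S.θ n x := S.θ_comp le_rfl x

open Classical in
theorem ev_level_θ (M : ℕ) (x w : X) : S.ev M x ((S.θ M).level (S.θ M w)) =
    if S.E M (S.θ M x) (S.θ M w) then 1 else 0 := by
  rw [ev_apply]
  simp only [LocallyConstant.level_apply]
  split_ifs with h
  · obtain ⟨y, hy, hyw⟩ := S.θ_lift h
    rw [Finset.sum_eq_single y]
    · simp [hyw]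
    · intro z hz hzy
      rw [S.mem_cls] at hz
      rw [if_neg]
      intro hzw
      exact hzy (S.θ_inj ((S.E M).trans ((S.E M).symm hz) hy) (hzw.trans hyw.symm))
    · intro hy'
      exact absurd (S.mem_cls.2 hy) hy'
  · refine Finset.sum_eq_zero fun y hy => if_neg fun hyw => h ?_
    rw [← hyw]
    exact S.θ_rel_self (S.mem_cls.1 hy)

/-- The tiling of a system by the templates of level `M`. -/
noncomputable def templateTiling (M : ℕ) (enc : X → ℕ) (tw : ℕ → ℕ)
    (henc : ∀ x y, enc (S.θ M x) = enc (S.θ M y) → S.θ M x = S.θ M y)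
    (htw : ∀ x y, tw (enc (S.θ M x)) = tw (enc (S.θ M y)) ↔ S.E M (S.θ M x) (S.θ M y)) :
    S.Tiling tw where
  c := (S.θ M).map enc
  F := S.E M
  tw_eq h := (htw _ _).2 (S.θ_rel_self h)
  inj h h' := S.θ_inj h (henc _ _ h')
  full x z h := by
    obtain ⟨y, hy, hyz⟩ := S.θ_lift ((htw _ _).1 h.symm)
    exact ⟨y, hy, by simp [hyz]⟩
  adapted := ⟨M, fun n hn => ⟨fun x y h => S.mono hn h, fun x y h => S.θ_rel hn h⟩⟩
  pure := by
    classical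
    refine ⟨M, fun n hn z => ?_⟩
    obtain ⟨α, hα, h⟩ := S.exists_stab hn z
    have key : ∀ w, α (((S.θ M).map enc).level ((S.θ M).map enc w)) =
        if S.E M (S.θ M z) (S.θ M w) then 1 else 0 := by
      intro w
      rw [← S.ev_level_θ]
      have e : (((S.θ M).map enc).level ((S.θ M).map enc w) : X → ℤ) =
          fun x => (fun x' => if x' = S.θ M w then (1 : ℤ) else 0) (S.θ M x) := by
        funext x
        rw [LocallyConstant.level_apply]
        simp only [LocallyConstant.map_apply, Function.comp_apply]
        congr 1
        exact propext ⟨henc _ _, congrArg enc⟩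
      rw [e]
      refine (h (fun x' => if x' = S.θ M w then (1 : ℤ) else 0)).trans
        (congrArg _ (funext fun x => ?_))
      rw [LocallyConstant.level_apply]
    refine ⟨α, hα, fun w => ⟨fun hw => ?_, fun hw => ?_⟩⟩
    · rw [key, if_pos ((htw _ _).1 hw.symm)]
    · rw [key, if_neg fun hE => hw ((htw _ _).2 hE).symm]

variable {S} in
theorem Tiling.ev_level_eq {tw : ℕ → ℕ} (L : S.Tiling tw) {n : ℕ}
    (hn : ∀ x y, L.F x y → S.E n x y) {a b : X} (h : tw (L.c a) = tw (L.c b)) (x : X) :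
    S.ev n x (L.c.level (L.c a)) = S.ev n x (L.c.level (L.c b)) := by
  classical
  have key : ∀ a b, tw (L.c a) = tw (L.c b) → {y ∈ S.cls n x | L.c y = L.c a}.card ≤
      {y ∈ S.cls n x | L.c y = L.c b}.card := by
    intro a b h
    have : ∀ y, ∃ z, L.c y = L.c a → L.F y z ∧ L.c z = L.c b := fun y => by
      by_cases hy : L.c y = L.c a
      · obtain ⟨z, hz⟩ := L.full y b (by rw [hy, h])
        exact ⟨z, fun _ => hz⟩
      · exact ⟨y, fun h => absurd h hy⟩
    choose g hg using this
    refine Finset.card_le_card_of_injOn g ?_ ?_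
    · intro y hy
      have hy := Finset.mem_filter.1 hy
      exact Finset.mem_filter.2 ⟨S.mem_cls.2 ((S.E n).trans (S.mem_cls.1 hy.1)
        (hn _ _ (hg y hy.2).1)), (hg y hy.2).2⟩
    · intro y hy z hz hyz
      have hy := (Finset.mem_filter.1 hy).2
      have hz := (Finset.mem_filter.1 hz).2
      refine L.inj (L.F.trans (hg y hy).1 ?_) (hy.trans hz.symm)
      rw [hyz]; exact L.F.symm (hg z hz).1
  have := le_antisymm (key a b h) (key b a h.symm)
  rw [ev_apply, ev_apply]
  simp only [LocallyConstant.level_apply, Finset.sum_boole, this]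

end TowerSys

variable {X Y : Type} [TopologicalSpace X] [TopologicalSpace Y] [CompactSpace X] [CompactSpace Y]
  {S : TowerSys X} {S' : TowerSys Y}

/-- The heights in the second system of the template towers of the first. -/
theorem Stage.exists_heights (s : Stage S S') (M : ℕ) (hc : ∀ x, s.L.c (S.θ M x) = s.L.c x)
    (hF : ∀ x y, s.L.F x y → S.E M x y)
    (hpure : ∀ z, ∃ α ∈ S.evGroup M, ∀ w,
      (s.tw (s.L.c w) = s.tw (s.L.c z) → α (s.L.c.level (s.L.c w)) = 1) ∧
      (s.tw (s.L.c w) ≠ s.tw (s.L.c z) → α (s.L.c.level (s.L.c w)) = 0))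
    (hI : ∀ f, ∃ g, S'.I g = S.I f) :
    ∃ f : X → LocallyConstant Y ℤ, (∀ x x', S.E M (S.θ M x) (S.θ M x') → f x = f x') ∧
      (∀ x, S'.I (f x) = S.I ((S.θ M).level (S.θ M x))) ∧
      (∀ x, ∃ x', s.tw (s.L.c x') = s.tw (s.L.c x) ∧
        ∑ z ∈ (S.θ M).isLocallyConstant.range_finite.toFinset with s.L.c z = s.L.c x, f z =
          s.R.c.level (s.L.c x')) ∧
      ∃ N, ∀ n ≥ N, ∀ x, ∃ α ∈ S'.evGroup n, ∀ w, (S.E M (S.θ M x) (S.θ M w) → α (f w) = 1) ∧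
        (¬ S.E M (S.θ M x) (S.θ M w) → α (f w) = 0) := by
  classical
  cases isEmpty_or_nonempty X
  · exact ⟨fun _ => 0, fun x => isEmptyElim x, fun x => isEmptyElim x, fun x => isEmptyElim x,
      0, fun n _ x => isEmptyElim x⟩
  set Z := (S.θ M).isLocallyConstant.range_finite.toFinset with hZ
  have hZθ : ∀ z ∈ Z, S.θ M z = z := by
    intro z hz
    obtain ⟨x, rfl⟩ := (Set.Finite.mem_toFinset _).1 hz
    exact S.θ_θ M x
  have hZmem : ∀ x, S.θ M x ∈ Z := fun x => (Set.Finite.mem_toFinset _).2 ⟨x, rfl⟩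
  -- representatives of the template classes
  let rep : X → X := fun x => S.θ M (Quotient.out (Quotient.mk (S.E M) (S.θ M x)))
  have hrep : ∀ x, S.E M (rep x) (S.θ M x) := fun x => by
    have : S.E M (Quotient.out (Quotient.mk (S.E M) (S.θ M x))) (S.θ M x) :=
      Quotient.mk_out (s := S.E M) (S.θ M x)
    simpa [S.θ_θ] using S.θ_rel_self this
  have hrep_eq : ∀ x x', S.E M (S.θ M x) (S.θ M x') → rep x = rep x' := fun x x' h => by
    have : Quotient.mk (S.E M) (S.θ M x) = Quotient.mk (S.E M) (S.θ M x') := Quotient.sound h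
    simp only [rep, this]
  have hθrep : ∀ x, S.θ M (rep x) = rep x := fun x => S.θ_θ M _
  have hrep_rel : ∀ x x', rep x = rep x' → S.E M (S.θ M x) (S.θ M x') := fun x x' h =>
    (S.E M).trans ((S.E M).symm (hrep x)) (by rw [h]; exact hrep x')
  let J := {z : X // z ∈ Z.image rep}
  let jj : X → J := fun x => ⟨rep x, Finset.mem_image.2 ⟨S.θ M x, hZmem x,
    hrep_eq _ _ (by rw [S.θ_θ])⟩⟩
  have hJ : ∀ j : J, jj j.1 = j := by
    rintro ⟨z, hz⟩
    obtain ⟨x, hx, rfl⟩ := Finset.mem_image.1 hz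
    refine Subtype.ext (hrep_eq _ _ ?_)
    rw [hθrep]; exact hrep x
  have hJθ : ∀ j : J, S.θ M j.1 = j.1 := by
    rintro ⟨z, hz⟩
    obtain ⟨x, hx, rfl⟩ := Finset.mem_image.1 hz
    exact hθrep x
  have hjj : ∀ x j, jj x = j ↔ S.E M (S.θ M x) (S.θ M j.1) := by
    intro x j
    rw [← hJ j]
    refine ⟨fun h => ?_, fun h => Subtype.ext (hrep_eq _ _ ?_)⟩
    · have := hrep_rel _ _ (congrArg Subtype.val h)
      rw [hJ j]
      exact this
    · rwa [hJ j] at h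
  have hev : ∀ x, ∀ φ : X → ℤ, (∀ y, φ (S.θ M y) = φ y) → S.ev M x φ = S.ev M (jj x).1 φ := by
    intro x φ hφ
    rw [← S.ev_θ le_rfl hφ x, ← S.ev_eq (hrep x)]
  -- tower labels
  let V := {v : ℕ // v ∈ (s.L.c.isLocallyConstant.range_finite.toFinset).image s.tw}
  have hV : ∀ v : V, ∃ x, s.tw (s.L.c x) = v.1 := by
    rintro ⟨v, hv⟩
    obtain ⟨l, hl, rfl⟩ := Finset.mem_image.1 hv
    obtain ⟨x, rfl⟩ := (Set.Finite.mem_toFinset _).1 hl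
    exact ⟨x, rfl⟩
  choose b hb using hV
  have hlev : ∀ l x, s.L.c.level l (S.θ M x) = s.L.c.level l x := fun l x => by
    rw [LocallyConstant.level_apply, LocallyConstant.level_apply, hc]
  let K : J → V → ℤ := fun j v => S.ev M j.1 (s.L.c.level (s.L.c (b v)))
  have hcoef : ∀ α ∈ S.evGroup M, ∃ k : J → ℤ, ∀ φ : X → ℤ, (∀ y, φ (S.θ M y) = φ y) →
      α φ = ∑ j, k j * S.ev M j.1 φ := by
    intro α hα
    induction hα using AddSubgroup.closure_induction with
    | mem x hx =>
      obtain ⟨y, rfl⟩ := hx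
      refine ⟨fun j => if j = jj y then 1 else 0, fun φ hφ => ?_⟩
      rw [hev y φ hφ, Finset.sum_eq_single (jj y) (fun j _ hj => by simp [hj])
        (by simp)]
      simp
    | zero => exact ⟨0, by simp⟩
    | add a b _ _ ha hb =>
      obtain ⟨k, hk⟩ := ha
      obtain ⟨k', hk'⟩ := hb
      exact ⟨k + k', fun φ hφ => by
        simp [hk φ hφ, hk' φ hφ, add_mul, Finset.sum_add_distrib]⟩
    | neg a _ ha =>
      obtain ⟨k, hk⟩ := ha
      exact ⟨-k, fun φ hφ => by simp [hk φ hφ]⟩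
  have hL : ∀ v, ∃ k : J → ℤ, ∀ w, ∑ j, K j w * k j = if v = w then 1 else 0 := by
    intro v
    obtain ⟨α, hα, h⟩ := hpure (b v)
    obtain ⟨k, hk⟩ := hcoef α hα
    refine ⟨k, fun w => ?_⟩
    have h1 := hk (s.L.c.level (s.L.c (b w))) (hlev _)
    have h2 := h (b w)
    simp only [mul_comm (K _ _)]
    rw [← h1]
    split_ifs with hvw
    · subst hvw; exact h2.1 rfl
    · exact h2.2 (by rw [hb, hb]; exact fun h => hvw (Subtype.ext h.symm))
  choose Lk hLk using hL
  obtain ⟨f, hf1, hf2, N, hf3⟩ := S'.exists_lift (V := V) (J := J)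
    (fun v => s.R.c.level (s.L.c (b v)))
    (by
      obtain ⟨N, hN⟩ := s.R.pure
      refine ⟨N, fun n hn v => ?_⟩
      have hby : ∀ v, ∃ y, s.R.c y = s.L.c (b v) := fun v => by
        have : s.L.c (b v) ∈ Set.range s.R.c := s.range_eq ▸ ⟨b v, rfl⟩
        exact this
      choose b' hb' using hby
      obtain ⟨α, hα, h⟩ := hN n hn (b' v)
      refine ⟨α, hα, fun w => ?_⟩
      have h2 := h (b' w)
      rw [hb', hb', hb, hb] at h2
      split_ifs with hvw
      · subst hvw; exact h2.1 rfl
      · exact h2.2 fun h => hvw (Subtype.ext h))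
    K (fun j v => Lk v j) hLk (fun j => S.I ((S.θ M).level j.1))
    (by
      intro v
      rw [← s.I_eq]
      simp only [← map_zsmul, ← map_sum]
      refine S.I_congr (n := M) (Classical.arbitrary X) fun x => ?_
      rw [hev x _ (hlev _), LocallyConstant.coe_finsetSum, map_sum, Finset.sum_eq_single (jj x)]
      · rw [LocallyConstant.coe_smul, map_zsmul, ← hJθ (jj x), S.ev_level_θ,
          if_pos ((hjj _ _).1 rfl)]
        simp [K, hJθ]
      · intro j _ hj
        rw [LocallyConstant.coe_smul, map_zsmul, ← hJθ j, S.ev_level_θ,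
          if_neg fun h => hj ((hjj _ _).2 h).symm, smul_zero]
      · simp)
    (fun j => hI _)
  refine ⟨fun x => f (jj x), fun x x' h => ?_, fun x => ?_, fun x => ?_, N, fun n hn x => ?_⟩
  · have : jj x = jj x' := Subtype.ext (hrep_eq _ _ h)
    simp only [this]
  · rw [hf2]
    refine S.I_congr (n := M) (Classical.arbitrary X) fun w => ?_
    rw [← hJθ (jj x), S.ev_level_θ, S.ev_level_θ, hJθ]
    exact if_congr ⟨fun h => (S.E M).trans h (hrep x),
      fun h => (S.E M).trans h ((S.E M).symm (hrep x))⟩ rfl rfl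
  · have hv : s.tw (s.L.c x) ∈ (s.L.c.isLocallyConstant.range_finite.toFinset).image s.tw :=
      Finset.mem_image_of_mem _ ((Set.Finite.mem_toFinset _).2 ⟨x, rfl⟩)
    refine ⟨b ⟨_, hv⟩, hb _, ?_⟩
    rw [← hf1 ⟨_, hv⟩, ← Finset.sum_fiberwise _ jj]
    refine Finset.sum_congr rfl fun j _ => ?_
    rw [Finset.sum_congr rfl (g := fun _ => f j) (fun z hz => by rw [(Finset.mem_filter.1 hz).2]),
      Finset.sum_const, ← natCast_zsmul]
    congr 1
    simp only [K]
    rw [← s.L.ev_level_eq hF (a := x) (hb ⟨_, hv⟩).symm, S.ev_apply]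
    simp only [LocallyConstant.level_apply, Finset.sum_boole, Nat.cast_inj]
    rw [Finset.filter_filter]
    symm
    refine Finset.card_bij (fun y _ => S.θ M y) ?_ ?_ ?_
    · intro y hy
      rw [Finset.mem_filter, S.mem_cls] at hy
      rw [Finset.mem_filter]
      refine ⟨hZmem _, by rw [hc]; exact hy.2, (hjj _ _).2 ?_⟩
      rw [S.θ_θ]
      exact S.θ_rel_self ((S.E M).symm hy.1)
    · intro y hy z hz h
      rw [Finset.mem_filter, S.mem_cls] at hy hz
      exact S.θ_inj ((S.E M).trans ((S.E M).symm hy.1) hz.1) h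
    · intro z hz
      rw [Finset.mem_filter] at hz
      obtain ⟨hzZ, hzc, hzj⟩ := hz
      have := (hjj _ _).1 hzj
      rw [hZθ z hzZ] at this
      obtain ⟨y, hy, rfl⟩ := S.θ_lift ((S.E M).symm this)
      refine ⟨y, ?_, rfl⟩
      rw [Finset.mem_filter, S.mem_cls]
      exact ⟨hy, by rw [← hc]; exact hzc⟩
  · obtain ⟨α, hα, h⟩ := hf3 n hn (fun j => if j = jj x then 1 else 0)
    refine ⟨α, hα, fun w => ⟨fun hw => ?_, fun hw => ?_⟩⟩
    · rw [h, if_pos (Subtype.ext (hrep_eq _ _ ((S.E M).symm hw)))]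
    · rw [h, if_neg]
      intro h'
      exact hw ((S.E M).symm (hrep_rel _ _ (congrArg Subtype.val h')))

end

section

/-! ### Marked points and assignments -/

section Marks

variable {X Y : Type} [TopologicalSpace X] [TopologicalSpace Y]

theorem TowerSys.exists_isolating [CompactSpace Y] [T2Space Y] [TotallyDisconnectedSpace Y]
    (S : TowerSys Y) (i : ℕ × Bool) (hi : i.1 ≠ 0) :
    ∃ U : Set Y, IsClopen U ∧ S.ξ i ∈ U ∧ ∀ k, k ≠ i → S.ξ k ∉ U := by
  have h0 : ∀ b, ∃ V : Set Y, IsClopen V ∧ S.ξ (0, b) ∈ V ∧ S.ξ i ∉ V := by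
    intro b
    obtain ⟨V, hV, hV1, hV2⟩ := compact_exists_isClopen_in_isOpen
      (U := {S.ξ i}ᶜ) (x := S.ξ (0, b)) isOpen_compl_singleton
      (fun h => hi (congrArg Prod.fst (S.ξ_inj h)).symm)
    exact ⟨V, hV, hV1, fun h => hV2 h rfl⟩
  choose V hV hV1 hV2 using h0
  choose N hN using fun b => S.ξ_tendsto b (V b) (hV b) (hV1 b)
  let D : Set Y := S.ξ '' ({k | k.1 < max (N true) (N false)} \ {i})
  have hD : D.Finite := by
    refine Set.Finite.image _ (Set.Finite.subset
      ((Set.finite_Iio (max (N true) (N false))).prod (Set.finite_univ (α := Bool))) ?_)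
    intro k hk
    exact ⟨hk.1, trivial⟩
  obtain ⟨U, hU, hU1, hU2⟩ := compact_exists_isClopen_in_isOpen
    (U := Dᶜ ∩ ((V true)ᶜ ∩ (V false)ᶜ)) (x := S.ξ i)
    (hD.isClosed.isOpen_compl.inter ((hV true).compl.isOpen.inter (hV false).compl.isOpen))
    ⟨by rintro ⟨k, hk, hki⟩; exact hk.2 (S.ξ_inj hki), hV2 _, hV2 _⟩
  refine ⟨U, hU, hU1, fun k hk hkU => ?_⟩
  obtain ⟨h1, h2, h3⟩ := hU2 hkU
  by_cases hkN : k.1 < max (N true) (N false)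
  · exact h1 ⟨k, ⟨hkN, hk⟩, rfl⟩
  · push Not at hkN
    obtain ⟨j, b⟩ := k
    cases b
    · exact h3 (hN false j (le_trans (le_max_right _ _) hkN))
    · exact h2 (hN true j (le_trans (le_max_left _ _) hkN))

/-- Locally constant functions on the marks of one system transfer to the other system. -/
theorem TowerSys.exists_extension [CompactSpace X] [CompactSpace Y] [T2Space Y]
    [TotallyDisconnectedSpace Y] (S : TowerSys X) (S' : TowerSys Y) {α : Type}
    (g : LocallyConstant X α) : ∃ q : LocallyConstant Y α, ∀ i, q (S'.ξ i) = g (S.ξ i) := by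
  classical
  obtain ⟨A, hA, hA0, hA1⟩ := compact_exists_isClopen_in_isOpen
      (U := {S'.ξ (0, true)}ᶜ) (x := S'.ξ (0, false)) isOpen_compl_singleton
      (fun h => by simpa using S'.ξ_inj h)
  have hA1' : S'.ξ (0, true) ∈ Aᶜ := fun h => hA1 h rfl
  obtain ⟨N₁, hN₁⟩ := S'.ξ_tendsto _ A hA hA0
  obtain ⟨N₂, hN₂⟩ := S'.ξ_tendsto _ Aᶜ hA.compl hA1'
  choose N₃ hN₃ using fun b => S.ξ_tendsto b (g ⁻¹' {g (S.ξ (0, b))})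
    (g.isLocallyConstant.isClopen_fiber _) rfl
  let N := max (max N₁ N₂) (max (N₃ true) (N₃ false))
  have key : ∀ s : Finset (ℕ × Bool), (∀ i ∈ s, i.1 ≠ 0) →
      ∃ q : LocallyConstant Y α, ∀ i, (i ∈ s ∨ i.1 = 0 ∨ N ≤ i.1) → q (S'.ξ i) = g (S.ξ i) := by
    intro s
    induction s using Finset.induction_on with
    | empty =>
      intro _
      refine ⟨⟨fun y => if y ∈ A then g (S.ξ (0, false)) else g (S.ξ (0, true)), ?_⟩, ?_⟩
      · rw [IsLocallyConstant.iff_exists_open]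
        intro y
        by_cases hy : y ∈ A
        · exact ⟨A, hA.isOpen, hy, fun z hz => by simp only [hy, hz]⟩
        · refine ⟨Aᶜ, hA.compl.isOpen, hy, fun z hz => ?_⟩
          simp only [hy, (show z ∉ A from hz)]
      · rintro ⟨j, b⟩ h
        simp only [Finset.notMem_empty, false_or] at h
        simp only [LocallyConstant.coe_mk]
        rcases h with rfl | h
        · cases b
          · exact if_pos hA0
          · exact if_neg hA1'
        · simp only [N, max_le_iff] at h
          cases b
          · rw [if_pos (hN₁ j h.1.1)]
            exact (hN₃ false j h.2.2).symm
          · rw [if_neg (hN₂ j h.1.2)]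
            exact (hN₃ true j h.2.1).symm
    | insert i s _ ih =>
      intro hs
      obtain ⟨q, hq⟩ := ih fun k hk => hs k (Finset.mem_insert_of_mem hk)
      obtain ⟨U, hU, hU1, hU2⟩ := S'.exists_isolating i (hs i (Finset.mem_insert_self _ _))
      refine ⟨⟨fun y => if y ∈ U then g (S.ξ i) else q y, ?_⟩, ?_⟩
      · rw [IsLocallyConstant.iff_exists_open]
        intro y
        by_cases hy : y ∈ U
        · exact ⟨U, hU.isOpen, hy, fun z hz => by simp only [hy, hz, if_true]⟩
        · obtain ⟨W, hW, hyW, h⟩ := (IsLocallyConstant.iff_exists_open _).1 q.isLocallyConstant y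
          refine ⟨Uᶜ ∩ W, hU.compl.isOpen.inter hW, ⟨hy, hyW⟩, fun z hz => ?_⟩
          simp only [hy, (show z ∉ U from hz.1), if_false]
          exact h z hz.2
      · intro k hk
        simp only [LocallyConstant.coe_mk]
        by_cases hki : k = i
        · subst hki; rw [if_pos hU1]
        · rw [if_neg (hU2 k hki)]
          refine hq k ?_
          rcases hk with hk | hk
          · exact Or.inl ((Finset.mem_insert.1 hk).resolve_left hki)
          · exact Or.inr hk
  obtain ⟨q, hq⟩ := key ((Finset.range N ×ˢ Finset.univ).filter fun i => i.1 ≠ 0) (by simp)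
  refine ⟨q, fun i => hq i ?_⟩
  by_cases h0 : i.1 = 0
  · exact Or.inr (Or.inl h0)
  · by_cases hN : N ≤ i.1
    · exact Or.inr (Or.inr hN)
    · refine Or.inl ?_
      simp only [Finset.mem_filter, Finset.mem_product, Finset.mem_range, Finset.mem_univ, and_true]
      exact ⟨by omega, h0⟩

end Marks

variable {X Y : Type} [TopologicalSpace X] [TopologicalSpace Y] [CompactSpace X]
  {S : TowerSys X} {S' : TowerSys Y}

/-- Cutting one class of the second system into copies of template classes of the first. -/
theorem Stage.exists_assignment (s : Stage S S') (M : ℕ) (hc : ∀ x, s.L.c (S.θ M x) = s.L.c x)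
    (hF : (∀ x y, s.L.F x y → S.E M x y) ∧
      ∀ x y, S.E M x y → (s.L.F x y ↔ s.L.F (S.θ M x) (S.θ M y)))
    (f : X → LocallyConstant Y ℤ) (hf : ∀ x x', S.E M (S.θ M x) (S.θ M x') → f x = f x')
    (hfc : ∀ x, ∃ x', s.tw (s.L.c x') = s.tw (s.L.c x) ∧
        ∑ z ∈ (S.θ M).isLocallyConstant.range_finite.toFinset with s.L.c z = s.L.c x, f z =
          s.R.c.level (s.L.c x')) (m : ℕ) (hF' : ∀ x y, s.R.F x y → S'.E m x y)
    (y : Y) (hpos : ∀ x, 0 < S'.ev m y (f x)) (x₀ : X) (y₀ : Y) (hy₀ : S'.E m y y₀)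
    (h₀ : s.L.c x₀ = s.R.c y₀) :
    ∃ β : Y → (_ : X) × ℕ, (∀ y', S'.E m y y' → S.θ M (β y').1 = (β y').1 ∧
        (β y').2 < (S'.ev m y (f (β y').1)).toNat ∧ s.L.c (β y').1 = s.R.c y') ∧
      (∀ y₁ y₂, S'.E m y y₁ → S'.E m y y₂ → β y₁ = β y₂ → y₁ = y₂) ∧
      (∀ x i, i < (S'.ev m y (f x)).toNat → ∃ y', S'.E m y y' ∧ β y' = ⟨S.θ M x, i⟩) ∧
      (∀ y₁ y₂, S'.E m y y₁ → s.R.F y₁ y₂ → s.L.F (β y₁).1 (β y₂).1 ∧ (β y₁).2 = (β y₂).2) ∧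
      (β y₀).1 = S.θ M x₀ := by
  classical
  have hfθ : ∀ x, f (S.θ M x) = f x := fun x => hf _ _ (by rw [S.θ_θ])
  set Z := (S.θ M).isLocallyConstant.range_finite.toFinset with hZ
  have hZθ : ∀ z ∈ Z, S.θ M z = z := by
    intro z hz
    obtain ⟨x, rfl⟩ := (Set.Finite.mem_toFinset _).1 hz
    exact S.θ_θ M x
  have hZmem : ∀ x, S.θ M x ∈ Z := fun x => (Set.Finite.mem_toFinset _).2 ⟨x, rfl⟩
  let P : Finset ((_ : X) × ℕ) := Z.sigma fun z => Finset.range (S'.ev m y (f z)).toNat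
  have hP : ∀ p, p ∈ P ↔ p.1 ∈ Z ∧ p.2 < (S'.ev m y (f p.1)).toNat := fun p => by
    simp [P, Finset.mem_sigma]
  let r' : Setoid ((_ : X) × ℕ) :=
    { r := fun p p' => s.L.F p.1 p'.1 ∧ p.2 = p'.2
      iseqv := ⟨fun p => ⟨s.L.F.refl _, rfl⟩, fun h => ⟨s.L.F.symm h.1, h.2.symm⟩,
        fun h h' => ⟨s.L.F.trans h.1 h'.1, h.2.trans h'.2⟩⟩ }
  have hyx : ∀ x, ∃ y, s.R.c y = s.L.c x := fun x => by
    have : s.L.c x ∈ Set.range s.R.c := s.range_eq ▸ ⟨x, rfl⟩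
    exact this
  obtain ⟨β, h1, h2, h3, h4, h5⟩ := exists_tower_matching (S'.cls m y) P s.R.F r' s.R.c
    (fun p => s.L.c p.1) s.tw (Set.range s.L.c)
    (fun x _ => by rw [s.range_eq]; exact ⟨x, rfl⟩)
    (fun x _ y _ h => s.R.tw_eq h) (fun x _ y _ h => s.R.inj h)
    (by
      rintro x hx _ ⟨w, rfl⟩ h
      obtain ⟨y', hy'⟩ := hyx w
      rw [← hy'] at h ⊢
      obtain ⟨z, hz, hzc⟩ := s.R.full x y' h
      exact ⟨z, S'.mem_cls.2 ((S'.E m).trans (S'.mem_cls.1 hx) (hF' _ _ hz)), hz, hzc⟩)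
    (by
      rintro ⟨x, i⟩ _ ⟨x', i'⟩ _ ⟨h, rfl : i = i'⟩ h'
      obtain rfl : x = x' := s.L.inj h h'
      rfl)
    (by
      rintro ⟨x, i⟩ hx _ ⟨w, rfl⟩ h
      obtain ⟨hxZ, hxi⟩ := (hP _).1 hx
      obtain ⟨z, hz, hzc⟩ := s.L.full x w h
      have hE := hF.1 _ _ hz
      have hz' := (hF.2 _ _ hE).1 hz
      rw [hZθ x hxZ] at hz'
      refine ⟨⟨S.θ M z, i⟩, (hP _).2 ⟨hZmem z, ?_⟩, ⟨hz', rfl⟩, by rw [hc]; exact hzc⟩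
      have : f x = f z := hf x z (S.θ_rel_self hE)
      simpa only [hfθ, ← this] using hxi)
    (by
      intro l
      by_cases hl : l ∈ Set.range s.L.c
      · obtain ⟨x, rfl⟩ := hl
        obtain ⟨x', hx', hsum⟩ := hfc x
        obtain ⟨y₁, hy₁⟩ := hyx x
        obtain ⟨y₂, hy₂⟩ := hyx x'
        have e := s.R.ev_level_eq hF' (a := y₁) (b := y₂) (by rw [hy₁, hy₂, hx']) y
        rw [hy₁, hy₂, ← hsum, LocallyConstant.coe_finsetSum, map_sum, S'.ev_apply] at e
        simp only [LocallyConstant.level_apply, Finset.sum_boole] at e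
        have hcard : {p ∈ P | s.L.c p.1 = s.L.c x} =
            ({z ∈ Z | s.L.c z = s.L.c x}).sigma
              fun z => Finset.range (S'.ev m y (f z)).toNat := by
          ext p
          simp only [P, Finset.mem_filter, Finset.mem_sigma]
          tauto
        rw [hcard, Finset.card_sigma]
        simp only [Finset.card_range]
        rw [← Nat.cast_inj (R := ℤ), e, Nat.cast_sum]
        exact Finset.sum_congr rfl fun z _ => (Int.toNat_of_nonneg (hpos z).le).symm
      · rw [Finset.card_eq_zero.2, Finset.card_eq_zero.2]
        · refine Finset.filter_eq_empty_iff.2 fun p _ h => hl ⟨_, h⟩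
        · refine Finset.filter_eq_empty_iff.2 fun p _ h => hl ?_
          rw [s.range_eq]; exact ⟨_, h⟩)
    (x₀ := y₀) (p₀ := ⟨S.θ M x₀, 0⟩) (S'.mem_cls.2 hy₀)
    ((hP _).2 ⟨hZmem _, by have := hpos x₀; simp only [hfθ]; omega⟩)
    (by rw [hc]; exact h₀.symm)
  refine ⟨β, fun y' hy' => ?_, fun y₁ y₂ hy₁ hy₂ h => ?_, fun x i hi => ?_, fun y₁ y₂ hy₁ h => ?_,
    congrArg Sigma.fst h5⟩
  · obtain ⟨h, h'⟩ := h1 y' (S'.mem_cls.2 hy')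
    obtain ⟨ha, hb⟩ := (hP _).1 h
    exact ⟨hZθ _ ha, hb, h'⟩
  · exact h2 _ (S'.mem_cls.2 hy₁) _ (S'.mem_cls.2 hy₂) h
  · obtain ⟨y', hy', h⟩ := h3 ⟨S.θ M x, i⟩ ((hP _).2 ⟨hZmem _, by simpa only [hfθ] using hi⟩)
    exact ⟨y', S'.mem_cls.1 hy', h⟩
  · exact h4 _ (S'.mem_cls.2 hy₁) _ (S'.mem_cls.2 ((S'.E m).trans hy₁ (hF' _ _ h))) h

end

section

/-! ### The refinement step -/

variable {X Y : Type} [TopologicalSpace X] [TopologicalSpace Y] [CompactSpace X]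
  {S : TowerSys X} {S' : TowerSys Y}

theorem Stage.exists_global_assignment (s : Stage S S') (M : ℕ)
    (hc : ∀ x, s.L.c (S.θ M x) = s.L.c x)
    (hF : (∀ x y, s.L.F x y → S.E M x y) ∧
      ∀ x y, S.E M x y → (s.L.F x y ↔ s.L.F (S.θ M x) (S.θ M y)))
    (f : X → LocallyConstant Y ℤ) (hf : ∀ x x', S.E M (S.θ M x) (S.θ M x') → f x = f x')
    (hfc : ∀ x, ∃ x', s.tw (s.L.c x') = s.tw (s.L.c x) ∧
        ∑ z ∈ (S.θ M).isLocallyConstant.range_finite.toFinset with s.L.c z = s.L.c x, f z =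
          s.R.c.level (s.L.c x')) (m : ℕ) (hF' : ∀ x y, s.R.F x y → S'.E m x y)
    (hpos : ∀ y x, 0 < S'.ev m y (f x)) (Q : Set Y)
    (hQ : ∀ x y, x ∈ Q → y ∈ Q → S'.E m x y → x = y) (q : Y → X)
    (hq : ∀ y ∈ Q, s.L.c (q y) = s.R.c y) :
    ∃ β : Y → (_ : X) × ℕ, (∀ y, S.θ M (β y).1 = (β y).1 ∧
        (β y).2 < (S'.ev m y (f (β y).1)).toNat ∧ s.L.c (β y).1 = s.R.c y) ∧
      (∀ y₁ y₂, S'.E m y₁ y₂ → β y₁ = β y₂ → y₁ = y₂) ∧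
      (∀ y x i, i < (S'.ev m y (f x)).toNat → ∃ y', S'.E m y y' ∧ β y' = ⟨S.θ M x, i⟩) ∧
      (∀ y₁ y₂, s.R.F y₁ y₂ → s.L.F (β y₁).1 (β y₂).1 ∧ (β y₁).2 = (β y₂).2) ∧
      ∀ y ∈ Q, (β y).1 = S.θ M (q y) := by
  have hloc : ∀ y, ∃ β : Y → (_ : X) × ℕ, (∀ y', S'.E m y y' → S.θ M (β y').1 = (β y').1 ∧
        (β y').2 < (S'.ev m y (f (β y').1)).toNat ∧ s.L.c (β y').1 = s.R.c y') ∧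
      (∀ y₁ y₂, S'.E m y y₁ → S'.E m y y₂ → β y₁ = β y₂ → y₁ = y₂) ∧
      (∀ x i, i < (S'.ev m y (f x)).toNat → ∃ y', S'.E m y y' ∧ β y' = ⟨S.θ M x, i⟩) ∧
      (∀ y₁ y₂, S'.E m y y₁ → s.R.F y₁ y₂ → s.L.F (β y₁).1 (β y₂).1 ∧ (β y₁).2 = (β y₂).2) ∧
      ∀ w, S'.E m y w → w ∈ Q → (β w).1 = S.θ M (q w) := by
    intro y
    by_cases h : ∃ w, S'.E m y w ∧ w ∈ Q
    · obtain ⟨w, hw, hwQ⟩ := h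
      obtain ⟨β, h1, h2, h3, h4, h5⟩ := s.exists_assignment M hc hF f hf hfc m hF' y (hpos y)
        (q w) w hw (hq w hwQ)
      refine ⟨β, h1, h2, h3, h4, fun w' hw' hwQ' => ?_⟩
      obtain rfl : w = w' := hQ _ _ hwQ hwQ' ((S'.E m).trans ((S'.E m).symm hw) hw')
      exact h5
    · have : s.R.c y ∈ Set.range s.L.c := s.range_eq ▸ ⟨y, rfl⟩
      obtain ⟨x, hx⟩ := this
      obtain ⟨β, h1, h2, h3, h4, h5⟩ := s.exists_assignment M hc hF f hf hfc m hF' y (hpos y)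
        x y ((S'.E m).refl y) hx
      exact ⟨β, h1, h2, h3, h4, fun w hw hwQ => absurd ⟨w, hw, hwQ⟩ h⟩
  choose B h1 h2 h3 h4 h5 using hloc
  let o : Y → Y := fun y => Quotient.out (Quotient.mk (S'.E m) y)
  have ho : ∀ y, S'.E m (o y) y := fun y => Quotient.mk_out (s := S'.E m) y
  have hoE : ∀ y y', S'.E m y y' → o y = o y' := fun y y' h => by
    have : Quotient.mk (S'.E m) y = Quotient.mk (S'.E m) y' := Quotient.sound h
    simp only [o, this]
  refine ⟨fun y => B (o y) y, fun y => ?_, fun y₁ y₂ h hβ => ?_, fun y x i hi => ?_,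
    fun y₁ y₂ h => ?_, fun y hy => h5 _ _ (ho y) hy⟩
  · rw [← S'.ev_eq (ho y)]
    exact h1 (o y) y (ho y)
  · simp only [← hoE _ _ h] at hβ
    exact h2 _ _ _ (ho y₁) ((S'.E m).trans (ho y₁) h) hβ
  · obtain ⟨y', hy', h⟩ := h3 (o y) x i (by rwa [S'.ev_eq (ho y)])
    have hyy := (S'.E m).trans ((S'.E m).symm (ho y)) hy'
    exact ⟨y', hyy, by simp only [← hoE _ _ hyy]; exact h⟩
  · simp only [← hoE _ _ (hF' _ _ h)]
    exact h4 _ _ _ (ho y₁) h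

variable [CompactSpace Y] [T2Space Y] [TotallyDisconnectedSpace Y]

theorem TowerSys.exists_template_codes [Nonempty X] (S : TowerSys X) (M : ℕ) :
    ∃ (enc : X → ℕ) (tw : ℕ → ℕ),
      (∀ x y, enc (S.θ M x) = enc (S.θ M y) → S.θ M x = S.θ M y) ∧
      ∀ x y, tw (enc (S.θ M x)) = tw (enc (S.θ M y)) ↔ S.E M (S.θ M x) (S.θ M y) := by
  obtain ⟨enc, henc⟩ := Set.countable_iff_exists_injOn.1
    (S.θ M).isLocallyConstant.range_finite.countable
  have henc' : ∀ x y, enc (S.θ M x) = enc (S.θ M y) → S.θ M x = S.θ M y :=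
    fun x y h => henc ⟨x, rfl⟩ ⟨y, rfl⟩ h
  let o : X → X := fun y => Quotient.out (Quotient.mk (S.E M) y)
  have ho : ∀ y, S.E M (o y) y := fun y => Quotient.mk_out (s := S.E M) y
  let d : ℕ → X := Function.invFun fun x => enc (S.θ M x)
  have hd : ∀ x, S.θ M (d (enc (S.θ M x))) = S.θ M x := fun x =>
    henc' _ _ (Function.invFun_eq (f := fun x => enc (S.θ M x)) ⟨x, rfl⟩)
  have hE : ∀ x, S.E M (S.θ M (o (S.θ M x))) (S.θ M x) := fun x => by
    have := S.θ_rel_self (ho (S.θ M x))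
    rwa [S.θ_θ] at this
  refine ⟨enc, fun l => enc (S.θ M (o (S.θ M (d l)))), henc', fun x y => ?_⟩
  simp only [hd]
  refine ⟨fun h => ?_, fun h => ?_⟩
  · refine (S.E M).trans ((S.E M).symm (hE x)) ?_
    rw [henc' _ _ h]; exact hE y
  · have : Quotient.mk (S.E M) (S.θ M x) = Quotient.mk (S.E M) (S.θ M y) := Quotient.sound h
    simp only [o, this]

theorem Stage.exists_step [Nonempty X] (s : Stage S S') (hI : ∀ f, ∃ g, S'.I g = S.I f)
    (A : Set X) (hA : IsClopen A) (k : ℕ) :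
    ∃ t : Stage S S', s.Refines t ∧ (∀ x x', t.L.c x = t.L.c x' → (x ∈ A ↔ x' ∈ A)) ∧
      ∀ x x', S.E k x x' → t.L.F x x' := by
  classical
  obtain ⟨N₁, hN₁⟩ := S.exists_forall_θ_eq s.L.c
  obtain ⟨N₂, hN₂⟩ := S.θ_mem A hA
  obtain ⟨N₃, hN₃⟩ := s.L.adapted
  obtain ⟨N₄, hN₄⟩ := s.L.pure
  obtain ⟨M, hkM, hM₁, hM₂, hM₃, hM₄⟩ : ∃ M, k ≤ M ∧ N₁ ≤ M ∧ N₂ ≤ M ∧ N₃ ≤ M ∧ N₄ ≤ M :=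
    ⟨max k (max N₁ (max N₂ (max N₃ N₄))), by simp, by simp, by simp, by simp, by simp⟩
  have hc := hN₁ M hM₁
  have hF := hN₃ M hM₃
  obtain ⟨f, hf, hfI, hfc, N₅, hfp⟩ := s.exists_heights M hc hF.1 (hN₄ M hM₄) hI
  have hfθ : ∀ x, f (S.θ M x) = f x := fun x => hf _ _ (by rw [S.θ_θ])
  have hZ := (S.θ M).isLocallyConstant.range_finite
  obtain ⟨N₆, hN₆⟩ := exists_forall_ge_of_finite _ hZ
    (fun z n => ∀ y, 0 < ∑ w ∈ S'.cls n y, f z w) (fun z _ => S'.pos _ (by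
      rw [hfI]
      refine S.I_pos _ (S.θ M z) (fun y => ?_) ?_
      · rw [LocallyConstant.level_apply]; split_ifs <;> norm_num
      · rw [LocallyConstant.level_apply, if_pos (S.θ_θ M z)]; norm_num))
  obtain ⟨N₇, hN₇⟩ := exists_forall_ge_of_finite _ hZ
    (fun z n => ∀ y, f z (S'.θ n y) = f z y) (fun z _ => S'.exists_forall_θ_eq (f z))
  obtain ⟨N₈, hN₈⟩ := s.R.adapted
  obtain ⟨q, hq⟩ := S.exists_extension S' (S.θ M)
  obtain ⟨m, hm₆, hm₈⟩ : ∃ m, N₆ ≤ m ∧ N₈ ≤ m := ⟨max N₆ N₈, by simp, by simp⟩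
  obtain ⟨Q, hQ, hQξ, hQs⟩ := S'.ξ_sparse m
  have hF' := hN₈ m hm₈
  have hpos : ∀ y x, 0 < S'.ev m y (f x) := fun y x => by
    rw [← hfθ, S'.ev_apply]; exact hN₆ m hm₆ _ ⟨x, rfl⟩ y
  obtain ⟨β, b1, b2, b3, b4, b5⟩ := s.exists_global_assignment M hc hF f hf hfc m hF'.1 hpos
    {y | y ∈ Q ∧ s.L.c (q y) = s.R.c y} (fun x y hx hy => hQs x y hx.1 hy.1) q (fun y hy => hy.2)
  obtain ⟨N₉, hN₉⟩ := S'.exists_forall_θ_eq s.R.c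
  obtain ⟨N₁₀, hN₁₀⟩ := S'.exists_forall_θ_eq q
  obtain ⟨N₁₁, hN₁₁⟩ := S'.θ_mem Q hQ
  obtain ⟨p, hmp, hp₇, hp₉, hp₁₀, hp₁₁⟩ : ∃ p, m ≤ p ∧ N₇ ≤ p ∧ N₉ ≤ p ∧ N₁₀ ≤ p ∧ N₁₁ ≤ p :=
    ⟨max m (max N₇ (max N₉ (max N₁₀ N₁₁))), by simp, by simp, by simp, by simp, by simp⟩
  have hfp' : ∀ x y, f x (S'.θ p y) = f x y := fun x y => by
    rw [← hfθ x]; exact hN₇ p hp₇ _ ⟨x, rfl⟩ y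
  have hc' := hN₉ p hp₉
  obtain ⟨enc, tw, henc, htw⟩ := S.exists_template_codes M
  -- points are indexed by templates through `γ`
  let γ : Y → (_ : X) × ℕ := fun y => β (S'.θ p y)
  have hγθ : ∀ y, S.θ M (γ y).1 = (γ y).1 := fun y => (b1 _).1
  have hγlt : ∀ y, (γ y).2 < (S'.ev m y (f (γ y).1)).toNat := fun y => by
    rw [← S'.ev_θ hmp (hfp' _) y]; exact (b1 _).2.1
  have hγc : ∀ y, s.L.c (γ y).1 = s.R.c y := fun y => by rw [← hc']; exact (b1 _).2.2
  have hγinj : ∀ y₁ y₂, S'.E m y₁ y₂ → γ y₁ = γ y₂ → y₁ = y₂ := fun y₁ y₂ h hγ =>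
    S'.θ_inj (S'.mono hmp h) (b2 _ _ ((S'.θ_rel hmp (S'.mono hmp h)).1 h) hγ)
  have hγsurj : ∀ y x i, i < (S'.ev m y (f x)).toNat →
      ∃ y', S'.E m y y' ∧ γ y' = ⟨S.θ M x, i⟩ := fun y x i hi => by
    rw [← S'.ev_θ hmp (hfp' _) y] at hi
    obtain ⟨w, hw, hβ⟩ := b3 _ _ _ hi
    obtain ⟨y', hy', rfl⟩ := S'.θ_lift (S'.mono hmp hw)
    exact ⟨y', (S'.θ_rel hmp hy').2 hw, hβ⟩
  have hγF : ∀ y₁ y₂, s.R.F y₁ y₂ → s.L.F (γ y₁).1 (γ y₂).1 ∧ (γ y₁).2 = (γ y₂).2 :=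
    fun y₁ y₂ h => b4 _ _ (((hN₈ p (hm₈.trans hmp)).2 _ _ (S'.mono hmp (hF'.1 _ _ h))).1 h)
  have hγE : ∀ y x x', S.E M (S.θ M x) (S.θ M x') → S'.ev m y (f x) = S'.ev m y (f x') :=
    fun y x x' h => by rw [hf x x' h]
  let cR : LocallyConstant Y ℕ := (S'.θ p).map fun y => enc (β y).1
  have hcR : ∀ y, cR y = enc (γ y).1 := fun y => rfl
  have hcRlev : ∀ y x, S'.ev m y (cR.level (enc (S.θ M x))) = S'.ev m y (f x) := by
    intro y x
    rw [S'.ev_apply]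
    simp only [LocallyConstant.level_apply, Finset.sum_boole]
    rw [← Int.toNat_of_nonneg (hpos y x).le, Nat.cast_inj,
      ← Finset.card_range (S'.ev m y (f x)).toNat]
    have hmem : ∀ w, w ∈ {w ∈ S'.cls m y | cR w = enc (S.θ M x)} ↔
        S'.E m y w ∧ (γ w).1 = S.θ M x := fun w => by
      rw [Finset.mem_filter, S'.mem_cls, hcR]
      refine and_congr_right fun _ => ⟨fun h => ?_, fun h => by rw [h]⟩
      rw [← hγθ w] at h ⊢
      exact henc _ _ h
    refine Finset.card_bij (fun w _ => (γ w).2) ?_ ?_ ?_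
    · intro w hw
      obtain ⟨hw, hwx⟩ := (hmem w).1 hw
      have := hγlt w
      rw [hwx, hfθ, ← S'.ev_eq hw] at this
      exact Finset.mem_range.2 this
    · intro w hw w' hw' h
      obtain ⟨hw, hwx⟩ := (hmem w).1 hw
      obtain ⟨hw', hwx'⟩ := (hmem w').1 hw'
      refine hγinj _ _ ((S'.E m).trans ((S'.E m).symm hw) hw') ?_
      exact Sigma.ext (hwx.trans hwx'.symm) (heq_of_eq h)
    · intro i hi
      obtain ⟨w, hw, h⟩ := hγsurj y x i (Finset.mem_range.1 hi)
      exact ⟨w, (hmem w).2 ⟨hw, by rw [h]⟩, by rw [h]⟩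
  let FR : Setoid Y :=
    { r := fun y y' => S'.E m y y' ∧ (γ y).2 = (γ y').2 ∧ S.E M (γ y).1 (γ y').1
      iseqv := ⟨fun y => ⟨(S'.E m).refl _, rfl, (S.E M).refl _⟩,
        fun h => ⟨(S'.E m).symm h.1, h.2.1.symm, (S.E M).symm h.2.2⟩,
        fun h h' => ⟨(S'.E m).trans h.1 h'.1, h.2.1.trans h'.2.1, (S.E M).trans h.2.2 h'.2.2⟩⟩ }
  let R : S'.Tiling tw :=
    { c := cR
      F := FR
      tw_eq := by
        rintro x y ⟨_, _, h⟩
        rw [hcR, hcR]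
        have := (htw (γ x).1 (γ y).1)
        rw [hγθ, hγθ] at this
        exact this.2 h
      inj := by
        rintro x y ⟨h1, h2, h3⟩ h
        refine hγinj _ _ h1 (Sigma.ext ?_ (heq_of_eq h2))
        rw [hcR, hcR] at h
        have := henc (γ x).1 (γ y).1
        rw [hγθ, hγθ] at this
        exact this h
      full := by
        intro x z h
        rw [hcR, hcR] at h
        have h' := htw (γ z).1 (γ x).1
        rw [hγθ, hγθ] at h'
        have hE := h'.1 h
        have hlt := hγlt x
        rw [← hγE x (γ z).1 (γ x).1 (by rwa [hγθ, hγθ])] at hlt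
        obtain ⟨y, hy, hγy⟩ := hγsurj x _ _ hlt
        rw [hγθ] at hγy
        refine ⟨y, ⟨hy, by rw [hγy], by rw [hγy]; exact (S.E M).symm hE⟩, ?_⟩
        rw [hcR, hcR, hγy]
      adapted := by
        refine ⟨p, fun n hn => ⟨fun x y h => S'.mono (hmp.trans hn) h.1, fun x y h => ?_⟩⟩
        have : ∀ y, γ (S'.θ n y) = γ y := fun y => by simp only [γ, S'.θ_comp hn]
        refine and_congr (S'.θ_rel (hmp.trans hn) h) ?_
        rw [this, this]
      pure := by
        refine ⟨max N₅ m, fun n hn z => ?_⟩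
        obtain ⟨α, hα, h⟩ := hfp n (le_trans (le_max_left _ _) hn) (γ z).1
        have key : ∀ w, α (cR.level (cR w)) = α (f (γ w).1) := fun w =>
          S'.evGroup_congr (le_trans (le_max_right _ _) hn)
            (fun y => by rw [← hcRlev, hγθ, hcR]) hα
        refine ⟨α, hα, fun w => ?_⟩
        have h' := htw (γ w).1 (γ z).1
        rw [hγθ, hγθ] at h'
        have h2 := h (γ w).1
        rw [hγθ, hγθ] at h2
        rw [key, hcR, hcR, ne_eq, h']
        exact ⟨fun hE => h2.1 ((S.E M).symm hE), fun hE => h2.2 fun hE' => hE ((S.E M).symm hE')⟩ }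
  obtain ⟨y₀⟩ : Nonempty Y := ⟨S'.ξ (0, true)⟩
  let t : Stage S S' :=
    { tw := tw
      L := S.templateTiling M enc tw henc htw
      R := R
      range_eq := by
        ext l
        refine ⟨?_, ?_⟩
        · rintro ⟨x, rfl⟩
          obtain ⟨y, _, hy⟩ := hγsurj y₀ x 0 (by have := hpos y₀ x; omega)
          exact ⟨y, by change cR y = enc (S.θ M x); rw [hcR, hy]⟩
        · rintro ⟨y, rfl⟩
          exact ⟨(γ y).1, by change enc (S.θ M _) = cR y; rw [hcR, hγθ]⟩
      I_eq := by
        intro l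
        change S.I (((S.θ M).map enc).level l) = S'.I (cR.level l)
        by_cases hl : ∃ x, enc (S.θ M x) = l
        · obtain ⟨x, rfl⟩ := hl
          rw [S'.I_congr y₀ fun y => hcRlev y x, hfI]
          congr 1
          ext y
          rw [LocallyConstant.level_apply, LocallyConstant.level_apply]
          simp only [LocallyConstant.map_apply, Function.comp_apply]
          exact if_congr ⟨henc _ _, congrArg enc⟩ rfl rfl
        · push Not at hl
          have h1 : ((S.θ M).map enc).level l = 0 := by
            ext x
            rw [LocallyConstant.level_apply]
            exact if_neg (hl x)
          have h2 : cR.level l = 0 := by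
            ext y
            rw [LocallyConstant.level_apply]
            refine if_neg ?_
            rw [hcR, ← hγθ]; exact hl _
          rw [h1, h2, map_zero, map_zero]
      mark_eq := by
        intro i
        change enc (S.θ M (S.ξ i)) = cR (S'.ξ i)
        rw [hcR, ← hq i, ← hN₁₀ p hp₁₀]
        have := b5 (S'.θ p (S'.ξ i)) ⟨(hN₁₁ p hp₁₁ _).2 (hQξ i), by
          rw [hN₁₀ p hp₁₀, hc', hq, hc]; exact s.mark_eq i⟩
        simp only [γ]
        rw [this, hN₁₀ p hp₁₀, hq, S.θ_θ] }
  have htc : ∀ x y, t.L.c x = t.R.c y → S.θ M x = (γ y).1 := fun x y h => by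
    have h : enc (S.θ M x) = enc (γ y).1 := h
    rw [← hγθ] at h ⊢
    exact henc _ _ h
  refine ⟨t, ⟨fun x y h => ?_, fun x x' h => hF.1 _ _ h, fun y y' h => ?_,
    fun x x' y y' hx hy h h' => ?_⟩, fun x x' h => ?_, fun x x' h => S.mono hkM h⟩
  · rw [← hc, htc x y h, hγc]
  · exact ⟨hF'.1 _ _ h, (hγF _ _ h).2, hF.1 _ _ (hγF _ _ h).1⟩
  · have h1 := ((hF.2 _ _ (hF.1 _ _ hx)).1 hx)
    rw [htc x y h] at h1
    have h2 := s.L.inj (s.L.F.trans (s.L.F.symm h1) (hγF _ _ hy).1) (by rw [hc, hγc]; exact h')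
    change enc (S.θ M x') = enc (γ y').1
    rw [h2]
  · have : S.θ M x = S.θ M x' := henc _ _ h
    rw [← hN₂ M hM₂, this, hN₂ M hM₂]

end

/-! ### The limit of the back-and-forth construction -/

section Limit

variable {X Y : Type} [TopologicalSpace X] [TopologicalSpace Y] {S : TowerSys X} {S' : TowerSys Y}

/-- Exchange the two systems of a stage. -/
def Stage.swap (s : Stage S S') : Stage S' S where
  tw := s.tw
  L := s.R
  R := s.L
  range_eq := s.range_eq.symm
  I_eq l := (s.I_eq l).symm
  mark_eq i := (s.mark_eq i).symm

theorem Stage.Refines.swap {s t : Stage S S'} (h : s.Refines t) : s.swap.Refines t.swap where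
  code x y hxy := (h.code y x hxy.symm).symm
  left := h.right
  right := h.left
  cross x x' y y' hx hy h1 h2 := (h.cross y y' x x' hy hx h1.symm h2.symm).symm

theorem Stage.Refines.refl (s : Stage S S') : s.Refines s where
  code _ _ h := h
  left _ _ h := h
  right _ _ h := h
  cross _ _ _ _ _ _ _ h := h

theorem Stage.Refines.trans {s t u : Stage S S'} (h : s.Refines t) (h' : t.Refines u) :
    s.Refines u where
  code x y hxy := h.code x y (h'.code x y hxy)
  left x x' hx := h'.left x x' (h.left x x' hx)
  right y y' hy := h'.right y y' (h.right y y' hy)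
  cross x x' y y' hx hy h1 h2 := h'.cross x x' y y' (h.left x x' hx) (h.right y y' hy) h1
    (h.cross x x' y y' hx hy (h'.code x y h1) h2)

theorem Stage.exists_right (s : Stage S S') (x : X) : ∃ y, s.R.c y = s.L.c x := by
  have : s.L.c x ∈ Set.range s.R.c := s.range_eq ▸ ⟨x, rfl⟩
  exact this

theorem Stage.Refines.code_left {s t : Stage S S'} (h : s.Refines t) {x x' : X}
    (hx : t.L.c x = t.L.c x') : s.L.c x = s.L.c x' := by
  obtain ⟨y, hy⟩ := t.exists_right x
  exact (h.code x y hy.symm).trans (h.code x' y (hx.symm.trans hy.symm)).symm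

/-- The trivial tiling. -/
def TowerSys.trivialTiling (S : TowerSys X) : S.Tiling (fun _ => 0) where
  c := LocallyConstant.const X 0
  F := ⊥
  tw_eq _ := rfl
  inj h _ := h
  full x z _ := ⟨x, rfl, rfl⟩
  adapted := ⟨0, fun n _ => ⟨fun x y h => by cases (show x = y from h); exact (S.E n).refl x,
    fun x y h => ⟨fun (h : x = y) => by rw [h], fun h' => S.θ_inj h h'⟩⟩⟩
  pure := by
    classical
    refine ⟨0, fun M _ z => ?_⟩
    obtain ⟨α, hα, h⟩ := S.exists_stab (Nat.zero_le M) z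
    refine ⟨α, hα, fun w => ⟨fun _ => ?_, fun h => absurd rfl h⟩⟩
    have h1 := h fun _ => 1
    have hc : S.cls 0 z = {z} := by
      ext y
      rw [S.mem_cls, Finset.mem_singleton]
      exact ⟨fun h => (S.E_zero h).symm, fun h => h ▸ (S.E 0).refl y⟩
    rw [S.ev_apply, hc, Finset.sum_singleton] at h1
    rw [← h1]
    congr 1
    funext x
    simp [LocallyConstant.level_apply]

/-- The trivial stage. -/
def Stage.trivial [Nonempty X] [Nonempty Y] (h : S.I 1 = S'.I 1) : Stage S S' where
  tw := fun _ => 0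
  L := S.trivialTiling
  R := S'.trivialTiling
  range_eq := by simp [TowerSys.trivialTiling]
  I_eq l := by
    classical
    by_cases hl : 0 = l
    · subst hl
      have e : S.trivialTiling.c.level 0 = 1 := by
        ext x; simp [TowerSys.trivialTiling, LocallyConstant.level_apply]
      have e' : S'.trivialTiling.c.level 0 = 1 := by
        ext x; simp [TowerSys.trivialTiling, LocallyConstant.level_apply]
      rw [e, e', h]
    · have e : S.trivialTiling.c.level l = 0 := by
        ext x; simp [TowerSys.trivialTiling, LocallyConstant.level_apply, hl]
      have e' : S'.trivialTiling.c.level l = 0 := by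
        ext x; simp [TowerSys.trivialTiling, LocallyConstant.level_apply, hl]
      rw [e, e', map_zero, map_zero]
  mark_eq i := rfl

theorem Stage.exists_next [CompactSpace X] [T2Space X] [TotallyDisconnectedSpace X]
    [CompactSpace Y] [T2Space Y] [TotallyDisconnectedSpace Y] [Nonempty X] [Nonempty Y]
    (hI : ∀ f, ∃ g, S'.I g = S.I f) (hI' : ∀ g, ∃ f, S.I f = S'.I g) (s : Stage S S')
    (A : Set X) (hA : IsClopen A) (B : Set Y) (hB : IsClopen B) (k : ℕ) :
    ∃ t, s.Refines t ∧ (∀ x x', t.L.c x = t.L.c x' → (x ∈ A ↔ x' ∈ A)) ∧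
      (∀ y y', t.R.c y = t.R.c y' → (y ∈ B ↔ y' ∈ B)) ∧
      (∀ x x', S.E k x x' → t.L.F x x') ∧ ∀ y y', S'.E k y y' → t.R.F y y' := by
  obtain ⟨t, h1, h2, h3⟩ := s.exists_step hI A hA k
  obtain ⟨u, h4, h5, h6⟩ := t.swap.exists_step hI' B hB k
  have h4' : t.Refines u.swap := h4.swap
  exact ⟨u.swap, h1.trans h4', fun x x' h => h2 x x' (h4'.code_left h), h5,
    fun x x' h => h4'.left _ _ (h3 x x' h), h6⟩

theorem Stage.exists_limit_rel {s : ℕ → Stage S S'} (hs : ∀ m n, m ≤ n → (s m).Refines (s n))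
    (hE : ∀ k, ∃ n, ∀ x x', S.E k x x' → (s n).L.F x x') (h : X → Y)
    (hh : ∀ x y, (∀ n, (s n).L.c x = (s n).R.c y) ↔ h x = y) {k : ℕ} {x x' : X}
    (hx : S.E k x x') : ∃ n, S'.E n (h x) (h x') := by
  obtain ⟨n, hn⟩ := hE k
  have hF := hn x x' hx
  obtain ⟨z, hz⟩ := (s n).exists_right x'
  have hc := (hh x _).2 rfl
  obtain ⟨y, hy, hyz⟩ := (s n).R.full (h x) z (by rw [hz, ← (s n).L.tw_eq hF, hc n])
  have hyx : h x' = y := by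
    have h1 : ∀ m ≥ n, (s m).L.c x' = (s m).R.c y := fun m hm =>
      (hs n m hm).cross x x' (h x) y hF hy (hc m) (hz.symm.trans hyz.symm)
    exact (hh x' y).1 fun m => (hs m (max m n) (le_max_left _ _)).code _ _
      (h1 _ (le_max_right _ _))
  obtain ⟨N, hN⟩ := (s n).R.adapted
  exact ⟨N, hyx ▸ (hN N le_rfl).1 _ _ hy⟩

theorem Stage.existsUnique_limit [CompactSpace Y] [T2Space Y] {s : ℕ → Stage S S'}
    (hs : ∀ m n, m ≤ n → (s m).Refines (s n))
    (hB : ∀ y y', (∀ n, (s n).R.c y = (s n).R.c y') → y = y') (x : X) :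
    ∃! y, ∀ n, (s n).L.c x = (s n).R.c y := by
  have hcl : ∀ n, IsClosed {y | (s n).L.c x = (s n).R.c y} := fun n =>
    isClosed_eq continuous_const (s n).R.c.continuous
  obtain ⟨y, hy⟩ := IsCompact.nonempty_iInter_of_sequence_nonempty_isCompact_isClosed
    (fun n => {y | (s n).L.c x = (s n).R.c y})
    (fun n y hy => (hs n (n + 1) n.le_succ).code x y hy)
    (fun n => by obtain ⟨y, hy⟩ := (s n).exists_right x; exact ⟨y, hy.symm⟩)
    (hcl 0).isCompact hcl
  rw [Set.mem_iInter] at hy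
  exact ⟨y, hy, fun z hz => hB z y fun n => (hz n).symm.trans (hy n)⟩

/-- Two tower systems with the same values of the functionals are isomorphic by a homeomorphism
respecting the marks. -/
theorem TowerSys.exists_homeomorph [CompactSpace X] [T2Space X] [TotallyDisconnectedSpace X]
    [SecondCountableTopology X] [CompactSpace Y] [T2Space Y] [TotallyDisconnectedSpace Y]
    [SecondCountableTopology Y] [Nonempty X] [Nonempty Y] (S : TowerSys X) (S' : TowerSys Y)
    (h1 : S.I 1 = S'.I 1) (hI : ∀ f, ∃ g, S'.I g = S.I f) (hI' : ∀ g, ∃ f, S.I f = S'.I g) :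
    ∃ h : X ≃ₜ Y, (∀ i, h (S.ξ i) = S'.ξ i) ∧ (∀ n x x', S.E n x x' → ∃ m, S'.E m (h x) (h x')) ∧
      ∀ n y y', S'.E n y y' → ∃ m, S.E m (h.symm y) (h.symm y') := by
  have : Countable (TopologicalSpace.Clopens X) :=
    TopologicalSpace.Clopens.countable_iff_secondCountable.2 inferInstance
  have : Countable (TopologicalSpace.Clopens Y) :=
    TopologicalSpace.Clopens.countable_iff_secondCountable.2 inferInstance
  obtain ⟨A, hA⟩ := exists_surjective_nat (TopologicalSpace.Clopens X)
  obtain ⟨B, hB⟩ := exists_surjective_nat (TopologicalSpace.Clopens Y)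
  choose nx hn1 hn2 hn3 hn4 hn5 using fun (s : Stage S S') k =>
    s.exists_next hI hI' (A k) (A k).isClopen (B k) (B k).isClopen k
  let s : ℕ → Stage S S' := fun n => Nat.rec (Stage.trivial h1) (fun k s => nx s k) n
  have hss : ∀ n, s (n + 1) = nx (s n) n := fun n => rfl
  have hs : ∀ m n, m ≤ n → (s m).Refines (s n) := by
    intro m n hmn
    induction n, hmn using Nat.le_induction with
    | base => exact Stage.Refines.refl _
    | succ n _ ih => exact ih.trans (hss n ▸ hn1 (s n) n)
  have sepA : ∀ U : Set X, IsClopen U → ∃ n, ∀ x x', (s n).L.c x = (s n).L.c x' →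
      (x ∈ U ↔ x' ∈ U) := by
    intro U hU
    obtain ⟨k, hk⟩ := hA ⟨U, hU⟩
    refine ⟨k + 1, fun x x' h => ?_⟩
    have := hn2 (s k) k x x' h
    rwa [hk] at this
  have sepB : ∀ U : Set Y, IsClopen U → ∃ n, ∀ x x', (s n).R.c x = (s n).R.c x' →
      (x ∈ U ↔ x' ∈ U) := by
    intro U hU
    obtain ⟨k, hk⟩ := hB ⟨U, hU⟩
    refine ⟨k + 1, fun x x' h => ?_⟩
    have := hn3 (s k) k x x' h
    rwa [hk] at this
  have eqA : ∀ x x', (∀ n, (s n).L.c x = (s n).L.c x') → x = x' := by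
    intro x x' h
    by_contra hne
    obtain ⟨U, hU, hx, hx'⟩ := exists_isClopen_of_totally_separated hne
    obtain ⟨n, hn⟩ := sepA U hU
    exact hx' ((hn x x' (h n)).1 hx)
  have eqB : ∀ x x', (∀ n, (s n).R.c x = (s n).R.c x') → x = x' := by
    intro x x' h
    by_contra hne
    obtain ⟨U, hU, hx, hx'⟩ := exists_isClopen_of_totally_separated hne
    obtain ⟨n, hn⟩ := sepB U hU
    exact hx' ((hn x x' (h n)).1 hx)
  have hs' : ∀ m n, m ≤ n → (s m).swap.Refines (s n).swap := fun m n h => (hs m n h).swap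
  choose f hf hfu using Stage.existsUnique_limit hs eqB
  choose g hg hgu using Stage.existsUnique_limit (s := fun n => (s n).swap) hs' eqA
  have hff : ∀ x y, (∀ n, (s n).L.c x = (s n).R.c y) ↔ f x = y :=
    fun x y => ⟨fun h => (hfu x y h).symm, fun h => h ▸ hf x⟩
  have hgg : ∀ y x, (∀ n, (s n).swap.L.c y = (s n).swap.R.c x) ↔ g y = x :=
    fun y x => ⟨fun h => (hgu y x h).symm, fun h => h ▸ hg y⟩
  let e : X ≃ Y := ⟨f, g, fun x => (hgg _ _).1 fun n => (hf x n).symm,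
    fun y => (hff _ _).1 fun n => (hg y n).symm⟩
  have he : Continuous e := by
    refine isTopologicalBasis_isClopen.continuous_iff.2 fun U hU => ?_
    obtain ⟨n, hn⟩ := sepB U hU
    have : e ⁻¹' U = (s n).L.c ⁻¹' ((s n).R.c '' U) := by
      ext x
      refine ⟨fun h => ⟨f x, h, (hf x n).symm⟩, ?_⟩
      rintro ⟨y, hy, hyx⟩
      exact (hn y (f x) (hyx.trans (hf x n))).1 hy
    rw [this]
    exact (s n).L.c.isLocallyConstant _
  refine ⟨he.homeoOfEquivCompactToT2, fun i => (hff _ _).1 fun n => (s n).mark_eq i,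
    fun n x x' h => ?_, fun n y y' h => ?_⟩
  · exact Stage.exists_limit_rel hs (fun k => ⟨k + 1, hn4 (s k) k⟩) f hff h
  · exact Stage.exists_limit_rel hs' (fun k => ⟨k + 1, hn5 (s k) k⟩) g hgg h

end Limit

/-! ### Return times in aperiodic minimal systems -/

/-- A continuous aperiodic action of the integers with uniformly bounded hitting times. -/
structure MinSys (X : Type) [TopologicalSpace X] where
  τ : ℤ → X → X
  cont : ∀ k, Continuous (τ k)
  zero : ∀ x, τ 0 x = x
  add : ∀ a b x, τ (a + b) x = τ a (τ b x)
  aper : ∀ k x, τ k x = x → k = 0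
  hit : ∀ U : Set X, IsOpen U → U.Nonempty → ∃ N : ℕ, ∀ x, ∃ i < N, τ (i : ℤ) x ∈ U

namespace MinSys

variable {X : Type} [TopologicalSpace X] (D : MinSys X)

theorem inj {a b : ℤ} {x : X} (h : D.τ a x = D.τ b x) : a = b := by
  have h1 := congrArg (D.τ (-b)) h
  rw [← D.add, ← D.add, neg_add_cancel, D.zero] at h1
  have := D.aper _ _ h1
  omega

theorem neg_τ (a : ℤ) (x : X) : D.τ (-a) (D.τ a x) = x := by
  rw [← D.add, neg_add_cancel, D.zero]

theorem τ_neg (a : ℤ) (x : X) : D.τ a (D.τ (-a) x) = x := by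
  rw [← D.add, add_neg_cancel, D.zero]

theorem τ_inj {a : ℤ} {x y : X} (h : D.τ a x = D.τ a y) : x = y := by
  rw [← D.neg_τ a x, h, D.neg_τ]

/-- A nonempty clopen set, used as the base of a partition of the orbits into finite blocks. -/
structure IsBase (W : Set X) : Prop where
  clopen : IsClopen W
  nonempty : W.Nonempty

/-- The time since the last visit to `W`. -/
noncomputable def lo (W : Set X) (x : X) : ℕ := sInf {k : ℕ | D.τ (-(k : ℤ)) x ∈ W}

/-- The first return time to `W`. -/
noncomputable def ret (W : Set X) (x : X) : ℕ := sInf {k : ℕ | 0 < k ∧ D.τ (k : ℤ) x ∈ W}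

/-- The last visited point of `W`. -/
noncomputable def base (W : Set X) (x : X) : X := D.τ (-(D.lo W x : ℤ)) x

variable {D} {W : Set X}

theorem IsBase.exists_ret (hW : IsBase W) :
    ∃ N : ℕ, ∀ x, ∃ k, k ≤ N ∧ 0 < k ∧ D.τ (k : ℤ) x ∈ W := by
  obtain ⟨N, hN⟩ := D.hit W hW.clopen.isOpen hW.nonempty
  refine ⟨N, fun x => ?_⟩
  obtain ⟨i, hi, h⟩ := hN (D.τ 1 x)
  exact ⟨i + 1, hi, i.succ_pos, by rw [← D.add] at h; exact_mod_cast h⟩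

theorem IsBase.exists_lo (hW : IsBase W) (x : X) :
    ∃ k : ℕ, 0 < k ∧ D.τ (-(k : ℤ)) x ∈ W := by
  obtain ⟨N, hN⟩ := D.hit W hW.clopen.isOpen hW.nonempty
  obtain ⟨i, hi, h⟩ := hN (D.τ (-(N : ℤ)) x)
  refine ⟨N - i, by omega, ?_⟩
  rw [← D.add] at h
  convert h using 2
  omega

theorem IsBase.ret_spec (hW : IsBase W) (x : X) : 0 < D.ret W x ∧ D.τ (D.ret W x : ℤ) x ∈ W := by
  obtain ⟨N, hN⟩ := hW.exists_ret (D := D)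
  obtain ⟨k, -, hk⟩ := hN x
  exact Nat.sInf_mem (s := {k : ℕ | 0 < k ∧ D.τ (k : ℤ) x ∈ W}) ⟨k, hk⟩

theorem IsBase.ret_pos (hW : IsBase W) (x : X) : 0 < D.ret W x := (hW.ret_spec x).1

theorem notMem_of_lt_ret {x : X} {k : ℕ} (h0 : 0 < k) (h : k < D.ret W x) :
    D.τ (k : ℤ) x ∉ W := fun hk => Nat.notMem_of_lt_sInf h ⟨h0, hk⟩

theorem ret_le {x : X} {k : ℕ} (h0 : 0 < k) (h : D.τ (k : ℤ) x ∈ W) : D.ret W x ≤ k :=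
  Nat.sInf_le ⟨h0, h⟩

theorem ret_eq {x : X} {a : ℕ} (h0 : 0 < a) (h : D.τ (a : ℤ) x ∈ W)
    (h' : ∀ i : ℕ, 0 < i → i < a → D.τ (i : ℤ) x ∉ W) : D.ret W x = a := by
  refine le_antisymm (ret_le h0 h) ?_
  refine le_csInf ⟨a, h0, h⟩ fun k hk => ?_
  by_contra! hka
  exact h' k hk.1 hka hk.2

theorem IsBase.exists_ret_le (hW : IsBase W) : ∃ N : ℕ, ∀ x, D.ret W x ≤ N := by
  obtain ⟨N, hN⟩ := hW.exists_ret (D := D)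
  refine ⟨N, fun x => ?_⟩
  obtain ⟨k, hk, h⟩ := hN x
  exact (ret_le h.1 h.2).trans hk

theorem IsBase.base_mem (hW : IsBase W) (x : X) : D.base W x ∈ W := by
  obtain ⟨k, -, hk⟩ := hW.exists_lo (D := D) x
  exact Nat.sInf_mem (s := {k : ℕ | D.τ (-(k : ℤ)) x ∈ W}) ⟨k, hk⟩

theorem τ_lo_base (x : X) : D.τ (D.lo W x : ℤ) (D.base W x) = x := D.τ_neg _ _

theorem lo_eq {x : X} {a : ℕ} (h : D.τ (-(a : ℤ)) x ∈ W)
    (h' : ∀ i < a, D.τ (-(i : ℤ)) x ∉ W) : D.lo W x = a := by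
  refine le_antisymm (Nat.sInf_le h) (le_csInf ⟨a, h⟩ fun k hk => ?_)
  by_contra! hka
  exact h' k hka hk

theorem IsBase.lo_lt_ret (hW : IsBase W) (x : X) : D.lo W x < D.ret W (D.base W x) := by
  by_contra! h
  obtain ⟨h0, h1⟩ := hW.ret_spec (D := D) (D.base W x)
  rw [base, ← D.add] at h1
  refine Nat.notMem_of_lt_sInf (s := {k : ℕ | D.τ (-(k : ℤ)) x ∈ W})
    (m := D.lo W x - D.ret W (D.base W x)) (show _ < D.lo W x by omega) ?_
  change D.τ _ x ∈ W
  convert h1 using 2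
  change D.ret W (D.τ (-(D.lo W x : ℤ)) x) ≤ _ at h
  change -((D.lo W x - D.ret W (D.τ (-(D.lo W x : ℤ)) x) : ℕ) : ℤ) = _
  omega

theorem lo_τ {y : X} (hy : y ∈ W) {i : ℕ} (hi : i < D.ret W y) : D.lo W (D.τ (i : ℤ) y) = i := by
  refine lo_eq (by rwa [D.neg_τ]) fun j hj => ?_
  rw [← D.add]
  have := notMem_of_lt_ret (D := D) (W := W) (x := y) (k := i - j) (by omega) (by omega)
  convert this using 3
  push_cast [Nat.cast_sub hj.le]
  ring

theorem base_τ {y : X} (hy : y ∈ W) {i : ℕ} (hi : i < D.ret W y) :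
    D.base W (D.τ (i : ℤ) y) = y := by
  rw [base, lo_τ hy hi, D.neg_τ]

theorem IsBase.lo_of_mem {y : X} (hW : IsBase W) (hy : y ∈ W) : D.lo W y = 0 := by
  have := lo_τ hy (hW.ret_pos (D := D) y)
  rwa [Nat.cast_zero, D.zero] at this

theorem IsBase.base_of_mem {y : X} (hW : IsBase W) (hy : y ∈ W) : D.base W y = y := by
  rw [base, hW.lo_of_mem hy]
  simp [D.zero]

theorem IsBase.exists_τ_eq (hW : IsBase W) (x : X) :
    ∃ y ∈ W, ∃ i < D.ret W y, D.τ (i : ℤ) y = x :=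
  ⟨D.base W x, hW.base_mem x, D.lo W x, hW.lo_lt_ret x, τ_lo_base x⟩

theorem isClopen_preimage_τ (hW : IsClopen W) (k : ℤ) : IsClopen {x | D.τ k x ∈ W} :=
  hW.preimage (D.cont k)

theorem IsBase.isLocallyConstant_lo (hW : IsBase W) : IsLocallyConstant (D.lo W) := by
  refine IsLocallyConstant.iff_isOpen_fiber.2 fun k => ?_
  have : D.lo W ⁻¹' {k} = {x | D.τ (-(k : ℤ)) x ∈ W} ∩
      ⋂ i ∈ Finset.range k, {x | D.τ (-(i : ℤ)) x ∈ W}ᶜ := by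
    ext x
    simp only [Set.mem_preimage, Set.mem_singleton_iff, Set.mem_inter_iff, Set.mem_iInter,
      Finset.mem_range]
    constructor
    · rintro rfl
      exact ⟨hW.base_mem x, fun i hi h => Nat.notMem_of_lt_sInf hi h⟩
    · exact fun h => lo_eq h.1 h.2
  rw [this]
  exact (isClopen_preimage_τ hW.clopen _).isOpen.inter
    (isOpen_biInter_finset fun i _ => (isClopen_preimage_τ hW.clopen _).compl.isOpen)

theorem IsBase.isLocallyConstant_ret (hW : IsBase W) : IsLocallyConstant (D.ret W) := by
  refine IsLocallyConstant.iff_isOpen_fiber.2 fun k => ?_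
  rcases k.eq_zero_or_pos with rfl | hk
  · convert isOpen_empty
    ext x
    simp [(hW.ret_pos (D := D) x).ne']
  have : D.ret W ⁻¹' {k} = {x | D.τ (k : ℤ) x ∈ W} ∩
      ⋂ i ∈ Finset.Ioo 0 k, {x | D.τ (i : ℤ) x ∈ W}ᶜ := by
    ext x
    simp only [Set.mem_preimage, Set.mem_singleton_iff, Set.mem_inter_iff, Set.mem_iInter,
      Finset.mem_Ioo]
    constructor
    · rintro rfl
      exact ⟨(hW.ret_spec x).2, fun i hi => notMem_of_lt_ret hi.1 hi.2⟩
    · exact fun h => ret_eq hk h.1 fun i h1 h2 => h.2 i ⟨h1, h2⟩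
  rw [this]
  exact (isClopen_preimage_τ hW.clopen _).isOpen.inter
    (isOpen_biInter_finset fun i _ => (isClopen_preimage_τ hW.clopen _).compl.isOpen)

theorem IsBase.continuous_base (hW : IsBase W) : Continuous (D.base W) := by
  refine continuous_iff_continuousAt.2 fun x => ?_
  have h := (hW.isLocallyConstant_lo (D := D)).eventually_eq x
  refine (D.cont (-(D.lo W x : ℤ))).continuousAt.congr ?_
  filter_upwards [h] with y hy
  rw [base, hy]

variable (D)

/-- The partition of the orbits at the visits to `W`. -/
noncomputable def blockRel (W : Set X) : Setoid X := Setoid.ker (D.base W)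

open Classical in
/-- The block of a point. -/
noncomputable def block (W : Set X) (x : X) : Finset X :=
  (Finset.range (D.ret W (D.base W x))).image fun i : ℕ => D.τ (i : ℤ) (D.base W x)

variable {D}

theorem IsBase.mem_block (hW : IsBase W) {x y : X} : y ∈ D.block W x ↔ D.blockRel W x y := by
  simp only [block, Finset.mem_image, Finset.mem_range]
  constructor
  · rintro ⟨i, hi, rfl⟩
    exact (base_τ (hW.base_mem x) hi).symm
  · intro h
    have h : D.base W x = D.base W y := h
    exact ⟨D.lo W y, h ▸ hW.lo_lt_ret y, h ▸ τ_lo_base y⟩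

theorem sum_block {M : Type*} [AddCommMonoid M] (f : X → M) (x : X) :
    ∑ y ∈ D.block W x, f y =
      ∑ i ∈ Finset.range (D.ret W (D.base W x)), f (D.τ (i : ℤ) (D.base W x)) := by
  classical
  rw [block, Finset.sum_image]
  intro i _ j _ h
  exact_mod_cast D.inj h

theorem IsBase.rel_τ (hW : IsBase W) {y : X} (hy : y ∈ W) {z : X} :
    D.blockRel W y z ↔ ∃ i < D.ret W y, D.τ (i : ℤ) y = z := by
  rw [← hW.mem_block, block, hW.base_of_mem hy]
  simp

/-- Points in the same block lie on the same orbit at bounded distance. -/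
theorem IsBase.exists_of_rel (hW : IsBase W) {x y : X} (h : D.blockRel W x y) :
    ∃ z ∈ W, ∃ i < D.ret W z, ∃ j < D.ret W z, D.τ (i : ℤ) z = x ∧ D.τ (j : ℤ) z = y := by
  have h : D.base W x = D.base W y := h
  exact ⟨D.base W x, hW.base_mem x, D.lo W x, hW.lo_lt_ret x, D.lo W y, h ▸ hW.lo_lt_ret y,
    τ_lo_base x, h ▸ τ_lo_base y⟩

theorem IsBase.rel_iff (hW : IsBase W) {z : X} {i j : ℕ} (hij : i ≤ j) :
    D.blockRel W (D.τ (i : ℤ) z) (D.τ (j : ℤ) z) ↔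
      ∀ k : ℕ, i < k → k ≤ j → D.τ (k : ℤ) z ∉ W := by
  constructor
  · intro h k hik hkj hk
    have h : D.base W _ = D.base W _ := h
    have h1 : D.lo W (D.τ (j : ℤ) z) ≤ j - k := by
      refine Nat.sInf_le ?_
      change D.τ _ _ ∈ W
      rw [← D.add]
      convert hk using 2
      push_cast [Nat.cast_sub hkj]; ring
    rw [base, base, ← D.add, ← D.add] at h
    have := D.inj h
    omega
  · intro h
    change D.base W _ = D.base W _
    have : D.lo W (D.τ (j : ℤ) z) = D.lo W (D.τ (i : ℤ) z) + (j - i) := by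
      refine lo_eq ?_ fun k hk => ?_
      · rw [← D.add]
        have := hW.base_mem (D := D) (D.τ (i : ℤ) z)
        rw [base, ← D.add] at this
        convert this using 2
        push_cast [Nat.cast_sub hij]; ring
      · by_cases hkj : k < j - i
        · have := h (j - k) (by omega) (by omega)
          rw [← D.add]
          convert this using 3
          rw [Nat.cast_sub (by omega)]; ring
        · have := Nat.notMem_of_lt_sInf (s := {k : ℕ | D.τ (-(k : ℤ)) (D.τ (i : ℤ) z) ∈ W})
            (m := k - (j - i)) (show _ < D.lo W _ by omega)
          change ¬ D.τ _ _ ∈ W at this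
          rw [← D.add] at this ⊢
          convert this using 3
          push_cast [Nat.cast_sub hij, Nat.cast_sub (not_lt.1 hkj)]; ring
    rw [base, base, this, ← D.add, ← D.add]
    congr 1
    push_cast [Nat.cast_sub hij]; ring

theorem blockRel_mono {W' : Set X} (hW : IsBase W) (hW' : IsBase W') (h : W' ⊆ W) {x y : X}
    (hxy : D.blockRel W x y) : D.blockRel W' x y := by
  obtain ⟨z, -, i, -, j, -, rfl, rfl⟩ := hW.exists_of_rel hxy
  rcases le_total i j with hij | hij
  · exact (hW'.rel_iff hij).2 fun k h1 h2 hk => (hW.rel_iff hij).1 hxy k h1 h2 (h hk)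
  · exact (D.blockRel W').symm ((hW'.rel_iff hij).2 fun k h1 h2 hk =>
      (hW.rel_iff hij).1 ((D.blockRel W).symm hxy) k h1 h2 (h hk))

end MinSys

/-! ### Templates for the blocks of an integer action -/

namespace MinSys

variable {X : Type} [TopologicalSpace X] (D : MinSys X) (W W' : Set X) (P P' : DiscreteQuotient X)

/-- Points whose itineraries up to the next visit to `W` cannot be distinguished by `P`. -/
def pat : Setoid X where
  r y y' := (y ∈ W ↔ y' ∈ W) ∧ D.ret W y = D.ret W y' ∧
    ∀ i < D.ret W y, P.toSetoid (D.τ (i : ℤ) y) (D.τ (i : ℤ) y')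
  iseqv := ⟨fun _ => ⟨Iff.rfl, rfl, fun _ _ => P.refl _⟩,
    fun h => ⟨h.1.symm, h.2.1.symm, fun i hi => P.symm _ _ (h.2.2 i (h.2.1.symm ▸ hi))⟩,
    fun h h' => ⟨h.1.trans h'.1, h.2.1.trans h'.2.1,
      fun i hi => P.trans _ _ _ (h.2.2 i hi) (h'.2.2 i (h.2.1 ▸ hi))⟩⟩

/-- A representative with the same pattern. -/
noncomputable def tmpl (y : X) : X := (Quotient.mk (D.pat W P) y).out

/-- The retraction onto the blocks of the representatives. -/
noncomputable def θ (x : X) : X := D.τ (D.lo W x : ℤ) (D.tmpl W P (D.base W x))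

variable {D W W' P P'}

theorem pat_tmpl (y : X) : D.pat W P y (D.tmpl W P y) :=
  (D.pat W P).symm (Quotient.mk_out (s := D.pat W P) y)

theorem tmpl_eq {y y' : X} (h : D.pat W P y y') : D.tmpl W P y = D.tmpl W P y' :=
  congrArg Quotient.out (Quotient.sound (s := D.pat W P) h)

theorem tmpl_mem {y : X} (hy : y ∈ W) : D.tmpl W P y ∈ W := (pat_tmpl y).1.1 hy

theorem ret_tmpl (y : X) : D.ret W (D.tmpl W P y) = D.ret W y := (pat_tmpl y).2.1.symm

theorem θ_τ {y : X} (hy : y ∈ W) {i : ℕ} (hi : i < D.ret W y) :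
    D.θ W P (D.τ (i : ℤ) y) = D.τ (i : ℤ) (D.tmpl W P y) := by
  rw [θ, lo_τ hy hi, base_τ hy hi]

theorem IsBase.isLocallyConstant_tmpl (hW : IsBase W) : IsLocallyConstant (D.tmpl W P) := by
  refine (IsLocallyConstant.iff_eventually_eq _).2 fun y => ?_
  have h1 := (hW.isLocallyConstant_ret (D := D)).eventually_eq y
  have h2 : ∀ᶠ y' in nhds y, (y ∈ W ↔ y' ∈ W) := by
    by_cases hy : y ∈ W
    · filter_upwards [hW.clopen.isOpen.mem_nhds hy] with y' hy' using iff_of_true hy hy'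
    · filter_upwards [hW.clopen.compl.isOpen.mem_nhds hy] with y' hy' using iff_of_false hy hy'
  have h3 : ∀ᶠ y' in nhds y, ∀ i ∈ Finset.range (D.ret W y),
      P.toSetoid (D.τ (i : ℤ) y) (D.τ (i : ℤ) y') := by
    refine (Filter.eventually_all_finset _).2 fun i _ => ?_
    exact ((P.isOpen_setOfPred_rel (D.τ (i : ℤ) y)).preimage (D.cont i)).mem_nhds (P.refl _)
  filter_upwards [h1, h2, h3] with y' h1 h2 h3
  exact (tmpl_eq ⟨h2, h1.symm, fun i hi => h3 i (Finset.mem_range.2 hi)⟩).symm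

theorem IsBase.isLocallyConstant_θ (hW : IsBase W) : IsLocallyConstant (D.θ W P) := by
  refine (IsLocallyConstant.iff_eventually_eq _).2 fun x => ?_
  have h1 := (hW.isLocallyConstant_lo (D := D)).eventually_eq x
  have h2 := ((hW.isLocallyConstant_tmpl (D := D) (P := P)).comp_continuous
    (hW.continuous_base (D := D))).eventually_eq x
  filter_upwards [h1, h2] with y h1 h2
  simp only [Function.comp_apply] at h2
  rw [θ, θ, h1, h2]

theorem IsBase.rel_θ (hW : IsBase W) (x : X) : P.toSetoid x (D.θ W P x) := by
  obtain ⟨y, hy, i, hi, rfl⟩ := hW.exists_τ_eq (D := D) x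
  rw [θ_τ hy hi]
  exact (pat_tmpl y).2.2 i hi

theorem IsBase.θ_inj (hW : IsBase W) {x y : X} (h : D.blockRel W x y)
    (hxy : D.θ W P x = D.θ W P y) : x = y := by
  obtain ⟨z, hz, i, hi, j, hj, rfl, rfl⟩ := hW.exists_of_rel h
  rw [θ_τ hz hi, θ_τ hz hj] at hxy
  rw [D.inj hxy]

theorem IsBase.θ_lift (hW : IsBase W) {x z : X} (h : D.blockRel W (D.θ W P x) z) :
    ∃ y, D.blockRel W x y ∧ D.θ W P y = z := by
  obtain ⟨y, hy, i, hi, rfl⟩ := hW.exists_τ_eq (D := D) x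
  rw [θ_τ hy hi] at h
  have h1 : D.blockRel W (D.tmpl W P y) z := (D.blockRel W).trans
    ((hW.rel_τ (tmpl_mem hy)).2 ⟨i, by rwa [ret_tmpl], rfl⟩) h
  obtain ⟨j, hj, rfl⟩ := (hW.rel_τ (tmpl_mem hy)).1 h1
  rw [ret_tmpl] at hj
  refine ⟨D.τ (j : ℤ) y, ?_, θ_τ hy hj⟩
  exact (D.blockRel W).trans ((D.blockRel W).symm ((hW.rel_τ hy).2 ⟨i, hi, rfl⟩))
    ((hW.rel_τ hy).2 ⟨j, hj, rfl⟩)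

variable (W' P' D W) in
/-- The itineraries with respect to `W` of the blocks of `W'` are determined by `P'`. -/
def Resolves : Prop := W' ⊆ W ∧ ∀ y y', D.pat W' P' y y' → y ∈ W' → ∀ k ≤ D.ret W' y,
  (D.τ (k : ℤ) y ∈ W ↔ D.τ (k : ℤ) y' ∈ W)

theorem IsBase.resolves_self (hW : IsBase W) : D.Resolves W W P := by
  refine ⟨subset_rfl, fun y y' h hy k hk => ?_⟩
  rcases k.eq_zero_or_pos with rfl | h0
  · simpa [D.zero] using h.1
  rcases hk.lt_or_eq with hk | rfl
  · exact iff_of_false (notMem_of_lt_ret h0 hk) (notMem_of_lt_ret h0 (h.2.1 ▸ hk))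
  · exact iff_of_true (hW.ret_spec y).2 (h.2.1 ▸ (hW.ret_spec y').2)

theorem IsBase.resolves (hW' : IsBase W') (h : W' ⊆ W)
    (hP : ∀ x y, P'.toSetoid x y → (x ∈ W ↔ y ∈ W)) : D.Resolves W W' P' := by
  refine ⟨h, fun y y' hyy hy k hk => ?_⟩
  rcases hk.lt_or_eq with hk | rfl
  · exact hP _ _ (hyy.2.2 k hk)
  · exact iff_of_true (h (hW'.ret_spec y).2) (h (hyy.2.1 ▸ (hW'.ret_spec y').2))

theorem IsBase.θ_rel (hW : IsBase W) (hW' : IsBase W') (h : D.Resolves W W' P') {x y : X}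
    (hxy : D.blockRel W' x y) :
    D.blockRel W x y ↔ D.blockRel W (D.θ W' P' x) (D.θ W' P' y) := by
  obtain ⟨z, hz, i, hi, j, hj, rfl, rfl⟩ := hW'.exists_of_rel hxy
  rw [θ_τ hz hi, θ_τ hz hj]
  have key : ∀ i j : ℕ, i ≤ j → j < D.ret W' z →
      (D.blockRel W (D.τ (i : ℤ) z) (D.τ (j : ℤ) z) ↔
        D.blockRel W (D.τ (i : ℤ) (D.tmpl W' P' z)) (D.τ (j : ℤ) (D.tmpl W' P' z))) := by
    intro i j hij hj
    rw [hW.rel_iff hij, hW.rel_iff hij]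
    refine forall_congr' fun k => imp_congr_right fun _ => imp_congr_right fun hk => ?_
    exact not_congr (h.2 z _ (pat_tmpl z) hz k (hk.trans hj.le))
  rcases le_total i j with hij | hij
  · exact key i j hij hj
  · exact ((Setoid.comm' _).trans (key j i hij hi)).trans (Setoid.comm' _)

/-- Points at the same position of blocks with the same pattern for a finer partition. -/
theorem IsBase.θ_eq_of_pat (hW : IsBase W) (hW' : IsBase W') (h : D.Resolves W W' P') (hP : P' ≤ P)
    {y y' : X}
    (hyy : D.pat W' P' y y') (hy : y ∈ W') {i : ℕ} (hi : i < D.ret W' y) :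
    D.θ W P (D.τ (i : ℤ) y) = D.θ W P (D.τ (i : ℤ) y') := by
  have hv := h.2 y y' hyy hy
  obtain ⟨z, hz, l, hl, hzx⟩ := hW.exists_τ_eq (D := D) (D.τ (i : ℤ) y)
  have hlo : D.lo W (D.τ (i : ℤ) y) = l := by rw [← hzx, lo_τ hz hl]
  have hli : l ≤ i := by
    rw [← hlo]
    refine Nat.sInf_le ?_
    change D.τ _ _ ∈ W
    rw [D.neg_τ]
    exact h.1 hy
  obtain ⟨j, rfl⟩ := Nat.exists_eq_add_of_le' hli
  have hzj : z = D.τ (j : ℤ) y := by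
    refine D.τ_inj (a := l) ?_
    rw [hzx, ← D.add]
    congr 1
    push_cast; ring
  subst hzj
  set r := D.ret W (D.τ (j : ℤ) y) with hr
  have hrr : j + r ≤ D.ret W' y := by
    by_contra! hlt
    have h1 : D.τ ((D.ret W' y - j : ℕ) : ℤ) (D.τ (j : ℤ) y) ∈ W := by
      rw [← D.add]
      have h2 : D.τ (D.ret W' y : ℤ) y ∈ W := h.1 (hW'.ret_spec y).2
      convert h2 using 2
      rw [Nat.cast_sub (by omega)]; ring
    exact notMem_of_lt_ret (by omega) (by omega) h1
  have hz' : D.τ (j : ℤ) y' ∈ W := (hv j (by omega)).1 hz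
  have hr' : D.ret W (D.τ (j : ℤ) y') = r := by
    refine ret_eq (by omega) ?_ fun k h0 hk => ?_
    · have := (hW.ret_spec (D := D) (D.τ (j : ℤ) y)).2
      rw [← D.add, add_comm, ← Nat.cast_add] at this ⊢
      exact (hv _ hrr).1 this
    · have := notMem_of_lt_ret h0 hk
      rw [← D.add, add_comm, ← Nat.cast_add] at this ⊢
      exact fun h => this ((hv _ (by omega)).2 h)
  have e : ∀ w : X, D.τ ((j + l : ℕ) : ℤ) w = D.τ (l : ℤ) (D.τ (j : ℤ) w) := fun w => by
    rw [← D.add, add_comm, Nat.cast_add]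
  rw [e, e, θ_τ hz hl, θ_τ hz' (hr'.symm ▸ hl)]
  congr 1
  refine tmpl_eq ⟨iff_of_true hz hz', hr'.symm, fun k hk => ?_⟩
  rw [← D.add, ← D.add, add_comm, ← Nat.cast_add]
  exact hP (hyy.2.2 _ (by omega))

theorem IsBase.θ_comp (hW : IsBase W) (hW' : IsBase W') (h : D.Resolves W W' P') (hP : P' ≤ P)
    (x : X) : D.θ W P (D.θ W' P' x) = D.θ W P x := by
  obtain ⟨y, hy, i, hi, rfl⟩ := hW'.exists_τ_eq (D := D) x
  rw [θ_τ hy hi]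
  exact (hW.θ_eq_of_pat hW' h hP (pat_tmpl y) hy hi).symm

end MinSys

/-! ### Nested families of cuts -/

namespace MinSys

variable {X : Type} [TopologicalSpace X] (D : MinSys X)

/-- Distinct points of the set lie in distinct orbits. -/
def Free (S : Set X) : Prop := ∀ x ∈ S, ∀ y ∈ S, ∀ k, D.τ k x = y → x = y

variable {D}

theorem Free.mono {S S' : Set X} (h : D.Free S) (hS : S' ⊆ S) : D.Free S' :=
  fun x hx y hy k hk => h x (hS hx) y (hS hy) k hk

theorem Free.union_singleton {S : Set X} (h : D.Free S) {u : X} (hu : ∀ s ∈ S, ∀ k, D.τ k s ≠ u)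
    (l : ℤ) : D.Free (insert (D.τ l u) S) := by
  rintro x (rfl | hx) y (rfl | hy) k hk
  · rfl
  · refine absurd ?_ (hu y hy (-l + -k))
    rw [← hk, D.add, D.neg_τ, D.neg_τ]
  · refine absurd ?_ (hu x hx (-l + k))
    rw [D.add, hk, D.neg_τ]
  · exact h x hx y hy k hk

section Generic

variable [CompactSpace X] [T2Space X] [PerfectSpace X]

theorem exists_notMem_orbits (D : MinSys X) (S : Finset X) {U : Set X} (hU : IsOpen U)
    (hne : U.Nonempty) : ∃ u ∈ U, ∀ s ∈ S, ∀ k, D.τ k s ≠ u := by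
  have hd : Dense (⋂ p ∈ (S : Set X) ×ˢ (Set.univ : Set ℤ), ({D.τ p.2 p.1}ᶜ : Set X)) := by
    refine dense_biInter_of_isOpen (fun p _ => isOpen_compl_singleton)
      (S.countable_toSet.prod Set.countable_univ) fun p _ => dense_compl_singleton _
  obtain ⟨u, hu, h⟩ := hd.exists_mem_open hU hne
  exact ⟨u, h, fun s hs k hk => (Set.mem_iInter₂.1 hu (s, k) ⟨hs, trivial⟩) hk.symm⟩

theorem Free.exists_generic {S : Finset X} (hS : D.Free S) (Z : Finset X) (U : X → Set X)
    (l : X → ℤ) (hU : ∀ t ∈ Z, IsOpen (U t)) (hne : ∀ t ∈ Z, (U t).Nonempty) :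
    ∃ u : X → X, (∀ t ∈ Z, u t ∈ U t ∧ ∀ s ∈ S, ∀ k, D.τ k s ≠ u t) ∧
      D.Free (S ∪ (fun t => D.τ (l t) (u t)) '' Z) := by
  classical
  induction Z using Finset.induction_on with
  | empty => exact ⟨id, by simp, by simpa using hS⟩
  | insert t Z ht ih =>
    obtain ⟨u, hu, hf⟩ := ih (fun s hs => hU s (Finset.mem_insert_of_mem hs))
      fun s hs => hne s (Finset.mem_insert_of_mem hs)
    obtain ⟨v, hv, hvS⟩ := exists_notMem_orbits D (S ∪ Z.image fun t => D.τ (l t) (u t))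
      (hU t (Finset.mem_insert_self _ _)) (hne t (Finset.mem_insert_self _ _))
    have hne' : ∀ s ∈ Z, s ≠ t := fun s hs h => ht (h ▸ hs)
    refine ⟨Function.update u t v, fun s hs => ?_, ?_⟩
    · rcases Finset.mem_insert.1 hs with rfl | hs
      · rw [Function.update_self]
        exact ⟨hv, fun s hs => hvS s (Finset.mem_union_left _ hs)⟩
      · rw [Function.update_of_ne (hne' s hs)]
        exact hu s hs
    · refine (hf.union_singleton (u := v) (fun s hs => hvS s (by simpa using hs)) (l t)).mono ?_
      rintro x (hx | ⟨s, hs, rfl⟩)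
      · exact Or.inr (Or.inl hx)
      rcases Finset.mem_insert.1 (Finset.mem_coe.1 hs) with rfl | hs
      · exact Or.inl (by simp)
      · exact Or.inr (Or.inr ⟨s, hs, by simp [Function.update_of_ne (hne' s hs)]⟩)

end Generic

variable (D) in
/-- The sum along an orbit segment. -/
noncomputable def seg (n : ℕ) (y : X) : (X → ℤ) →+ ℤ :=
  ∑ i ∈ Finset.range n, Pi.evalAddMonoidHom (fun _ : X => ℤ) (D.τ (i : ℤ) y)

theorem seg_apply (n : ℕ) (y : X) (f : X → ℤ) :
    D.seg n y f = ∑ i ∈ Finset.range n, f (D.τ (i : ℤ) y) := by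
  simp [seg]

theorem seg_add (m n : ℕ) (y : X) : D.seg (m + n) y = D.seg m y + D.seg n (D.τ (m : ℤ) y) := by
  rw [seg, Finset.sum_range_add]
  congr 1
  refine Finset.sum_congr rfl fun i _ => ?_
  rw [← D.add, add_comm (m : ℕ), Nat.cast_add]

theorem seg_congr {n : ℕ} {y y' : X} {f : X → ℤ}
    (h : ∀ i < n, f (D.τ (i : ℤ) y) = f (D.τ (i : ℤ) y')) : D.seg n y f = D.seg n y' f := by
  rw [seg_apply, seg_apply]
  exact Finset.sum_congr rfl fun i hi => h i (Finset.mem_range.1 hi)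

variable (D) in
/-- A base `W` consisting of a neighbourhood `G` of `x₀` and of small neighbourhoods of finitely
many marked points `F`. -/
structure Cut (x₀ : X) where
  G : Set X
  W : Set X
  F : Finset X
  P : DiscreteQuotient X
  clopen_G : IsClopen G
  clopen_W : IsClopen W
  mem_G : x₀ ∈ G
  G_sub : G ⊆ W
  F_sub : ↑F ⊆ W
  F_disj : ∀ x ∈ F, x ∉ G
  free : D.Free (insert x₀ ↑F)
  half : ∀ y ∈ W, y ∉ G → (∃ x ∈ F, D.pat W P y x) ∧ D.τ (D.ret W y : ℤ) y ∈ G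

namespace Cut

variable {x₀ : X} (c : D.Cut x₀)

theorem isBase_W : IsBase c.W := ⟨c.clopen_W, x₀, c.G_sub c.mem_G⟩

theorem isBase_G : IsBase c.G := ⟨c.clopen_G, x₀, c.mem_G⟩

/-- The retraction onto templates attached to a cut. -/
noncomputable abbrev θ : X → X := D.θ c.W c.P

variable (D) in
/-- The cut without marked points. -/
noncomputable def trivialCut (x₀ : X) : D.Cut x₀ where
  G := Set.univ
  W := Set.univ
  F := ∅
  P := ⊤
  clopen_G := isClopen_univ
  clopen_W := isClopen_univ
  mem_G := trivial
  G_sub := subset_rfl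
  F_sub := by simp
  F_disj := by simp
  free := by rintro x (rfl | h) y (rfl | h') <;> simp_all
  half y _ h := absurd trivial h

/-- The relation between consecutive cuts. -/
structure Next (c c' : D.Cut x₀) (C : Set X) : Prop where
  G_sub : c'.G ⊆ c.G
  G_small : ∀ y ∈ c'.G, c.P.toSetoid x₀ y
  F_sub : c.F ⊆ c'.F
  F_ne : c.F ≠ c'.F
  F_new : ∀ x ∈ c'.F, x ∉ c.F → x ∈ c.G
  W_sub : c'.W ⊆ c.W
  P_le : c'.P ≤ c.P
  P_W : ∀ x y, c'.P.toSetoid x y → (x ∈ c.W ↔ y ∈ c.W)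
  P_G : ∀ x y, c'.P.toSetoid x y → (x ∈ c.G ↔ y ∈ c.G)
  P_C : ∀ x y, c'.P.toSetoid x y → (x ∈ C ↔ y ∈ C)
  full : ∀ g ∈ c.G, ∃ p ∈ c'.F, ∃ q ∈ c'.F, ∀ φ : X → ℤ,
    D.seg (D.ret c.G g) g (fun x => φ (c.θ x)) =
      D.seg (D.ret c'.W q) q (fun x => φ (c.θ x)) - D.seg (D.ret c'.W p) p (fun x => φ (c.θ x))
  swap : ∃ p ∈ c'.F, ∃ q ∈ c'.F, ∃ Q : Set X, IsClopen Q ∧ p ∈ Q ∧ q ∉ Q ∧ Disjoint Q c'.G ∧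
    (∀ x y, c'.P.toSetoid x y → (x ∈ Q ↔ y ∈ Q)) ∧
    (∀ x y, c'.P.toSetoid x y → (D.τ 1 x ∈ Q ↔ D.τ 1 y ∈ Q)) ∧
    ∀ φ : X → ℤ, D.seg (D.ret c'.W p) p (fun x => φ (c.θ x)) =
      D.seg (D.ret c'.W q) q (fun x => φ (c.θ x))

/-- The functionals which agree on functions of `c.θ` with combinations of blocks of `c'`. -/
def combos (c c' : D.Cut x₀) : AddSubgroup ((X → ℤ) →+ ℤ) where
  carrier := {L | ∃ α ∈ AddSubgroup.closure ((fun w => D.seg (D.ret c'.W w) w) '' c'.W),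
    ∀ φ : X → ℤ, α (fun x => φ (c.θ x)) = L (fun x => φ (c.θ x))}
  zero_mem' := ⟨0, zero_mem _, fun _ => rfl⟩
  add_mem' := by
    rintro L L' ⟨α, hα, h⟩ ⟨α', hα', h'⟩
    exact ⟨α + α', add_mem hα hα', fun φ => by simp [h, h']⟩
  neg_mem' := by
    rintro L ⟨α, hα, h⟩
    exact ⟨-α, neg_mem hα, fun φ => by simp [h]⟩

variable {c} {c' : D.Cut x₀} {C : Set X}

theorem seg_mem_combos {w : X} (hw : w ∈ c'.W) : D.seg (D.ret c'.W w) w ∈ c.combos c' :=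
  ⟨_, AddSubgroup.subset_closure ⟨w, hw, rfl⟩, fun _ => rfl⟩

theorem mem_combos_congr {L L' : (X → ℤ) →+ ℤ} (hL : L ∈ c.combos c')
    (h : ∀ φ : X → ℤ, L (fun x => φ (c.θ x)) = L' (fun x => φ (c.θ x))) : L' ∈ c.combos c' := by
  obtain ⟨α, hα, hh⟩ := hL
  exact ⟨α, hα, fun φ => (hh φ).trans (h φ)⟩

namespace Next

theorem full_mem (h : c.Next c' C) {g : X} (hg : g ∈ c.G) :
    D.seg (D.ret c.G g) g ∈ c.combos c' := by
  obtain ⟨p, hp, q, hq, hpq⟩ := h.full g hg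
  exact mem_combos_congr (sub_mem (seg_mem_combos (c'.F_sub hq)) (seg_mem_combos (c'.F_sub hp)))
    fun φ => (hpq φ).symm

theorem multi_mem (h : c.Next c' C) (m : ℕ) : ∀ g ∈ c.G, D.τ (m : ℤ) g ∈ c.G →
    D.seg m g ∈ c.combos c' := by
  induction m using Nat.strong_induction_on with
  | _ m ih =>
    intro g hg hm
    rcases m.eq_zero_or_pos with rfl | h0
    · simp [seg, zero_mem (c.combos c')]
    have hl := ret_le h0 hm
    obtain ⟨k, rfl⟩ := Nat.exists_eq_add_of_le hl
    have hr := c.isBase_G.ret_spec (D := D) g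
    rw [seg_add]
    refine add_mem (h.full_mem hg) (ih k (by omega) _ hr.2 ?_)
    rwa [← D.add, add_comm, ← Nat.cast_add]

theorem half_mem (h : c.Next c' C) {y : X} (hy : y ∈ c.W) (hyG : y ∉ c.G) :
    D.seg (D.ret c.W y) y ∈ c.combos c' := by
  obtain ⟨⟨x, hx, hyx⟩, -⟩ := c.half y hy hyG
  have hxW := c.F_sub hx
  have hx' : x ∈ c'.F := h.F_sub hx
  have hr := (c.half x hxW (c.F_disj x hx)).2
  have hs := (c'.half x (c'.F_sub hx') (c'.F_disj x hx')).2
  have hle : D.ret c.W x ≤ D.ret c'.W x :=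
    ret_le (c'.isBase_W.ret_pos x) (h.W_sub (c'.G_sub hs))
  obtain ⟨k, hk⟩ := Nat.exists_eq_add_of_le hle
  have h1 := seg_mem_combos (c := c) (c'.F_sub hx')
  rw [hk, seg_add] at h1
  have h2 := h.multi_mem k _ hr (by
    rw [← D.add, add_comm, ← Nat.cast_add, ← hk]
    exact h.G_sub hs)
  have h3 : D.seg (D.ret c.W x) x ∈ c.combos c' := by
    simpa using sub_mem h1 h2
  refine mem_combos_congr h3 fun φ => ?_
  rw [hyx.2.1]
  refine seg_congr fun i hi => ?_
  rw [Cut.θ, θ_τ hxW hi, θ_τ hy (hyx.2.1 ▸ hi), tmpl_eq hyx]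

theorem block_mem (h : c.Next c' C) {y : X} (hy : y ∈ c.W) :
    D.seg (D.ret c.W y) y ∈ c.combos c' := by
  by_cases hyG : y ∈ c.G
  · have hr := (c.isBase_W.ret_spec (D := D) y).2
    by_cases hz : D.τ (D.ret c.W y : ℤ) y ∈ c.G
    · exact h.multi_mem _ y hyG hz
    · have h1 := h.half_mem hr hz
      have h2 := (c.half _ hr hz).2
      rw [← D.add, add_comm, ← Nat.cast_add] at h2
      have h3 := h.multi_mem _ y hyG h2
      rw [seg_add] at h3
      simpa using sub_mem h3 h1
  · exact h.half_mem hy hyG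

end Next

end Cut

end MinSys

/-! ### Refining a cut -/

namespace DiscreteQuotient

variable {X : Type} [TopologicalSpace X]

theorem exists_separating [CompactSpace X] [T2Space X] [TotallyDisconnectedSpace X]
    (Z : Finset X) : ∃ P : DiscreteQuotient X, ∀ x ∈ Z, ∀ y ∈ Z, P.toSetoid x y → x = y := by
  classical
  have h : ∀ p : X × X, ∃ P : DiscreteQuotient X, P.toSetoid p.1 p.2 → p.1 = p.2 := by
    rintro ⟨x, y⟩
    by_cases hxy : x = y
    · exact ⟨⊤, fun _ => hxy⟩
    obtain ⟨A, hA, hx, hy⟩ := exists_isClopen_of_totally_separated hxy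
    exact ⟨ofIsClopen hA, fun h => absurd (h.1 hx) hy⟩
  choose P hP using h
  refine ⟨(Z ×ˢ Z).inf P, fun x hx y hy hxy => hP (x, y) ?_⟩
  exact (Finset.inf_le (f := P) (Finset.mk_mem_product hx hy)) hxy

theorem mem_iff_of_le {A : Set X} (hA : IsClopen A) {P : DiscreteQuotient X}
    (h : P ≤ ofIsClopen hA) {x y : X} (hxy : P.toSetoid x y) : x ∈ A ↔ y ∈ A := h hxy

end DiscreteQuotient

namespace MinSys.Cut

variable {X : Type} [TopologicalSpace X] {D : MinSys X} {x₀ : X}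

section Build

variable {G : Set X} {F : Finset X} {P : DiscreteQuotient X}

variable (D G F P) in
/-- The neighbourhoods of the marked points, together with the set `G`. -/
def wide : Set X :=
  G ∪ {y | ∃ x ∈ F, ∀ i ≤ D.ret G x, P.toSetoid (D.τ (i : ℤ) y) (D.τ (i : ℤ) x)}

theorem isClopen_wide (hG : IsClopen G) : IsClopen (wide D G F P) := by
  refine hG.union ?_
  have : {y | ∃ x ∈ F, ∀ i ≤ D.ret G x, P.toSetoid (D.τ (i : ℤ) y) (D.τ (i : ℤ) x)} =
      ⋃ x ∈ F, ⋂ i ∈ Finset.range (D.ret G x + 1),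
        {y | P.toSetoid (D.τ (i : ℤ) y) (D.τ (i : ℤ) x)} := by
    ext y
    simp
  rw [this]
  refine isClopen_biUnion_finset fun x _ => isClopen_biInter_finset fun i _ => ?_
  have := (P.isClopen_setOfPred_rel (D.τ (i : ℤ) x)).preimage (D.cont i)
  convert this using 1
  ext y
  exact Setoid.comm' _

theorem subset_wide : ↑F ⊆ wide D G F P := fun x hx =>
  Or.inr ⟨x, hx, fun _ _ => P.refl _⟩

variable (hG : IsBase G) (hGP : ∀ x y, P.toSetoid x y → (x ∈ G ↔ y ∈ G))
  (hFG : ∀ x ∈ F, x ∉ G) (hF : D.Free ↑F)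
  (hsep : ∀ x ∈ F, ∀ i ≤ D.ret G x, ∀ y ∈ F, P.toSetoid (D.τ (i : ℤ) x) y → D.τ (i : ℤ) x = y)

include hG hGP hFG hF hsep

omit hFG in
theorem ret_wide {x y : X} (hx : x ∈ F)
    (hy : ∀ i ≤ D.ret G x, P.toSetoid (D.τ (i : ℤ) y) (D.τ (i : ℤ) x)) :
    D.ret (wide D G F P) y = D.ret G x := by
  have hr := hG.ret_spec (D := D) x
  refine ret_eq hr.1 (Or.inl ((hGP _ _ (hy _ le_rfl)).2 hr.2)) fun i h0 hi => ?_
  rintro (h | ⟨x', hx', h⟩)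
  · exact notMem_of_lt_ret h0 hi ((hGP _ _ (hy i hi.le)).1 h)
  · have h1 := h 0 (Nat.zero_le _)
    simp only [Nat.cast_zero, D.zero] at h1
    have h2 := hsep x hx i hi.le x' hx' (P.trans _ _ _ (P.symm _ _ (hy i hi.le)) h1)
    have h3 := hF x hx x' hx' i h2
    rw [← h3] at h2
    have := D.aper _ _ h2
    omega

omit hFG in
theorem half_wide {y : X} (hy : y ∈ wide D G F P) (hyG : y ∉ G) :
    (∃ x ∈ F, D.pat (wide D G F P) P y x) ∧ D.τ (D.ret (wide D G F P) y : ℤ) y ∈ G := by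
  rcases hy with hy | ⟨x, hx, h⟩
  · exact absurd hy hyG
  have h1 := ret_wide hG hGP hF hsep hx h
  have h2 := ret_wide hG hGP hF hsep hx (y := x) fun _ _ => P.refl _
  refine ⟨⟨x, hx, iff_of_true (Or.inr ⟨x, hx, h⟩) (Or.inr ⟨x, hx, fun _ _ => P.refl _⟩),
    h1.trans h2.symm, fun i hi => h i (h1 ▸ hi.le)⟩, ?_⟩
  rw [h1, hGP _ _ (h _ le_rfl)]
  exact (hG.ret_spec x).2

/-- The cut with given marked points. -/
def build (hx₀ : x₀ ∈ G) (hF₀ : D.Free (insert x₀ ↑F)) : D.Cut x₀ where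
  G := G
  W := wide D G F P
  F := F
  P := P
  clopen_G := hG.clopen
  clopen_W := isClopen_wide hG.clopen
  mem_G := hx₀
  G_sub := Set.subset_union_left
  F_sub := subset_wide
  F_disj := hFG
  free := hF₀
  half _ hy hyG := half_wide hG hGP hF hsep hy hyG

end Build

variable [CompactSpace X] [T2Space X] [TotallyDisconnectedSpace X] [PerfectSpace X]

theorem exists_next (c : D.Cut x₀) {C : Set X} (hC : IsClopen C) : ∃ c', c.Next c' C := by
  classical
  have hG := c.isBase_G
  have hW := c.isBase_W
  have hθ : IsLocallyConstant c.θ := hW.isLocallyConstant_θ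
  let Θ : DiscreteQuotient X := LocallyConstant.discreteQuotient ⟨c.θ, hθ⟩
  have hΘ : ∀ x y, Θ.toSetoid x y ↔ c.θ x = c.θ y := fun x y => Iff.rfl
  let t : X → X := D.tmpl c.G Θ
  have ht : IsLocallyConstant t := hG.isLocallyConstant_tmpl
  have hfin : (Set.range t).Finite := ht.range_finite
  let Z : Finset X := (hfin.subset (Set.image_subset_range t c.G)).toFinset
  have hZ : ∀ z, z ∈ Z ↔ ∃ g ∈ c.G, t g = z := fun z => by simp [Z]
  let U : X → Set X := fun z => {g | g ∈ c.G ∧ t g = z}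
  have hU : ∀ z, IsClopen (U z) := fun z => c.clopen_G.inter (ht.isClopen_fiber z)
  let l : X → ℤ := fun z => (D.ret c.G z : ℤ)
  have hl : ∀ z, ∀ g ∈ U z, D.ret c.G g = D.ret c.G z := fun z g hg => by
    rw [← hg.2]; exact (ret_tmpl g).symm
  -- points at the top of blocks of each type
  obtain ⟨g, hg, hfree1⟩ := Free.exists_generic (S := insert x₀ c.F) (by simpa using c.free) Z U l
    (fun z _ => (hU z).isOpen) fun z hz => by
      obtain ⟨w, hw, h⟩ := (hZ z).1 hz; exact ⟨w, hw, h⟩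
  let p : X → X := fun z => D.τ (l z) (g z)
  have hpS : ∀ z ∈ Z, ∀ s ∈ insert x₀ c.F, p z ≠ s := fun z hz s hs h =>
    (hg z hz).2 s hs (-l z) (by rw [← h, D.neg_τ])
  have hpG : ∀ z ∈ Z, p z ∈ c.G := fun z hz => by
    have := (hG.ret_spec (D := D) (g z)).2
    rwa [hl z (g z) (hg z hz).1] at this
  -- the new neighbourhood of the base point
  obtain ⟨G', hG'c, hx₀, hG'⟩ := compact_exists_isClopen_in_isOpen (x := x₀)
    (U := c.G ∩ {y | c.P.toSetoid x₀ y} ∩ ((Z.image g ∪ Z.image p : Finset X) : Set X)ᶜ)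
    ((c.clopen_G.isOpen.inter (c.P.isOpen_setOfPred_rel x₀)).inter
      (Finset.finite_toSet _).isClosed.isOpen_compl) ⟨⟨c.mem_G, c.P.refl _⟩, by
      simp only [Finset.coe_union, Finset.coe_image, Set.mem_compl_iff, Set.mem_union,
        Set.mem_image, Finset.mem_coe, not_or, not_exists, not_and]
      refine ⟨fun z hz h => (hg z hz).2 x₀ (Finset.mem_insert_self _ _) 0 ?_,
        fun z hz => hpS z hz x₀ (Finset.mem_insert_self _ _)⟩
      rw [D.zero, h]⟩
  have hG'b : IsBase G' := ⟨hG'c, x₀, hx₀⟩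
  have hG'G : G' ⊆ c.G := fun y hy => (hG' hy).1.1
  have hgG' : ∀ z ∈ Z, g z ∉ G' := fun z hz h => (hG' h).2
    (by exact_mod_cast Finset.mem_union_left _ (Finset.mem_image_of_mem g hz))
  have hpG' : ∀ z ∈ Z, p z ∉ G' := fun z hz h => (hG' h).2
    (by exact_mod_cast Finset.mem_union_right _ (Finset.mem_image_of_mem p hz))
  let a : X → ℕ := fun z => D.ret G' (p z)
  let n : X → ℕ := fun z => D.ret c.G z + a z
  have hn : ∀ z, n z = D.ret c.G z + a z := fun _ => rfl
  let Θ' := Θ ⊓ DiscreteQuotient.ofIsClopen hG'c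
  have hΘ'1 : ∀ x y, Θ'.toSetoid x y → ∀ φ : X → ℤ, φ (c.θ x) = φ (c.θ y) :=
    fun x y h φ => congrArg φ ((inf_le_left : Θ' ≤ Θ) h)
  have hΘ'2 : ∀ x y, Θ'.toSetoid x y → (x ∈ G' ↔ y ∈ G') := fun x y h =>
    DiscreteQuotient.mem_iff_of_le hG'c inf_le_right h
  let V : X → Set X := fun z => {y | y ∈ U z ∧
    ∀ i ∈ Finset.range (n z + 1), Θ'.toSetoid (D.τ (i : ℤ) (g z)) (D.τ (i : ℤ) y)}
  have hV : ∀ z, IsOpen (V z) := fun z => by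
    refine (hU z).isOpen.inter ?_
    have : {y | ∀ i ∈ Finset.range (n z + 1), Θ'.toSetoid (D.τ (i : ℤ) (g z)) (D.τ (i : ℤ) y)} =
        ⋂ i ∈ Finset.range (n z + 1),
          {y | Θ'.toSetoid (D.τ (i : ℤ) (g z)) (D.τ (i : ℤ) y)} := by ext; simp
    change IsOpen {y | _}
    rw [this]
    exact isOpen_biInter_finset fun i _ => (Θ'.isOpen_setOfPred_rel _).preimage (D.cont i)
  have hVi : ∀ z, ∀ y ∈ V z, ∀ i ≤ n z, Θ'.toSetoid (D.τ (i : ℤ) (g z)) (D.τ (i : ℤ) y) :=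
    fun z y hy i hi => hy.2 i (Finset.mem_range.2 (Nat.lt_succ_of_le hi))
  have hgV : ∀ z ∈ Z, g z ∈ V z := fun z hz => ⟨(hg z hz).1, fun i _ => Θ'.refl _⟩
  have hτp : ∀ z, ∀ i : ℕ, D.τ ((D.ret c.G z + i : ℕ) : ℤ) (g z) = D.τ (i : ℤ) (p z) :=
    fun z i => by rw [← D.add, add_comm, Nat.cast_add]
  have hτV : ∀ z y, ∀ i : ℕ, D.τ ((D.ret c.G z + i : ℕ) : ℤ) y = D.τ (i : ℤ) (D.τ (l z) y) :=
    fun z y i => by rw [← D.add, add_comm, Nat.cast_add]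
  have hVp : ∀ z, ∀ y ∈ V z, ∀ i ≤ a z,
      Θ'.toSetoid (D.τ (i : ℤ) (p z)) (D.τ (i : ℤ) (D.τ (l z) y)) := fun z y hy i hi => by
    rw [← hτp, ← hτV]; exact hVi z y hy _ (by have := hn z; omega)
  have hretp : ∀ z, ∀ y ∈ V z, D.ret G' (D.τ (l z) y) = a z := fun z y hy => by
    have hr := hG'b.ret_spec (D := D) (p z)
    exact ret_eq hr.1 ((hΘ'2 _ _ (hVp z y hy _ le_rfl)).1 hr.2) fun i h0 hi h =>
      notMem_of_lt_ret h0 hi ((hΘ'2 _ _ (hVp z y hy _ hi.le)).2 h)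
  have hretq : ∀ z ∈ Z, ∀ y ∈ V z, D.ret G' y = n z := fun z hz y hy => by
    have hr := hG'b.ret_spec (D := D) (D.τ (l z) y)
    rw [hretp z y hy] at hr
    have := hn z
    refine ret_eq (by have := hr.1; omega) (by rw [hτV]; exact hr.2) fun i h0 hi h => ?_
    rcases lt_trichotomy i (D.ret c.G z) with h1 | rfl | h1
    · exact notMem_of_lt_ret h0 (hl z y hy.1 ▸ h1) (hG'G h)
    · exact hpG' z hz ((hΘ'2 _ _ (hVi z y hy _ (by have := hn z; omega))).2 h)
    · obtain ⟨k, rfl⟩ := Nat.exists_eq_add_of_lt h1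
      rw [add_assoc, hτV] at h
      exact notMem_of_lt_ret (D := D) (W := G') (x := D.τ (l z) y) (k := k + 1)
        (by omega) (by rw [hretp z y hy]; omega) h
  -- points at the bottom of blocks of each type
  let S1 : Finset X := insert x₀ c.F ∪ Z.image p
  have hS1 : D.Free (S1 : Set X) := by simpa [S1, p, Set.insert_union] using hfree1
  obtain ⟨q, hq, hfree2⟩ := hS1.exists_generic Z V (fun _ => 0) (fun z _ => hV z)
    fun z hz => ⟨g z, hgV z hz⟩
  let S2 : Finset X := S1 ∪ Z.image q
  have hS2 : D.Free (S2 : Set X) := by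
    simp only [D.zero] at hfree2
    simpa [S2] using hfree2
  let z₀ := t x₀
  have hz₀ : z₀ ∈ Z := (hZ _).2 ⟨x₀, c.mem_G, rfl⟩
  obtain ⟨u, hu, huS⟩ := exists_notMem_orbits D S2 (hV z₀) ⟨g z₀, hgV z₀ hz₀⟩
  let p' := D.τ (l z₀) u
  have hp'S : ∀ s ∈ S2, p' ≠ s := fun s hs h => huS s hs (-l z₀) (by rw [← h, D.neg_τ])
  let S3 : Finset X := insert p' S2
  have hS3 : D.Free (S3 : Set X) := by simpa [S3] using hS2.union_singleton huS (l z₀)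
  have hqS : ∀ z ∈ Z, ∀ s ∈ S1, q z ≠ s := fun z hz s hs h =>
    (hq z hz).2 s hs 0 (by rw [D.zero, h])
  let F' := S3.erase x₀
  have hx₀S1 : x₀ ∈ S1 := by simp [S1]
  have hFF' : c.F ⊆ F' := fun x hx => Finset.mem_erase.2
    ⟨fun h => c.F_disj x hx (h ▸ c.mem_G), by simp [S3, S2, S1, hx]⟩
  have hpF' : ∀ z ∈ Z, p z ∈ F' := fun z hz => Finset.mem_erase.2
    ⟨hpS z hz _ (by simp), by
      simp only [S3, S2, S1, Finset.mem_insert, Finset.mem_union]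
      exact Or.inr (Or.inl (Or.inr (Finset.mem_image_of_mem p hz)))⟩
  have hqF' : ∀ z ∈ Z, q z ∈ F' := fun z hz => Finset.mem_erase.2
    ⟨hqS z hz _ hx₀S1, by
      simp only [S3, S2, Finset.mem_insert, Finset.mem_union]
      exact Or.inr (Or.inr (Finset.mem_image_of_mem q hz))⟩
  have hp'F' : p' ∈ F' := Finset.mem_erase.2
    ⟨hp'S _ (Finset.mem_union_left _ hx₀S1), Finset.mem_insert_self _ _⟩
  have hF'cases : ∀ x ∈ F', x ∈ c.F ∨ (∃ z ∈ Z, p z = x) ∨ (∃ z ∈ Z, q z = x) ∨ x = p' := by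
    intro x hx
    obtain ⟨hx0, hx⟩ := Finset.mem_erase.1 hx
    simp only [S3, S2, S1, Finset.mem_insert, Finset.mem_union, Finset.mem_image] at hx
    rcases hx with h | ((h | h) | h) | h
    · exact Or.inr (Or.inr (Or.inr h))
    · exact absurd h hx0
    · exact Or.inl h
    · exact Or.inr (Or.inl h)
    · exact Or.inr (Or.inr (Or.inl h))
  have hp'G' : p' ∉ G' := fun h =>
    hpG' z₀ hz₀ ((hΘ'2 _ _ (hVi z₀ u hu _ (by have := hn z₀; omega))).2 h)
  have hF'G' : ∀ x ∈ F', x ∉ G' := fun x hx => by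
    rcases hF'cases x hx with h | ⟨z, hz, rfl⟩ | ⟨z, hz, rfl⟩ | rfl
    · exact fun h' => c.F_disj x h (hG'G h')
    · exact hpG' z hz
    · intro h
      have := hVi z _ (hq z hz).1 0 (Nat.zero_le _)
      simp only [Nat.cast_zero, D.zero] at this
      exact hgG' z hz ((hΘ'2 _ _ this).2 h)
    · exact hp'G'
  have hp'G : p' ∈ c.G := by
    have := (hG.ret_spec (D := D) u).2
    rwa [hl z₀ u hu.1] at this
  have hF'new : ∀ x ∈ F', x ∉ c.F → x ∈ c.G := fun x hx hxF => by
    rcases hF'cases x hx with h | ⟨z, hz, rfl⟩ | ⟨z, hz, rfl⟩ | rfl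
    · exact absurd h hxF
    · exact hpG z hz
    · exact (hq z hz).1.1.1
    · exact hp'G
  have hF'free : D.Free (insert x₀ ↑F') := by
    refine hS3.mono ?_
    rintro x (rfl | hx)
    · simp [S3, S2, S1]
    · exact Finset.mem_coe.2 (Finset.mem_of_mem_erase hx)
  -- the clopen set distinguishing two marked points
  have hpp' : p z₀ ≠ p' := fun h => hp'S (p z₀) (by
    simp only [S2, S1, Finset.mem_union]
    exact Or.inl (Or.inr (Finset.mem_image_of_mem p hz₀))) h.symm
  obtain ⟨Q, hQc, hpQ, hQ⟩ := compact_exists_isClopen_in_isOpen (x := p z₀) (U := G'ᶜ ∩ {p'}ᶜ)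
    (hG'c.compl.isOpen.inter isOpen_compl_singleton) ⟨hpG' z₀ hz₀, hpp'⟩
  have hp'Q : p' ∉ Q := fun h => (hQ h).2 rfl
  have hQG' : Disjoint Q G' := Set.disjoint_left.2 fun x hx => (hQ hx).1
  -- the new partition
  obtain ⟨R, hR⟩ := DiscreteQuotient.exists_separating
    (F'.biUnion fun x => (Finset.range (D.ret G' x + 1)).image fun i : ℕ => D.τ (i : ℤ) x)
  have hQ1c := isClopen_preimage_τ (D := D) hQc 1
  obtain ⟨P', h1, h2, h3, h4, h5, h6, h7, h8⟩ : ∃ P' : DiscreteQuotient X, P' ≤ c.P ∧ P' ≤ R ∧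
      P' ≤ .ofIsClopen hC ∧ P' ≤ .ofIsClopen c.clopen_W ∧ P' ≤ .ofIsClopen c.clopen_G ∧
      P' ≤ .ofIsClopen hG'c ∧ P' ≤ .ofIsClopen hQc ∧ P' ≤ .ofIsClopen hQ1c := by
    refine ⟨c.P ⊓ (R ⊓ (.ofIsClopen hC ⊓ (.ofIsClopen c.clopen_W ⊓ (.ofIsClopen c.clopen_G ⊓
      (.ofIsClopen hG'c ⊓ (.ofIsClopen hQc ⊓ .ofIsClopen hQ1c)))))), ?_⟩
    simp only [← le_inf_iff]
    exact le_rfl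
  have hPW : ∀ x y, P'.toSetoid x y → (x ∈ c.W ↔ y ∈ c.W) := fun x y h => h4 h
  have hPG : ∀ x y, P'.toSetoid x y → (x ∈ c.G ↔ y ∈ c.G) := fun x y h => h5 h
  have hPG' : ∀ x y, P'.toSetoid x y → (x ∈ G' ↔ y ∈ G') := fun x y h => h6 h
  have hF'f : D.Free (F' : Set X) := hF'free.mono (Set.subset_insert _ _)
  have hsep : ∀ x ∈ F', ∀ i ≤ D.ret G' x, ∀ y ∈ F',
      P'.toSetoid (D.τ (i : ℤ) x) y → D.τ (i : ℤ) x = y := fun x hx i hi y hy h => by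
    refine hR _ (Finset.mem_biUnion.2 ⟨x, hx, Finset.mem_image.2
      ⟨i, Finset.mem_range.2 (Nat.lt_succ_of_le hi), rfl⟩⟩) _ (Finset.mem_biUnion.2 ⟨y, hy,
      Finset.mem_image.2 ⟨0, Finset.mem_range.2 (Nat.succ_pos _), ?_⟩⟩) (h2 h)
    rw [Nat.cast_zero, D.zero]
  have hret : ∀ x ∈ F', D.ret (wide D G' F' P') x = D.ret G' x := fun x hx =>
    ret_wide hG'b hPG' hF'f hsep hx fun _ _ => P'.refl _
  refine ⟨build hG'b hPG' hF'G' hF'f hsep hx₀ hF'free, ?_⟩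
  refine
    { G_sub := hG'G
      G_small := fun y hy => (hG' hy).1.2
      F_sub := hFF'
      F_ne := fun h => ?_
      F_new := hF'new
      W_sub := ?_
      P_le := h1
      P_W := hPW
      P_G := hPG
      P_C := fun x y h => h3 h
      full := fun w hw => ?_
      swap := ⟨p z₀, hpF' z₀ hz₀, p', hp'F', Q, hQc, hpQ, hp'Q, hQG', fun x y h => h7 h,
        fun x y h => h8 h, fun φ => ?_⟩ }
  · refine hp'S p' ?_ rfl
    have : p' ∈ c.F := h ▸ hp'F'
    simp [S2, S1, this]
  · rintro y (hy | ⟨x, hx, hy⟩)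
    · exact c.G_sub (hG'G hy)
    · have h0 := hy 0 (Nat.zero_le _)
      simp only [Nat.cast_zero, D.zero] at h0
      refine (hPW _ _ h0).2 ?_
      by_cases hxF : x ∈ c.F
      · exact c.F_sub hxF
      · exact c.G_sub (hF'new x hx hxF)
  · have hz : t w ∈ Z := (hZ _).2 ⟨w, hw, rfl⟩
    refine ⟨p (t w), hpF' _ hz, q (t w), hqF' _ hz, fun φ => ?_⟩
    change _ = D.seg (D.ret (wide D G' F' P') _) _ _ - D.seg (D.ret (wide D G' F' P') _) _ _
    rw [hret _ (hqF' _ hz), hret _ (hpF' _ hz), hretq _ hz _ (hq _ hz).1]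
    have e1 : D.seg (n (t w)) (q (t w)) (fun x => φ (c.θ x)) =
        D.seg (n (t w)) (g (t w)) fun x => φ (c.θ x) :=
      seg_congr fun i hi => (hΘ'1 _ _ (hVi _ _ (hq _ hz).1 i hi.le) φ).symm
    have e2 : D.pat c.G Θ w (g (t w)) := by
      have h1 := pat_tmpl (D := D) (W := c.G) (P := Θ) w
      have h2 := pat_tmpl (D := D) (W := c.G) (P := Θ) (g (t w))
      rw [show D.tmpl c.G Θ (g (t w)) = D.tmpl c.G Θ w from (hg _ hz).1.2] at h2
      exact (D.pat c.G Θ).trans h1 ((D.pat c.G Θ).symm h2)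
    have e3 : D.seg (D.ret c.G w) w (fun x => φ (c.θ x)) =
        D.seg (D.ret c.G w) (g (t w)) fun x => φ (c.θ x) :=
      seg_congr fun i hi => congrArg φ (e2.2.2 i hi)
    have e4 : D.ret c.G w = D.ret c.G (t w) := hl _ w ⟨hw, rfl⟩
    rw [e1, e3, seg_add, e4, AddMonoidHom.add_apply, add_sub_cancel_right]
  · change D.seg (D.ret (wide D G' F' P') _) _ _ = D.seg (D.ret (wide D G' F' P') _) _ _
    rw [hret _ (hpF' _ hz₀), hret _ hp'F', hretp _ _ hu]
    exact seg_congr fun i hi => hΘ'1 _ _ (hVp _ _ hu i hi.le) φ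

end MinSys.Cut

/-! ### The tower system of a chain of cuts -/

namespace MinSys.Cut

variable {X : Type} [TopologicalSpace X] {D : MinSys X} {x₀ : X}

/-- A sequence of successively refined cuts resolving all clopen sets. -/
structure Chain (c : ℕ → D.Cut x₀) (C : ℕ → Set X) : Prop where
  zero : (c 0).W = Set.univ
  next : ∀ n, (c n).Next (c (n + 1)) (C n)
  all : ∀ A, IsClopen A → ∃ n, C n = A

theorem exists_chain [CompactSpace X] [T2Space X] [TotallyDisconnectedSpace X] [PerfectSpace X]
    [SecondCountableTopology X] (D : MinSys X) (x₀ : X) :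
    ∃ (c : ℕ → D.Cut x₀) (C : ℕ → Set X), Chain c C := by
  have : Countable (TopologicalSpace.Clopens X) :=
    TopologicalSpace.Clopens.countable_iff_secondCountable.2 inferInstance
  obtain ⟨C, hC⟩ := exists_surjective_nat (TopologicalSpace.Clopens X)
  choose f hf using fun (c : D.Cut x₀) (n : ℕ) => c.exists_next (C n).isClopen
  refine ⟨fun n => n.rec (trivialCut D x₀) fun n c => f c n, fun n => C n, rfl, fun n => hf _ n,
    fun A hA => ?_⟩
  obtain ⟨n, hn⟩ := hC ⟨A, hA⟩
  exact ⟨n, by rw [hn]; rfl⟩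

namespace Chain

variable {c : ℕ → D.Cut x₀} {C : ℕ → Set X} (h : Chain c C)

include h

theorem G_anti {m n : ℕ} (hmn : m ≤ n) : (c n).G ⊆ (c m).G :=
  antitone_nat_of_succ_le (f := fun n => (c n).G) (fun n => (h.next n).G_sub) hmn

theorem W_anti {m n : ℕ} (hmn : m ≤ n) : (c n).W ⊆ (c m).W :=
  antitone_nat_of_succ_le (f := fun n => (c n).W) (fun n => (h.next n).W_sub) hmn

theorem F_mono {m n : ℕ} (hmn : m ≤ n) : (c m).F ⊆ (c n).F :=
  monotone_nat_of_le_succ (f := fun n => (c n).F) (fun n => (h.next n).F_sub) hmn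

theorem P_anti {m n : ℕ} (hmn : m ≤ n) : (c n).P ≤ (c m).P :=
  antitone_nat_of_succ_le (f := fun n => (c n).P) (fun n => (h.next n).P_le) hmn

theorem exists_P {A : Set X} (hA : IsClopen A) :
    ∃ N, ∀ n ≥ N, ∀ x y, (c n).P.toSetoid x y → (x ∈ A ↔ y ∈ A) := by
  obtain ⟨m, rfl⟩ := h.all A hA
  exact ⟨m + 1, fun n hn x y hxy => (h.next m).P_C x y (h.P_anti hn hxy)⟩

theorem resolves {m n : ℕ} (hmn : m ≤ n) : D.Resolves (c m).W (c n).W (c n).P := by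
  rcases hmn.eq_or_lt with rfl | hlt
  · exact (c m).isBase_W.resolves_self
  · exact (c n).isBase_W.resolves (h.W_anti hmn)
      fun x y hxy => (h.next m).P_W x y (h.P_anti hlt hxy)

theorem θ_comp {m n : ℕ} (hmn : m ≤ n) (x : X) : (c m).θ ((c n).θ x) = (c m).θ x :=
  (c m).isBase_W.θ_comp (c n).isBase_W (h.resolves hmn) (h.P_anti hmn) x

theorem θ_mem {A : Set X} (hA : IsClopen A) : ∃ N, ∀ n ≥ N, ∀ x, (c n).θ x ∈ A ↔ x ∈ A := by
  obtain ⟨N, hN⟩ := h.exists_P hA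
  exact ⟨N, fun n hn x => (hN n hn _ _ ((c n).isBase_W.rel_θ x)).symm⟩

theorem F_tail {m n : ℕ} {x : X} (hx : x ∈ (c n).F) (hx' : x ∉ (c m).F) : x ∈ (c m).G := by
  induction n with
  | zero => exact absurd (h.F_mono (Nat.zero_le m) hx) hx'
  | succ n ih =>
    by_cases hn : x ∈ (c n).F
    · exact ih hn
    · have : m ≤ n := by
        by_contra! hlt
        exact hx' (h.F_mono hlt hx)
      exact h.G_anti this ((h.next n).F_new x hx hn)

theorem G_small {A : Set X} (hA : IsClopen A) (hx : x₀ ∈ A) : ∃ N, ∀ n ≥ N, (c n).G ⊆ A := by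
  obtain ⟨N, hN⟩ := h.exists_P hA
  refine ⟨N + 1, fun n hn y hy => ?_⟩
  exact (hN N le_rfl _ _ ((h.next N).G_small y (h.G_anti hn hy))).1 hx

theorem mem_W {m : ℕ} {x : X} (hx : x = x₀ ∨ x ∈ (c m).F) (n : ℕ) : x ∈ (c n).W := by
  rcases hx with rfl | hx
  · exact (c n).G_sub (c n).mem_G
  · rcases le_total m n with hmn | hmn
    · exact (c n).F_sub (h.F_mono hmn hx)
    · exact h.W_anti hmn ((c m).F_sub hx)

theorem F_infinite : {x | ∃ n, x ∈ (c n).F}.Infinite := by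
  intro hfin
  have hle : ∀ n, n ≤ (c n).F.card := by
    intro n
    induction n with
    | zero => exact Nat.zero_le _
    | succ n ih => exact ih.trans_lt (Finset.card_lt_card
        ((h.next n).F_sub.ssubset_of_ne (h.next n).F_ne))
  have h1 := Finset.card_le_card (s := (c (hfin.toFinset.card + 1)).F) (t := hfin.toFinset)
    fun x hx => by simpa using ⟨_, hx⟩
  have := hle (hfin.toFinset.card + 1)
  omega

theorem mark_of_mem [CompactSpace X] [T2Space X] [TotallyDisconnectedSpace X] {x : X}
    (hx : ∀ n, x ∈ (c n).W) : ∃ n, x = x₀ ∨ x ∈ (c n).F := by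
  by_contra! hne
  obtain ⟨A, hA, hxA, hx₀A⟩ := exists_isClopen_of_totally_separated (hne 0).1.symm
  obtain ⟨m, hm⟩ := h.G_small hA hxA
  have hxG : x ∉ (c m).G := fun hxG => hx₀A (hm m le_rfl hxG)
  obtain ⟨B, hB, hxB, hBF⟩ := compact_exists_isClopen_in_isOpen (x := x)
    (U := ((c m).F : Set X)ᶜ) (Finset.finite_toSet _).isClosed.isOpen_compl (hne m).2
  obtain ⟨k, hk⟩ := h.exists_P hB
  set n := max k (m + 1)
  have hxn : x ∉ (c n).G := fun hxn => hxG (h.G_anti (by omega) hxn)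
  obtain ⟨⟨y, hy, hxy⟩, -⟩ := (c n).half x (hx n) hxn
  have h1 := hxy.2.2 0 ((c n).isBase_W.ret_pos x)
  simp only [Nat.cast_zero, D.zero] at h1
  have h2 := (hk n (le_max_left _ _) _ _ h1).1 hxB
  have h3 : y ∉ (c m).G := fun hyG =>
    hxG (((h.next m).P_G _ _ (h.P_anti (le_max_right _ _) h1)).2 hyG)
  by_cases hym : y ∈ (c m).F
  · exact hBF h2 hym
  · exact h3 (h.F_tail hy hym)

theorem free_iInter [CompactSpace X] [T2Space X] [TotallyDisconnectedSpace X] :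
    D.Free {x | ∀ n, x ∈ (c n).W} := by
  intro x hx y hy k hk
  obtain ⟨m, hm⟩ := h.mark_of_mem hx
  obtain ⟨n, hn⟩ := h.mark_of_mem hy
  refine (c (max m n)).free x ?_ y ?_ k hk
  · exact hm.imp_right fun hm => h.F_mono (le_max_left _ _) hm
  · exact hn.imp_right fun hn => h.F_mono (le_max_right _ _) hn

theorem exists_notMem [CompactSpace X] [T2Space X] [TotallyDisconnectedSpace X] (k : ℤ)
    (hk : k ≠ 0) : ∃ N, ∀ n ≥ N, ∀ x ∈ (c n).W, D.τ k x ∉ (c n).W := by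
  by_contra! hne
  have hc : ∀ n, IsClopen ((c n).W ∩ {x | D.τ k x ∈ (c n).W}) := fun n =>
    (c n).clopen_W.inter (isClopen_preimage_τ (c n).clopen_W k)
  obtain ⟨x, hx⟩ := IsCompact.nonempty_iInter_of_sequence_nonempty_isCompact_isClosed
    (fun n => (c n).W ∩ {x | D.τ k x ∈ (c n).W})
    (fun n x hx => ⟨h.W_anti n.le_succ hx.1, h.W_anti n.le_succ hx.2⟩)
    (fun n => by
      obtain ⟨m, hm, x, hx, hx'⟩ := hne n
      exact ⟨x, h.W_anti hm hx, h.W_anti hm hx'⟩) (hc 0).isClosed.isCompact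
    fun n => (hc n).isClosed
  rw [Set.mem_iInter] at hx
  have := h.free_iInter x (fun n => (hx n).1) _ (fun n => (hx n).2) k rfl
  exact hk (D.aper k x this.symm)

theorem exists_lt_return [CompactSpace X] [T2Space X] [TotallyDisconnectedSpace X] (L : ℕ) :
    ∃ N, ∀ n ≥ N, ∀ x ∈ (c n).W, ∀ k : ℕ, 0 < k → k ≤ L → D.τ (k : ℤ) x ∉ (c n).W := by
  obtain ⟨N, hN⟩ := exists_forall_ge_of_finite {k : ℕ | 0 < k ∧ k ≤ L}
    ((Set.finite_Iic L).subset fun k hk => hk.2)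
    (fun k n => ∀ x ∈ (c n).W, D.τ (k : ℤ) x ∉ (c n).W)
    fun k hk => h.exists_notMem k (by have := hk.1; omega)
  exact ⟨N, fun n hn x hx k h0 hk => hN n hn k ⟨h0, hk⟩ x hx⟩

omit h in
theorem closure_block (n : ℕ) : AddSubgroup.closure (Set.range fun x =>
      ∑ y ∈ D.block (c n).W x, Pi.evalAddMonoidHom (fun _ : X => ℤ) y) =
    AddSubgroup.closure ((fun w => D.seg (D.ret (c n).W w) w) '' (c n).W) := by
  congr 1
  ext α
  simp only [Set.mem_range, Set.mem_image, sum_block]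
  constructor
  · rintro ⟨x, rfl⟩
    exact ⟨D.base (c n).W x, (c n).isBase_W.base_mem x, rfl⟩
  · rintro ⟨w, hw, rfl⟩
    exact ⟨w, by rw [(c n).isBase_W.base_of_mem hw]; rfl⟩

theorem exists_combo {n M : ℕ} (hnM : n ≤ M) {L : (X → ℤ) →+ ℤ}
    (hL : L ∈ AddSubgroup.closure ((fun w => D.seg (D.ret (c n).W w) w) '' (c n).W)) :
    ∃ α ∈ AddSubgroup.closure ((fun w => D.seg (D.ret (c M).W w) w) '' (c M).W),
      ∀ φ : X → ℤ, α (fun x => φ ((c n).θ x)) = L (fun x => φ ((c n).θ x)) := by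
  induction M, hnM using Nat.le_induction with
  | base => exact ⟨L, hL, fun _ => rfl⟩
  | succ M hM ih =>
    obtain ⟨α, hα, hφ⟩ := ih
    have hle : AddSubgroup.closure ((fun w => D.seg (D.ret (c M).W w) w) '' (c M).W) ≤
        (c M).combos (c (M + 1)) := by
      rw [AddSubgroup.closure_le]
      rintro _ ⟨w, hw, rfl⟩
      exact (h.next M).block_mem hw
    obtain ⟨β, hβ, hψ⟩ := hle hα
    refine ⟨β, hβ, fun φ => ?_⟩
    have := hψ fun x => φ ((c n).θ x)
    simp only [h.θ_comp hM] at this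
    rw [this, hφ]

theorem exists_free (n : ℕ) (I : LocallyConstant X ℤ →+ ℝ)
    (hI : ∀ f g : LocallyConstant X ℤ, (∀ x, g x = f (D.τ 1 x)) → I g = I f) :
    ∃ δ : LocallyConstant X ℤ, I δ = 0 ∧ ∃ N, ∀ M ≥ N,
      ∃ α ∈ AddSubgroup.closure ((fun w => D.seg (D.ret (c M).W w) w) '' (c M).W),
        (∀ φ : X → ℤ, α (fun x => φ ((c n).θ x)) = 0) ∧ α δ = 1 := by
  classical
  obtain ⟨p, hp, q, hq, Q, hQ, hpQ, hqQ, hdis, h1, h2, hpq⟩ := (h.next n).swap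
  let f : LocallyConstant X ℤ := LocallyConstant.charFn ℤ hQ
  have hf : ∀ x, f x = if x ∈ Q then 1 else 0 := fun x => by
    simp [f, LocallyConstant.coe_charFn, Set.indicator_apply]
  let g : LocallyConstant X ℤ := f.comap ⟨D.τ 1, D.cont 1⟩
  have hg : ∀ x, g x = f (D.τ 1 x) := fun x => rfl
  obtain ⟨δ, hδ, hIδ⟩ : ∃ δ : LocallyConstant X ℤ, (∀ x, δ x = f x - f (D.τ 1 x)) ∧ I δ = 0 :=
    ⟨f - g, fun x => rfl, by rw [map_sub, hI f g hg, sub_self]⟩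
  have hδθ : ∀ x, δ ((c (n + 1)).θ x) = δ x := fun x => by
    have hr := (c (n + 1)).isBase_W.rel_θ (D := D) (P := (c (n + 1)).P) x
    rw [hδ, hδ, hf, hf, hf, hf]
    congr 2
    · exact propext (h1 _ _ hr).symm
    · exact propext (h2 _ _ hr).symm
  have hseg : ∀ x ∈ (c (n + 1)).F, D.seg (D.ret (c (n + 1)).W x) x δ = f x := by
    intro x hx
    have hG := ((c (n + 1)).half x ((c (n + 1)).F_sub hx) ((c (n + 1)).F_disj x hx)).2
    rw [seg_apply]
    have e : ∀ i : ℕ, δ (D.τ (i : ℤ) x) =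
        f (D.τ (i : ℤ) x) - f (D.τ ((i + 1 : ℕ) : ℤ) x) := fun i => by
      rw [hδ, ← D.add]
      congr 3
      push_cast; ring
    refine (Finset.sum_congr rfl fun i _ => e i).trans ?_
    rw [Finset.sum_range_sub', Nat.cast_zero, D.zero]
    rw [hf (D.τ _ x), if_neg fun hQ' => Set.disjoint_left.1 hdis hQ' hG, sub_zero]
  refine ⟨δ, hIδ, n + 1, fun M hM => ?_⟩
  obtain ⟨α, hα, hφ⟩ := h.exists_combo hM (L := D.seg (D.ret (c (n + 1)).W p) p -
    D.seg (D.ret (c (n + 1)).W q) q) (sub_mem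
      (AddSubgroup.subset_closure ⟨p, (c (n + 1)).F_sub hp, rfl⟩)
      (AddSubgroup.subset_closure ⟨q, (c (n + 1)).F_sub hq, rfl⟩))
  refine ⟨α, hα, fun φ => ?_, ?_⟩
  · have := hφ fun x => φ ((c n).θ x)
    simp only [h.θ_comp n.le_succ] at this
    rw [this, AddMonoidHom.sub_apply, hpq, sub_self]
  · have e : (fun x => δ ((c (n + 1)).θ x)) = ⇑δ := funext hδθ
    have := hφ δ
    rw [e] at this
    refine this.trans ?_
    change D.seg _ p δ - D.seg _ q δ = 1
    rw [hseg p hp, hseg q hq, hf, hf, if_pos hpQ, if_neg hqQ, sub_zero]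

end Chain

end MinSys.Cut

namespace MinSys.Cut.Chain

variable {X : Type} [TopologicalSpace X] {D : MinSys X} {x₀ : X} {c : ℕ → D.Cut x₀}
  {C : ℕ → Set X} (h : Chain c C)

include h

theorem exists_marks : ∃ ζ : ℕ → X, Function.Injective ζ ∧ ζ 0 = x₀ ∧
    (∀ x, (∃ n, x = x₀ ∨ x ∈ (c n).F) → ∃ j, ζ j = x) ∧ ∀ j n, ζ j ∈ (c n).W := by
  have hinf := h.F_infinite
  have hcount : {x | ∃ n, x ∈ (c n).F}.Countable := by
    have : {x | ∃ n, x ∈ (c n).F} = ⋃ n, ((c n).F : Set X) := by ext; simp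
    rw [this]
    exact Set.countable_iUnion fun n => Finset.countable_toSet _
  have := hinf.to_subtype
  have := hcount.to_subtype
  obtain ⟨hd⟩ := nonempty_denumerable {x | ∃ n, x ∈ (c n).F}
  let e := (Denumerable.eqv {x | ∃ n, x ∈ (c n).F}).symm
  have hne : ∀ j, (e j : X) ≠ x₀ := fun j hj => by
    obtain ⟨n, hn⟩ := (e j).2
    exact (c n).F_disj _ hn (by rw [hj]; exact (c n).mem_G)
  refine ⟨fun j => j.casesOn x₀ fun j => e j, ?_, rfl, ?_, ?_⟩
  · rintro (_ | i) (_ | j) hij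
    · rfl
    · exact absurd hij.symm (hne j)
    · exact absurd hij (hne i)
    · rw [e.injective (Subtype.ext hij)]
  · rintro x ⟨n, rfl | hx⟩
    · exact ⟨0, rfl⟩
    · exact ⟨e.symm ⟨x, n, hx⟩ + 1, by simp⟩
  · rintro (_ | j) n
    · exact h.mem_W (m := 0) (Or.inl rfl) n
    · obtain ⟨m, hm⟩ := (e j).2
      exact h.mem_W (Or.inr hm) n

variable [CompactSpace X] [T2Space X] [TotallyDisconnectedSpace X]

theorem tendsto_marks {ζ : ℕ → X} (hζ : Function.Injective ζ) (hW : ∀ j n, ζ j ∈ (c n).W)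
    {A : Set X} (hA : IsClopen A) (hx : x₀ ∈ A) : ∃ N, ∀ j ≥ N, ζ j ∈ A := by
  obtain ⟨m, hm⟩ := h.G_small hA hx
  have hfin : {j | ζ j ∈ (c m).F}.Finite :=
    (Finset.finite_toSet (c m).F).preimage hζ.injOn
  obtain ⟨N, hN⟩ := hfin.bddAbove
  refine ⟨N + 1, fun j hj => hm m le_rfl ?_⟩
  have hjF : ζ j ∉ (c m).F := fun hj' => by
    have := hN hj'
    omega
  obtain ⟨n, hn | hn⟩ := h.mark_of_mem (hW j)
  · rw [hn]; exact (c m).mem_G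
  · exact h.F_tail hn hjF

theorem exists_sparse (n : ℕ) : ∃ M, ∀ x y, (x ∈ (c M).W ∨ D.τ 1 x ∈ (c M).W) →
    (y ∈ (c M).W ∨ D.τ 1 y ∈ (c M).W) → D.blockRel (c n).W x y → x = y := by
  obtain ⟨L, hL⟩ := (c n).isBase_W.exists_ret_le (D := D)
  obtain ⟨N, hN⟩ := h.exists_lt_return (L + 1)
  refine ⟨max N n, ?_⟩
  set V := (c (max N n)).W
  have hV : ∀ x ∈ V, ∀ k : ℕ, 0 < k → k ≤ L + 1 → D.τ (k : ℤ) x ∉ V := hN _ (le_max_left _ _)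
  have hVW : V ⊆ (c n).W := h.W_anti (le_max_right _ _)
  have key : ∀ z ∈ (c n).W, ∀ i j : ℕ, i < j → j < D.ret (c n).W z →
      (D.τ (i : ℤ) z ∈ V ∨ D.τ 1 (D.τ (i : ℤ) z) ∈ V) →
      (D.τ (j : ℤ) z ∈ V ∨ D.τ 1 (D.τ (j : ℤ) z) ∈ V) → False := by
    intro z hz i j hij hj hi hj'
    have hjL := hj.trans_le (hL z)
    have hjV : D.τ (j : ℤ) z ∉ V := fun hjV => notMem_of_lt_ret (by omega) hj (hVW hjV)
    have hj1 : D.τ ((j + 1 : ℕ) : ℤ) z ∈ V := by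
      rcases hj' with hj' | hj'
      · exact absurd hj' hjV
      · rw [← D.add] at hj'
        convert hj' using 2
        push_cast; ring
    rcases hi with hi | hi
    · refine hV _ hi (j + 1 - i) (by omega) (by omega) ?_
      rw [← D.add]
      convert hj1 using 2
      omega
    · refine hV _ hi (j - i) (by omega) (by omega) ?_
      rw [← D.add, ← D.add]
      convert hj1 using 2
      omega
  intro x y hx hy hxy
  obtain ⟨z, hz, i, hi, j, hj, rfl, rfl⟩ := (c n).isBase_W.exists_of_rel hxy
  rcases lt_trichotomy i j with hij | rfl | hij
  · exact (key z hz i j hij hj hx hy).elim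
  · rfl
  · exact (key z hz j i hij hi hy hx).elim

end MinSys.Cut.Chain

theorem MinSys.exists_towerSys {X : Type} [TopologicalSpace X] [CompactSpace X] [T2Space X]
    [TotallyDisconnectedSpace X] [PerfectSpace X] [SecondCountableTopology X] [Nonempty X]
    (D : MinSys X) (I : LocallyConstant X ℤ →+ ℝ)
    (hI : ∀ f g : LocallyConstant X ℤ, (∀ x, g x = f (D.τ 1 x)) → I g = I f)
    (hpos : ∀ (f : LocallyConstant X ℤ) (x : X), (∀ y, 0 ≤ f y) → 0 < f x → 0 < I f)
    (herg : ∀ f : LocallyConstant X ℤ, 0 < I f → ∃ L : ℕ, ∀ l ≥ L, ∀ x,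
      0 < ∑ i ∈ Finset.range l, f (D.τ (i : ℤ) x)) :
    ∃ S : TowerSys X, S.I = I ∧ (∀ n x y, S.E n x y → ∃ k, D.τ k x = y) ∧
      (∀ j, S.ξ (j, true) = D.τ (-1) (S.ξ (j, false))) ∧
      ∀ x, (∀ j, S.ξ (j, false) ≠ x) → ∃ n, S.E n x (D.τ (-1) x) := by
  obtain ⟨x₀⟩ := ‹Nonempty X›
  obtain ⟨c, C, h⟩ := Cut.exists_chain D x₀
  obtain ⟨ζ, hζ, hζ0, hmem, hζW⟩ := h.exists_marks
  have hb : ∀ n, IsBase (c n).W := fun n => (c n).isBase_W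
  let ξ : ℕ × Bool → X := fun i => D.τ (bif i.2 then -1 else 0) (ζ i.1)
  have hξQ : ∀ i n, ξ i ∈ (c n).W ∨ D.τ 1 (ξ i) ∈ (c n).W := by
    rintro ⟨j, _ | _⟩ n
    · left
      change D.τ 0 (ζ j) ∈ _
      rw [D.zero]
      exact hζW j n
    · right
      change D.τ 1 (D.τ (-1) (ζ j)) ∈ _
      rw [D.τ_neg]
      exact hζW j n
  let S : TowerSys X :=
    { I := I
      E := fun n => D.blockRel (c n).W
      cls := fun n => D.block (c n).W
      mem_cls := (hb _).mem_block
      mono := fun hmn hxy => blockRel_mono (hb _) (hb _) (h.W_anti hmn) hxy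
      θ := fun n => ⟨(c n).θ, (hb n).isLocallyConstant_θ⟩
      θ_inj := fun hxy hh => (hb _).θ_inj hxy hh
      θ_rel := fun hmn hxy => (hb _).θ_rel (hb _) (h.resolves hmn) hxy
      θ_lift := fun hz => (hb _).θ_lift hz
      θ_comp := fun hmn x => h.θ_comp hmn x
      θ_mem := fun A hA => h.θ_mem hA
      pos := fun f hf => by
        obtain ⟨L, hL⟩ := herg f hf
        obtain ⟨N, hN⟩ := h.exists_lt_return L
        refine ⟨N, fun n hn x => ?_⟩
        rw [sum_block]
        refine hL _ ?_ _
        by_contra! hlt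
        obtain ⟨h0, h1⟩ := (hb n).ret_spec (D := D) (D.base (c n).W x)
        exact hN n hn _ ((hb n).base_mem x) _ h0 hlt.le h1
      I_pos := hpos
      E_zero := fun {x y} hxy => by
        have hx : x ∈ (c 0).W := h.zero ▸ trivial
        have hy : y ∈ (c 0).W := h.zero ▸ trivial
        have hxy : D.base (c 0).W x = D.base (c 0).W y := hxy
        rwa [(hb 0).base_of_mem hx, (hb 0).base_of_mem hy] at hxy
      stab := fun n M hnM z => by
        rw [Cut.Chain.closure_block]
        obtain ⟨α, hα, hφ⟩ := h.exists_combo hnM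
          (AddSubgroup.subset_closure ⟨_, (hb n).base_mem z, rfl⟩)
        refine ⟨α, hα, fun φ => (hφ φ).trans ?_⟩
        rw [sum_block]
        exact seg_apply _ _ _
      free := fun n => by
        simp only [Cut.Chain.closure_block]
        exact h.exists_free n I hI
      ξ := ξ
      ξ_inj := by
        rintro ⟨i, b⟩ ⟨j, b'⟩ hij
        have hij : D.τ (bif b then -1 else 0) (ζ i) = D.τ (bif b' then -1 else 0) (ζ j) := hij
        have h1 : D.τ (-(bif b' then -1 else 0) + (bif b then -1 else 0)) (ζ i) = ζ j := by
          rw [D.add, hij, D.neg_τ]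
        have h2 := hζ (h.free_iInter _ (hζW i) _ (hζW j) _ h1)
        subst h2
        have h3 := D.aper _ _ h1
        cases b <;> cases b' <;> simp_all
      ξ_tendsto := fun b A hA hx => by
        have hx : D.τ (bif b then -1 else 0) (ζ 0) ∈ A := hx
        rw [hζ0] at hx
        exact h.tendsto_marks hζ hζW (isClopen_preimage_τ hA (bif b then -1 else 0)) hx
      ξ_sparse := fun n => by
        obtain ⟨M, hM⟩ := h.exists_sparse n
        exact ⟨(c M).W ∪ {x | D.τ 1 x ∈ (c M).W},
          (hb M).clopen.union (isClopen_preimage_τ (hb M).clopen 1), fun i => hξQ i M,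
          fun x y hx hy => hM x y hx hy⟩ }
  refine ⟨S, rfl, fun n x y hxy => ?_, fun j => ?_, fun x hx => ?_⟩
  · obtain ⟨z, -, i, -, j, -, rfl, rfl⟩ := (hb n).exists_of_rel hxy
    exact ⟨j + -i, by rw [D.add, D.neg_τ]⟩
  · change D.τ (-1) (ζ j) = D.τ (-1) (D.τ 0 (ζ j))
    rw [D.zero]
  · have hxW : ∃ n, x ∉ (c n).W := by
      by_contra! hall
      obtain ⟨j, hj⟩ := hmem x (h.mark_of_mem hall)
      refine hx j ?_
      change D.τ 0 (ζ j) = x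
      rw [D.zero, hj]
    obtain ⟨n, hn⟩ := hxW
    refine ⟨n, ?_⟩
    obtain ⟨z, hz, i, hi, rfl⟩ := (hb n).exists_τ_eq (D := D) x
    have hi0 : i ≠ 0 := by
      rintro rfl
      rw [Nat.cast_zero, D.zero] at hn
      exact hn hz
    obtain ⟨k, rfl⟩ := Nat.exists_eq_succ_of_ne_zero hi0
    have e : D.τ (-1) (D.τ ((k + 1 : ℕ) : ℤ) z) = D.τ (k : ℤ) z := by
      rw [← D.add]
      congr 1
      push_cast; ring
    change D.base _ _ = D.base _ _
    rw [e, base_τ hz hi, base_τ hz (by omega)]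

/-! ### Minimal homeomorphisms and invariant measures -/

namespace Homeomorph

variable {X : Type} [TopologicalSpace X]

theorem coe_toEquiv_zpow (T : X ≃ₜ X) (n : ℤ) (x : X) : (T.toEquiv ^ n) x = (T ^ n) x := by
  let φ : (X ≃ₜ X) →* Equiv.Perm X :=
    { toFun := fun g => g.toEquiv, map_one' := rfl, map_mul' := fun _ _ => rfl }
  exact congrArg (fun e : Equiv.Perm X => e x) (map_zpow φ T n).symm

theorem mem_orbit_iff (T : X ≃ₜ X) {x y : X} : y ∈ T.orbit x ↔ ∃ n : ℤ, (T ^ n) x = y := by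
  simp only [orbit, Set.mem_range, coe_toEquiv_zpow]

theorem mem_orbit_self (T : X ≃ₜ X) (x : X) : x ∈ T.orbit x := T.mem_orbit_iff.2 ⟨0, rfl⟩

theorem orbit_trans (T : X ≃ₜ X) {x y z : X} (h : y ∈ T.orbit x) (h' : z ∈ T.orbit y) :
    z ∈ T.orbit x := by
  obtain ⟨m, rfl⟩ := T.mem_orbit_iff.1 h
  obtain ⟨n, rfl⟩ := T.mem_orbit_iff.1 h'
  exact T.mem_orbit_iff.2 ⟨n + m, by rw [zpow_add]; rfl⟩

theorem orbit_symm (T : X ≃ₜ X) {x y : X} (h : y ∈ T.orbit x) : x ∈ T.orbit y := by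
  obtain ⟨m, rfl⟩ := T.mem_orbit_iff.1 h
  refine T.mem_orbit_iff.2 ⟨-m, ?_⟩
  rw [← Homeomorph.mul_apply, ← zpow_add, neg_add_cancel, zpow_zero, Homeomorph.one_apply]

theorem zpow_eq_self_imp_eq_zero [T1Space X] [PerfectSpace X] [Nonempty X] {T : X ≃ₜ X}
    (hT : ∀ x, Dense (T.orbit x)) {k : ℤ} {x : X} (h : (T ^ k) x = x) : k = 0 := by
  by_contra hk
  have hper : ∀ n : ℤ, (T ^ (k * n)) x = x := fun n => by
    have h2 : ∀ n : ℕ, (T ^ (k * n)) x = x := fun n => by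
      induction n with
      | zero => simp
      | succ n ih =>
        rw [Nat.cast_succ, mul_add, mul_one, zpow_add, Homeomorph.mul_apply, h, ih]
    obtain ⟨m, rfl | rfl⟩ := n.eq_nat_or_neg
    · exact h2 m
    · rw [mul_neg, zpow_neg, Homeomorph.inv_apply, Homeomorph.symm_apply_eq]
      exact (h2 m).symm
  have hfin : (T.orbit x).Finite := by
    refine ((Set.finite_Ico 0 |k|).image fun i : ℤ => (T ^ i) x).subset ?_
    intro y hy
    obtain ⟨n, rfl⟩ := T.mem_orbit_iff.1 hy
    refine ⟨n % k, ⟨Int.emod_nonneg _ hk, Int.emod_lt_abs _ hk⟩, ?_⟩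
    conv_rhs => rw [← Int.emod_add_mul_ediv n k, zpow_add, Homeomorph.mul_apply, hper]
  have huniv : (_root_.Set.univ : Set X).Finite := by
    rw [← (hT x).closure_eq, hfin.isClosed.closure_eq]
    exact hfin
  exact infinite_of_mem_nhds x Filter.univ_mem huniv

/-- The integer action generated by a minimal homeomorphism. -/
def minSys [CompactSpace X] [T1Space X] [PerfectSpace X] [Nonempty X] (T : X ≃ₜ X)
    (hT : ∀ x, Dense (T.orbit x)) : MinSys X where
  τ k x := (T ^ k) x
  cont k := (T ^ k).continuous
  zero x := rfl
  add a b x := by rw [zpow_add, Homeomorph.mul_apply]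
  aper k x h := zpow_eq_self_imp_eq_zero hT h
  hit U hU hne := by
    have hcov : (_root_.Set.univ : Set X) ⊆ ⋃ k : ℤ, (T ^ k) ⁻¹' U := fun x _ => by
      obtain ⟨y, hy, hyU⟩ := (hT x).exists_mem_open hU hne
      obtain ⟨k, rfl⟩ := T.mem_orbit_iff.1 hy
      exact Set.mem_iUnion.2 ⟨k, hyU⟩
    obtain ⟨t, ht⟩ := isCompact_univ.elim_finite_subcover _
      (fun k : ℤ => hU.preimage (T ^ k).continuous) hcov
    obtain ⟨M, hM⟩ : ∃ M : ℕ, ∀ k ∈ t, k.natAbs ≤ M :=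
      ⟨t.sup Int.natAbs, fun k hk => Finset.le_sup (f := Int.natAbs) hk⟩
    refine ⟨2 * M + 1, fun x => ?_⟩
    obtain ⟨k, hk, hkU⟩ := Set.mem_iUnion₂.1 (ht (Set.mem_univ ((T ^ (M : ℤ)) x)))
    have := hM k hk
    refine ⟨(k + M).toNat, by omega, ?_⟩
    rw [Int.toNat_of_nonneg (by omega), zpow_add]
    exact hkU

end Homeomorph

/-- Integration of integer valued locally constant functions. -/
noncomputable def LocallyConstant.integral {X : Type} [TopologicalSpace X] [CompactSpace X]
    [MeasurableSpace X] [BorelSpace X] (μ : Measure X) [IsFiniteMeasure μ] :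
    LocallyConstant X ℤ →+ ℝ where
  toFun f := ∫ x, (f x : ℝ) ∂μ
  map_zero' := by simp
  map_add' f g := by
    have h : ∀ f : LocallyConstant X ℤ, Integrable (fun x => (f x : ℝ)) μ := fun f =>
      (BoundedContinuousFunction.mkOfCompact
        ⟨fun x => (f x : ℝ), continuous_of_discreteTopology.comp f.continuous⟩).integrable μ
    simp only [LocallyConstant.coe_add, Pi.add_apply, Int.cast_add]
    exact integral_add (h f) (h g)

section Ergodic

variable {X : Type} [TopologicalSpace X] [CompactSpace X] [MeasurableSpace X] [BorelSpace X]

theorem LocallyConstant.integral_apply (μ : Measure X) [IsFiniteMeasure μ]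
    (f : LocallyConstant X ℤ) : LocallyConstant.integral μ f = ∫ x, (f x : ℝ) ∂μ := rfl

theorem LocallyConstant.integral_charFn (μ : Measure X) [IsFiniteMeasure μ] {A : Set X}
    (hA : IsClopen A) : LocallyConstant.integral μ (LocallyConstant.charFn ℤ hA) = μ.real A := by
  rw [LocallyConstant.integral_apply, ← integral_indicator_one hA.isOpen.measurableSet]
  congr 1
  funext x
  rw [LocallyConstant.coe_charFn]
  by_cases h : x ∈ A <;> simp [h]

omit [CompactSpace X] in
theorem Homeomorph.measurePreserving_zpow (T : X ≃ₜ X) {μ : Measure X}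
    (hμ : μ.map (T : X → X) = μ) (n : ℤ) : MeasurePreserving (T ^ n : X ≃ₜ X) μ μ := by
  have hT : MeasurePreserving T μ μ := ⟨T.continuous.measurable, hμ⟩
  induction n with
  | zero => exact MeasurePreserving.id μ
  | succ n ih => rw [zpow_add_one]; exact ih.comp hT
  | pred n ih => rw [zpow_sub_one]; exact ih.comp (hT.symm T.toMeasurableEquiv)

omit [CompactSpace X] in
theorem Homeomorph.map_eq_of_mem_orbit [T2Space X] [PerfectSpace X] [Nonempty X] {T R : X ≃ₜ X}
    (hT : ∀ x, Dense (T.orbit x)) (hR : ∀ x, R x ∈ T.orbit x) {μ : Measure X}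
    (hμ : μ.map (T : X → X) = μ) : μ.map (R : X → X) = μ := by
  let C : ℤ → Set X := fun n => {x | R x = (T ^ n) x}
  have hCm : ∀ n, MeasurableSet (C n) := fun n =>
    (isClosed_eq R.continuous (T ^ n).continuous).measurableSet
  have hCd : Pairwise (Function.onFun Disjoint C) := fun m n hmn => by
    refine Set.disjoint_left.2 fun x hm hn => hmn ?_
    have h : (T ^ m) x = (T ^ n) x := (Set.mem_ofPred_eq ▸ hm).symm.trans hn
    have h' : (T ^ (-n + m)) x = x := by
      rw [zpow_add, Homeomorph.mul_apply, h, ← Homeomorph.mul_apply, ← zpow_add,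
        neg_add_cancel, zpow_zero, Homeomorph.one_apply]
    have := zpow_eq_self_imp_eq_zero hT h'
    omega
  have hCu : ⋃ n, C n = _root_.Set.univ := Set.eq_univ_of_forall fun x => by
    obtain ⟨n, hn⟩ := T.mem_orbit_iff.1 (hR x)
    exact Set.mem_iUnion.2 ⟨n, hn.symm⟩
  ext A hA
  rw [Measure.map_apply R.continuous.measurable hA]
  have hRC : ∀ n, MeasurableSet (R.symm ⁻¹' C n) := fun n => R.symm.continuous.measurable (hCm n)
  have h1 : R ⁻¹' A = ⋃ n, R ⁻¹' A ∩ C n := by rw [← Set.inter_iUnion, hCu, Set.inter_univ]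
  have h2 : A = ⋃ n, A ∩ R.symm ⁻¹' C n := by
    rw [← Set.inter_iUnion, ← Set.preimage_iUnion, hCu, Set.preimage_univ, Set.inter_univ]
  rw [h1, measure_iUnion (fun m n h => (hCd h).mono Set.inter_subset_right Set.inter_subset_right)
    fun n => (R.continuous.measurable hA).inter (hCm n)]
  conv_rhs => rw [h2]
  rw [measure_iUnion (fun m n h => ((hCd h).preimage R.symm).mono Set.inter_subset_right
    Set.inter_subset_right) fun n => hA.inter (hRC n)]
  refine tsum_congr fun n => ?_
  rw [← (T.measurePreserving_zpow hμ n).measure_preimage (hA.inter (hRC n)).nullMeasurableSet]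
  congr 1
  ext x
  simp only [Set.mem_inter_iff, Set.mem_preimage]
  constructor
  · rintro ⟨hA, hx⟩
    have hx' : R x = (T ^ n) x := hx
    rw [← hx', R.symm_apply_apply]
    exact ⟨hA, hx⟩
  · rintro ⟨hA, hx⟩
    have hx' : R (R.symm ((T ^ n) x)) = (T ^ n) (R.symm ((T ^ n) x)) := hx
    rw [R.apply_symm_apply] at hx'
    rw [← (T ^ n).injective hx'] at hx
    have hRx : R x = (T ^ n) x := hx
    exact ⟨hRx ▸ hA, hx⟩

theorem Homeomorph.measure_pos_of_isOpen [T1Space X] [PerfectSpace X] [Nonempty X] {T : X ≃ₜ X}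
    (hT : ∀ x, Dense (T.orbit x)) {μ : Measure X} [IsProbabilityMeasure μ]
    (hμ : μ.map (T : X → X) = μ) {U : Set X} (hU : IsOpen U) (hne : U.Nonempty) : 0 < μ U := by
  obtain ⟨N, hN⟩ := (T.minSys hT).hit U hU hne
  refine pos_iff_ne_zero.2 fun h0 => ?_
  have h1 : μ (⋃ i : Fin N, (T ^ ((i : ℕ) : ℤ)) ⁻¹' U) = 0 :=
    measure_iUnion_null fun i => by
      rw [(T.measurePreserving_zpow hμ _).measure_preimage hU.measurableSet.nullMeasurableSet, h0]
  have h2 : (⋃ i : Fin N, (T ^ ((i : ℕ) : ℤ)) ⁻¹' U) = _root_.Set.univ :=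
    Set.eq_univ_of_forall fun x => by
      obtain ⟨i, hi, hx⟩ := hN x
      exact Set.mem_iUnion.2 ⟨⟨i, hi⟩, hx⟩
  rw [h2, measure_univ] at h1
  exact one_ne_zero h1

/-- The uniform probability measure on an initial segment of an orbit. -/
noncomputable def MinSys.empirical (D : MinSys X) (l : ℕ) (x : X) : Measure X :=
  ((l + 1 : ℕ) : ENNReal)⁻¹ • ∑ i ∈ Finset.range (l + 1), Measure.dirac (D.τ (i : ℤ) x)

instance (D : MinSys X) (l : ℕ) (x : X) : IsProbabilityMeasure (D.empirical l x) := ⟨by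
  simp only [MinSys.empirical, Measure.smul_apply, Measure.finsetSum_apply, measure_univ,
    Finset.sum_const, Finset.card_range, smul_eq_mul, nsmul_eq_mul, mul_one]
  exact ENNReal.inv_mul_cancel (by simp) (ENNReal.natCast_ne_top _)⟩

theorem MinSys.integral_empirical (D : MinSys X) (l : ℕ) (x : X) {g : X → ℝ}
    (hg : Continuous g) : ∫ y, g y ∂(D.empirical l x) =
      ((l : ℝ) + 1)⁻¹ * ∑ i ∈ Finset.range (l + 1), g (D.τ (i : ℤ) x) := by
  rw [MinSys.empirical, integral_smul_measure, integral_finsetSum_measure]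
  · simp only [integral_dirac' _ _ hg.stronglyMeasurable]
    rw [ENNReal.toReal_inv, ENNReal.toReal_natCast, Nat.cast_succ, smul_eq_mul]
  · exact fun i _ => (BoundedContinuousFunction.mkOfCompact ⟨g, hg⟩).integrable _

theorem MinSys.abs_integral_empirical_sub_le (D : MinSys X) (l : ℕ) (x : X)
    (g : BoundedContinuousFunction X ℝ) :
    |∫ y, g (D.τ 1 y) ∂(D.empirical l x) - ∫ y, g y ∂(D.empirical l x)| ≤
      ((l : ℝ) + 1)⁻¹ * (2 * ‖g‖) := by
  rw [D.integral_empirical l x (g := fun y => g (D.τ 1 y)) (g.continuous.comp (D.cont 1)),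
    D.integral_empirical l x g.continuous, ← mul_sub, abs_mul, abs_of_pos (by positivity),
    ← Finset.sum_sub_distrib]
  have h : ∀ i : ℕ, D.τ 1 (D.τ (i : ℤ) x) = D.τ ((i + 1 : ℕ) : ℤ) x := fun i => by
    rw [← D.add]; congr 1; push_cast; ring
  simp only [h]
  rw [Finset.sum_range_sub (fun i => g (D.τ (i : ℤ) x))]
  gcongr
  have h1 := g.norm_coe_le_norm (D.τ ((l + 1 : ℕ) : ℤ) x)
  have h2 := g.norm_coe_le_norm (D.τ ((0 : ℕ) : ℤ) x)
  rw [← Real.norm_eq_abs]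
  linarith [norm_sub_le (g (D.τ ((l + 1 : ℕ) : ℤ) x)) (g (D.τ ((0 : ℕ) : ℤ) x))]

theorem MinSys.exists_forall_sum_pos [TopologicalSpace.MetrizableSpace X]
    (D : MinSys X) {μ : Measure X}
    (huniq : ∀ μ' : Measure X, IsProbabilityMeasure μ' → μ'.map (D.τ 1) = μ' → μ' = μ)
    {f : X → ℝ} (hf : Continuous f) (hpos : 0 < ∫ x, f x ∂μ) :
    ∃ L : ℕ, ∀ l ≥ L, ∀ x, 0 < ∑ i ∈ Finset.range l, f (D.τ (i : ℤ) x) := by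
  by_contra! hcon
  have hcon' : ∀ L : ℕ, ∃ l x, L ≤ l ∧ ∑ i ∈ Finset.range (l + 1), f (D.τ (i : ℤ) x) ≤ 0 := by
    intro L
    obtain ⟨l, hl, x, hx⟩ := hcon (L + 1)
    obtain ⟨l, rfl⟩ := Nat.exists_eq_succ_of_ne_zero (show l ≠ 0 by omega)
    exact ⟨l, x, by omega, hx⟩
  choose l x hl hx using hcon'
  let u : ℕ → ProbabilityMeasure X := fun n => ⟨D.empirical (l n) (x n), inferInstance⟩
  let F : Ultrafilter ℕ := Filter.hyperfilter ℕ
  have hF : (F : Filter ℕ) ≤ Filter.atTop := Nat.hyperfilter_le_atTop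
  obtain ⟨m, hm⟩ : ∃ m : ProbabilityMeasure X, Filter.Tendsto u F (nhds m) :=
    ⟨_, (F.map u).le_nhds_lim⟩
  have hlim := ProbabilityMeasure.tendsto_iff_forall_integral_tendsto.1 hm
  have hinv : (m : Measure X).map (D.τ 1) = m := by
    have : IsProbabilityMeasure ((m : Measure X).map (D.τ 1)) :=
      Measure.isProbabilityMeasure_map (D.cont 1).measurable.aemeasurable
    refine ext_of_forall_integral_eq_of_IsFiniteMeasure fun g => ?_
    rw [integral_map (D.cont 1).measurable.aemeasurable g.continuous.aestronglyMeasurable,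
      ← sub_eq_zero]
    have h1 := (hlim (g.compContinuous ⟨D.τ 1, D.cont 1⟩)).sub (hlim g)
    refine tendsto_nhds_unique h1 (squeeze_zero_norm (a := fun n : ℕ =>
      ((n : ℝ) + 1)⁻¹ * (2 * ‖g‖)) (fun n => ?_) ?_)
    · refine (D.abs_integral_empirical_sub_le (l n) (x n) g).trans ?_
      have := hl n
      gcongr
    · have h := (tendsto_one_div_add_atTop_nhds_zero_nat (𝕜 := ℝ)).mul_const (2 * ‖g‖)
      simp only [one_div, zero_mul] at h
      exact h.mono_left hF
  have hle : ∫ y, f y ∂(m : Measure X) ≤ 0 := by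
    refine le_of_tendsto (hlim (BoundedContinuousFunction.mkOfCompact ⟨f, hf⟩))
      (Filter.Eventually.of_forall fun n => ?_)
    refine (D.integral_empirical (l n) (x n) hf).trans_le ?_
    exact mul_nonpos_of_nonneg_of_nonpos (by positivity) (hx n)
  rw [huniq m inferInstance hinv] at hle
  exact hle.not_gt hpos

end Ergodic

/-! ### Orbit equivalence -/

/-- If `h` maps `T⁻¹ x` into the orbit of `h x` for all `x`, it maps orbits into orbits. -/
theorem Homeomorph.mem_orbit_of_forall_symm {X Y : Type} [TopologicalSpace X] [TopologicalSpace Y]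
    {T : X ≃ₜ X} {S : Y ≃ₜ Y} {h : X → Y} (H : ∀ x, h (T.symm x) ∈ S.orbit (h x)) {x y : X}
    (hy : y ∈ T.orbit x) : h y ∈ S.orbit (h x) := by
  obtain ⟨n, rfl⟩ := T.mem_orbit_iff.1 hy
  clear hy
  induction n with
  | zero => exact S.mem_orbit_self _
  | succ n ih =>
    refine S.orbit_trans ih (S.orbit_symm ?_)
    convert! H ((T ^ ((n : ℤ) + 1)) x) using 2
    rw [add_comm, zpow_one_add, Homeomorph.mul_apply, T.symm_apply_apply]
  | pred n ih =>
    refine S.orbit_trans ih ?_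
    convert! H ((T ^ (-(n : ℤ))) x) using 2
    rw [sub_eq_neg_add, zpow_add, zpow_neg_one]
    rfl

/-- The properties of a tower system representing a uniquely ergodic minimal homeomorphism. -/
structure TowerSys.Represents {X : Type} [TopologicalSpace X] (E : TowerSys X) (T : X ≃ₜ X) :
    Prop where
  mem_orbit : ∀ n x y, E.E n x y → y ∈ T.orbit x
  ξ_true : ∀ j, E.ξ (j, true) = T.symm (E.ξ (j, false))
  exists_rel : ∀ x, (∀ j, E.ξ (j, false) ≠ x) → ∃ n, E.E n x (T.symm x)

theorem TowerSys.Represents.mem_orbit_of_map {X Y : Type} [TopologicalSpace X] [TopologicalSpace Y]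
    {E : TowerSys X} {E' : TowerSys Y} {T : X ≃ₜ X} {S : Y ≃ₜ Y} (hE : E.Represents T)
    (hE' : E'.Represents S) {h : X → Y} (hξ : ∀ i, h (E.ξ i) = E'.ξ i)
    (hrel : ∀ n x x', E.E n x x' → ∃ m, E'.E m (h x) (h x')) {x y : X} (hy : y ∈ T.orbit x) :
    h y ∈ S.orbit (h x) := by
  refine Homeomorph.mem_orbit_of_forall_symm (fun x => ?_) hy
  by_cases hx : ∃ j, E.ξ (j, false) = x
  · obtain ⟨j, rfl⟩ := hx
    rw [← hE.ξ_true, hξ, hξ, hE'.ξ_true]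
    exact S.mem_orbit_iff.2 ⟨-1, by rw [zpow_neg_one]; rfl⟩
  · push Not at hx
    obtain ⟨n, hn⟩ := hE.exists_rel x hx
    obtain ⟨m, hm⟩ := hrel _ _ _ hn
    exact hE'.mem_orbit _ _ _ hm

section UniquelyErgodic

variable {X : Type} [TopologicalSpace X] [CompactSpace X] [TopologicalSpace.MetrizableSpace X]
  [TotallyDisconnectedSpace X] [PerfectSpace X] [Nonempty X] [MeasurableSpace X] [BorelSpace X]

theorem Homeomorph.exists_towerSys_represents (T : X ≃ₜ X) (hT : ∀ x, Dense (T.orbit x))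
    (μ : Measure X) [IsProbabilityMeasure μ] (hμ : μ.map (T : X → X) = μ)
    (huniq : ∀ μ' : Measure X, IsProbabilityMeasure μ' → μ'.map (T : X → X) = μ' → μ' = μ) :
    ∃ E : TowerSys X, E.I = LocallyConstant.integral μ ∧ E.Represents T := by
  have hc : ∀ f : LocallyConstant X ℤ, Continuous fun x => (f x : ℝ) := fun f =>
    continuous_of_discreteTopology.comp f.continuous
  have hτ : ∀ x, (T.minSys hT).τ 1 x = T x := fun x => by
    change (T ^ (1 : ℤ)) x = T x
    rw [zpow_one]
  have hτ' : ∀ x, (T.minSys hT).τ (-1) x = T.symm x := fun x => by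
    change (T ^ (-1 : ℤ)) x = T.symm x
    rw [zpow_neg_one, Homeomorph.inv_apply]
  have hτf : (T.minSys hT).τ 1 = T := funext hτ
  have hinv : ∀ f g : LocallyConstant X ℤ, (∀ x, g x = f ((T.minSys hT).τ 1 x)) →
      LocallyConstant.integral μ g = LocallyConstant.integral μ f := fun f g hfg => by
    simp only [LocallyConstant.integral_apply, hfg, hτ]
    rw [← integral_map (φ := T) (f := fun y => (f y : ℝ)) T.continuous.measurable.aemeasurable
      (hc f).aestronglyMeasurable, hμ]
  have hpos : ∀ (f : LocallyConstant X ℤ) x, (∀ y, 0 ≤ f y) → 0 < f x →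
      0 < LocallyConstant.integral μ f := fun f x h0 hx => by
    rw [LocallyConstant.integral_apply, integral_pos_iff_support_of_nonneg
      (f := fun y => (f y : ℝ)) (fun y => Int.cast_nonneg (h0 y))
      ((BoundedContinuousFunction.mkOfCompact ⟨_, hc f⟩).integrable μ)]
    refine T.measure_pos_of_isOpen hT hμ (hc f).isOpen_support ⟨x, ?_⟩
    exact Int.cast_ne_zero.2 hx.ne'
  have herg : ∀ f : LocallyConstant X ℤ, 0 < LocallyConstant.integral μ f → ∃ L : ℕ, ∀ l ≥ L,
      ∀ x, 0 < ∑ i ∈ Finset.range l, f ((T.minSys hT).τ (i : ℤ) x) := fun f hf => by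
    obtain ⟨L, hL⟩ := (T.minSys hT).exists_forall_sum_pos (by rwa [hτf]) (hc f) hf
    exact ⟨L, fun l hl x => by exact_mod_cast hL l hl x⟩
  obtain ⟨E, hI, h1, h2, h3⟩ := (T.minSys hT).exists_towerSys _ hinv hpos herg
  refine ⟨E, hI, fun n x y h => T.mem_orbit_iff.2 (h1 n x y h), fun j => ?_, fun x hx => ?_⟩
  · rw [h2, hτ']
  · rw [← hτ']
    exact h3 x hx

end UniquelyErgodic

theorem LocallyConstant.exists_integral_eq {X Y : Type} [TopologicalSpace X] [CompactSpace X]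
    [MeasurableSpace X] [BorelSpace X] [TopologicalSpace Y] [CompactSpace Y] [MeasurableSpace Y]
    [BorelSpace Y] {μ : Measure X} {ν : Measure Y} [IsFiniteMeasure μ] [IsFiniteMeasure ν]
    (h : clopenValues μ ⊆ clopenValues ν) (f : LocallyConstant X ℤ) :
    ∃ g : LocallyConstant Y ℤ, LocallyConstant.integral ν g = LocallyConstant.integral μ f := by
  have hfin : (Set.range f).Finite := f.range_finite
  have hlev : ∀ c : ℤ, IsClopen {x | f x = c} := fun c => f.isLocallyConstant.isClopen_fiber c
  have hsum : f = ∑ c ∈ hfin.toFinset, c • LocallyConstant.charFn ℤ (hlev c) := by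
    refine LocallyConstant.ext fun x => ?_
    rw [← LocallyConstant.coeFnAddMonoidHom_apply (∑ c ∈ hfin.toFinset, _), map_sum,
      Finset.sum_apply, Finset.sum_eq_single (f x)]
    · rw [map_zsmul, Pi.smul_apply, LocallyConstant.coeFnAddMonoidHom_apply,
        (LocallyConstant.charFn_eq_one ℤ x (hlev (f x))).2 rfl, smul_eq_mul, mul_one]
    · intro c _ hc
      rw [map_zsmul, Pi.smul_apply, LocallyConstant.coeFnAddMonoidHom_apply,
        (LocallyConstant.charFn_eq_zero ℤ x (hlev c)).2 fun h => hc h.symm, smul_zero]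
    · exact fun h => (h (hfin.mem_toFinset.2 ⟨x, rfl⟩)).elim
  rw [hsum, map_sum]
  have hc : ∀ c : ℤ, ∃ g : LocallyConstant Y ℤ, LocallyConstant.integral ν g =
      LocallyConstant.integral μ (c • LocallyConstant.charFn ℤ (hlev c)) := fun c => by
    obtain ⟨B, hB, hBA⟩ := h ⟨_, hlev c, rfl⟩
    refine ⟨c • LocallyConstant.charFn ℤ hB, ?_⟩
    rw [map_zsmul, map_zsmul, LocallyConstant.integral_charFn, LocallyConstant.integral_charFn,
      measureReal_def, measureReal_def, hBA]
  choose g hg using hc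
  exact ⟨∑ c ∈ hfin.toFinset, g c, by rw [map_sum]; exact Finset.sum_congr rfl fun c _ => hg c⟩

theorem LocallyConstant.integral_one {X : Type} [TopologicalSpace X] [CompactSpace X]
    [MeasurableSpace X] [BorelSpace X] (μ : Measure X) [IsProbabilityMeasure μ] :
    LocallyConstant.integral μ 1 = 1 := by
  simp [LocallyConstant.integral_apply]

theorem OrbitEquivalent.symm {X Y : Type} [TopologicalSpace X] [TopologicalSpace Y]
    {T : X ≃ₜ X} {S : Y ≃ₜ Y} (H : OrbitEquivalent T S) : OrbitEquivalent S T := by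
  obtain ⟨h, hh⟩ := H
  refine ⟨h.symm, fun y => ?_⟩
  rw [← h.apply_symm_apply y, ← hh, h.symm_apply_apply, Set.image_image]
  simp

theorem OrbitEquivalent.clopenValues_subset {X Y : Type}
    [TopologicalSpace X] [T2Space X] [PerfectSpace X] [Nonempty X]
    [CompactSpace X] [MeasurableSpace X] [BorelSpace X]
    [TopologicalSpace Y] [MeasurableSpace Y] [BorelSpace Y] {T : X ≃ₜ X} {S : Y ≃ₜ Y}
    (H : OrbitEquivalent T S) (hT : ∀ x, Dense (T.orbit x)) {μ : Measure X}
    [IsProbabilityMeasure μ] (hμ : μ.map (T : X → X) = μ) {ν : Measure Y}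
    (huniq : ∀ ν' : Measure Y, IsProbabilityMeasure ν' → ν'.map (S : Y → Y) = ν' → ν' = ν) :
    clopenValues ν ⊆ clopenValues μ := by
  obtain ⟨h, hh⟩ := H
  have hR : ∀ x, (h.trans (S.trans h.symm)) x ∈ T.orbit x := fun x => by
    have h1 : S (h x) ∈ (h : X → Y) '' T.orbit x := by
      rw [hh]
      exact S.mem_orbit_iff.2 ⟨1, by rw [zpow_one]⟩
    obtain ⟨y, hy, hyx⟩ := h1
    change h.symm (S (h x)) ∈ T.orbit x
    rwa [← hyx, h.symm_apply_apply]
  have hν : μ.map h = ν := by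
    refine huniq _ (Measure.isProbabilityMeasure_map h.continuous.measurable.aemeasurable) ?_
    conv_rhs => rw [← Homeomorph.map_eq_of_mem_orbit hT hR hμ]
    rw [Measure.map_map S.continuous.measurable h.continuous.measurable,
      Measure.map_map h.continuous.measurable (Homeomorph.continuous _).measurable]
    congr 1
    funext x
    exact (h.apply_symm_apply _).symm
  rintro _ ⟨B, hB, rfl⟩
  refine ⟨h ⁻¹' B, hB.preimage h.continuous, ?_⟩
  rw [← hν, Measure.map_apply h.continuous.measurable hB.isOpen.measurableSet]

/-- **Giordano–Putnam–Skau.** Two uniquely ergodic minimal Cantor systems are orbit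
equivalent iff their unique invariant measures have the same clopen values set. -/
theorem uniquelyErgodic_orbitEquivalent_iff_clopenValues_eq
    (X Y : Type)
    [TopologicalSpace X] [CompactSpace X] [TopologicalSpace.MetrizableSpace X]
    [TotallyDisconnectedSpace X] [PerfectSpace X] [Nonempty X]
    [MeasurableSpace X] [BorelSpace X]
    [TopologicalSpace Y] [CompactSpace Y] [TopologicalSpace.MetrizableSpace Y]
    [TotallyDisconnectedSpace Y] [TotallyDisconnectedSpace Y] [PerfectSpace Y] [Nonempty Y]
    [MeasurableSpace Y] [BorelSpace Y]
    (T : X ≃ₜ X) (S : Y ≃ₜ Y)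
    (hTmin : ∀ x : X, Dense (T.orbit x))
    (hSmin : ∀ y : Y, Dense (S.orbit y))
    (μ : Measure X) (ν : Measure Y)
    (hμ : IsProbabilityMeasure μ) (hμinv : μ.map (T : X → X) = μ)
    (hμuniq : ∀ μ' : Measure X,
      IsProbabilityMeasure μ' → μ'.map (T : X → X) = μ' → μ' = μ)
    (hν : IsProbabilityMeasure ν) (hνinv : ν.map (S : Y → Y) = ν)
    (hνuniq : ∀ ν' : Measure Y,
      IsProbabilityMeasure ν' → ν'.map (S : Y → Y) = ν' → ν' = ν) :
    OrbitEquivalent T S ↔ clopenValues μ = clopenValues ν := by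
  have : SecondCountableTopology X := inferInstance
  constructor
  · intro H
    exact Set.Subset.antisymm (H.symm.clopenValues_subset hSmin hνinv hμuniq)
      (H.clopenValues_subset hTmin hμinv hνuniq)
  · intro hval
    obtain ⟨E, hI, hE⟩ := T.exists_towerSys_represents hTmin μ hμinv hμuniq
    obtain ⟨E', hI', hE'⟩ := S.exists_towerSys_represents hSmin ν hνinv hνuniq
    obtain ⟨h, hξ, hrel, hrel'⟩ := TowerSys.exists_homeomorph E E'
      (by rw [hI, hI', LocallyConstant.integral_one, LocallyConstant.integral_one])
      (by rw [hI, hI']; exact LocallyConstant.exists_integral_eq hval.subset)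
      (by rw [hI, hI']; exact LocallyConstant.exists_integral_eq hval.symm.subset)
    refine ⟨h, fun x => Set.Subset.antisymm ?_ fun y hy => ?_⟩
    · rintro _ ⟨y, hy, rfl⟩
      exact hE.mem_orbit_of_map hE' hξ hrel hy
    · have hξ' : ∀ i, h.symm (E'.ξ i) = E.ξ i := fun i => by rw [← hξ, h.symm_apply_apply]
      have := hE'.mem_orbit_of_map hE hξ' hrel' hy
      rw [h.symm_apply_apply] at this
      exact ⟨_, this, h.apply_symm_apply y⟩
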